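/- arXiv:math/0407152 — 2 statements merged into one kernel-verified Lean document; each statement's English description precedes it below -/
import Mathlib

section
/- Let n ≥ 1 and m ≥ 2. (a) Z(–) and I(–) are mutually inverse inclusion-reversing bijections between Spec_n(G_{m,n}) and the set of irreducible n-varieties X ⊆ U_{m,n}. (b) Z(–) and I_T(–) are mutually inverse inclusion-reversing bijections between Spec_n(T_{m,n}) and the set of irreducible n-varieties X ⊆ U_{m,n}. -/
set_option linter.unusedSectionVars false

noncomputable section

universe u

-- Throughout, `k` is an algebraically closed base field of characteristic zero.
variable (k : Type) [Field k] [IsAlgClosed k] [CharZero k]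

/-- Index type for the `m·n²` commuting variables `x_{ij}^{(h)}`. -/
abbrev MIdx (n m : ℕ) := Fin m × Fin n × Fin n

/-- The commutative polynomial ring `k[x_{ij}^{(h)}]`. -/
abbrev PolyRing (n m : ℕ) := MvPolynomial (MIdx n m) k

/-- Matrices over the polynomial ring `k[x_{ij}^{(h)}]`. -/
abbrev MatPoly (n m : ℕ) := Matrix (Fin n) (Fin n) (PolyRing k n m)

/-- The space `(M_n)^m` of `m`-tuples of `n×n` matrices over `k`. -/
abbrev MTuple (n m : ℕ) := Fin m → Matrix (Fin n) (Fin n) k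

/-- The `h`-th generic `n×n` matrix `X_h = (x_{ij}^{(h)})`. -/
def genericMatrix (n m : ℕ) (h : Fin m) : MatPoly k n m :=
  Matrix.of fun i j => MvPolynomial.X (h, i, j)

/-- `G_{m,n}`, the algebra of `m` generic `n×n` matrices: the `k`-subalgebra of
`M_n(k[x_{ij}^{(h)}])` generated by the generic matrices. -/
def GMN (n m : ℕ) : Subalgebra k (MatPoly k n m) :=
  Algebra.adjoin k (Set.range (genericMatrix k n m))

/-- Evaluation of the commuting variables at a point `a ∈ (M_n)^m`. -/
def polyEval {n m : ℕ} (a : MTuple k n m) : PolyRing k n m →ₐ[k] k :=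
  MvPolynomial.aeval fun x : MIdx n m => a x.1 x.2.1 x.2.2

/-- Evaluation of matrix-valued polynomials at a point `a ∈ (M_n)^m`; under this
map an element of `G_{m,n}` (or `T_{m,n}`) becomes a `PGL_n`-equivariant polynomial
map `(M_n)^m → M_n`. -/
def evalMat {n m : ℕ} (a : MTuple k n m) :
    MatPoly k n m →ₐ[k] Matrix (Fin n) (Fin n) k :=
  (polyEval k a).mapMatrix

/-- The scalar matrix `tr(p)·1 ∈ M_n(k[x_{ij}^{(h)}])`. -/
def traceScalar {n m : ℕ} (p : MatPoly k n m) : MatPoly k n m :=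
  algebraMap (PolyRing k n m) (MatPoly k n m) (Matrix.trace p)

/-- `T_{m,n}`, the trace ring of `G_{m,n}`: the `k`-algebra generated inside
`M_n(k[x_{ij}^{(h)}])` by `G_{m,n}` together with the traces of its elements. -/
def TMN (n m : ℕ) : Subalgebra k (MatPoly k n m) :=
  Algebra.adjoin k ((GMN k n m : Set (MatPoly k n m)) ∪
    (traceScalar k '' (GMN k n m : Set (MatPoly k n m))))

lemma GMN_le_TMN (n m : ℕ) : GMN k n m ≤ TMN k n m :=
  fun _ hx => Algebra.subset_adjoin (Or.inl hx)

/-- The inclusion `G_{m,n} → T_{m,n}`. -/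
def inclGT (n m : ℕ) : ↥(GMN k n m) →+* ↥(TMN k n m) :=
  (Subalgebra.inclusion (GMN_le_TMN k n m) : ↥(GMN k n m) →ₐ[k] ↥(TMN k n m)).toRingHom

/-- `U_{m,n}`: the set of `m`-tuples of `n×n` matrices generating `M_n` as a
`k`-algebra. -/
def genTuples (n m : ℕ) : Set (MTuple k n m) :=
  {a | Algebra.adjoin k (Set.range a) = ⊤}

/-- Simultaneous conjugation of an `m`-tuple by `g ∈ GL_n(k)`; since scalar
matrices act trivially, this is the `PGL_n`-action on `(M_n)^m`. -/
def conjAct {n m : ℕ} (g : GL (Fin n) k) (a : MTuple k n m) : MTuple k n m :=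
  fun i =>
    (g : Matrix (Fin n) (Fin n) k) * a i * ((g⁻¹ : GL (Fin n) k) : Matrix (Fin n) (Fin n) k)

/-- Zariski closed subsets of `(M_n)^m`. -/
def IsZClosed {n m : ℕ} (C : Set (MTuple k n m)) : Prop :=
  ∃ S : Set (PolyRing k n m), C = {a | ∀ p ∈ S, polyEval k a p = 0}

/-- `X` is an `n`-variety: a closed `PGL_n`-invariant subvariety of `U_{m,n}`,
i.e. `X = X̄ ∩ U_{m,n}` where `X̄` is the Zariski closure of `X` in `(M_n)^m`. -/
def IsNVariety {n m : ℕ} (X : Set (MTuple k n m)) : Prop :=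
  X ⊆ genTuples k n m ∧
  (∀ g : GL (Fin n) k, ∀ a ∈ X, conjAct k g a ∈ X) ∧
  ∃ C, IsZClosed k C ∧ X = C ∩ genTuples k n m

/-- Irreducibility of a subset of `(M_n)^m` with respect to the Zariski topology. -/
def IsIrredSubset {n m : ℕ} (X : Set (MTuple k n m)) : Prop :=
  X.Nonempty ∧ ∀ C₁ C₂ : Set (MTuple k n m), IsZClosed k C₁ → IsZClosed k C₂ →
    X ⊆ C₁ ∪ C₂ → X ⊆ C₁ ∨ X ⊆ C₂

/-- The zero locus in `U_{m,n}` of a set of matrix-valued polynomials. -/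
def zeroLocus {n m : ℕ} (S : Set (MatPoly k n m)) : Set (MTuple k n m) :=
  {a | a ∈ genTuples k n m ∧ ∀ p ∈ S, evalMat k a p = 0}

/-- The zero locus in `U_{m,n}` of a two-sided ideal of a subalgebra `A` of
`M_n(k[x_{ij}^{(h)}])` (such as `G_{m,n}` or `T_{m,n}`). -/
def zeroLocusI {n m : ℕ} {A : Subalgebra k (MatPoly k n m)} (J : TwoSidedIdeal ↥A) :
    Set (MTuple k n m) :=
  {a | a ∈ genTuples k n m ∧ ∀ p : ↥A, p ∈ J → evalMat k a (p : MatPoly k n m) = 0}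

/-- The vanishing (two-sided) ideal of a subset `X ⊆ (M_n)^m` in a subalgebra `A`
of `M_n(k[x_{ij}^{(h)}])`; for `A = G_{m,n}` this is `I(X)`, for `A = T_{m,n}`
this is `I_T(X)`. -/
def vanishIdeal {n m : ℕ} (A : Subalgebra k (MatPoly k n m)) (X : Set (MTuple k n m)) :
    TwoSidedIdeal ↥A :=
  TwoSidedIdeal.mk' {p : ↥A | ∀ a ∈ X, evalMat k a (p : MatPoly k n m) = 0}
    (fun a _ => by simp)
    (fun {p q} hp hq a ha => by
      have : ((p + q : ↥A) : MatPoly k n m) = (p : MatPoly k n m) + q := rfl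
      simp [this, map_add, hp a ha, hq a ha])
    (fun {p} hp a ha => by
      have : ((-p : ↥A) : MatPoly k n m) = -(p : MatPoly k n m) := rfl
      simp [this, map_neg, hp a ha])
    (fun {p q} hq a ha => by
      have : ((p * q : ↥A) : MatPoly k n m) = (p : MatPoly k n m) * q := rfl
      simp [this, map_mul, hq a ha])
    (fun {p q} hp a ha => by
      have : ((p * q : ↥A) : MatPoly k n m) = (p : MatPoly k n m) * q := rfl
      simp [this, map_mul, hp a ha])

/-- Restriction: a matrix-valued polynomial gives an `M_n`-valued function on `X`. -/
def restrictTo {n m : ℕ} (X : Set (MTuple k n m)) :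
    MatPoly k n m →ₐ[k] (X → Matrix (Fin n) (Fin n) k) :=
  Pi.algHom k _ fun a => evalMat k a.val

/-- The PI-coordinate ring `k_n[X] = G_{m,n}/I(X)`, realized concretely as the
algebra of all restrictions to `X` of elements of `G_{m,n}` (i.e. of
`PGL_n`-equivariant morphisms `X → M_n` coming from `G_{m,n}`). -/
def coordRing {n m : ℕ} (X : Set (MTuple k n m)) :
    Subalgebra k (X → Matrix (Fin n) (Fin n) k) :=
  (GMN k n m).map (restrictTo k X)

/-- The ring `T_{m,n}/I_T(X)`, realized concretely as the algebra of all
restrictions to `X` of elements of `T_{m,n}`. -/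
def coordTraceRing {n m : ℕ} (X : Set (MTuple k n m)) :
    Subalgebra k (X → Matrix (Fin n) (Fin n) k) :=
  (TMN k n m).map (restrictTo k X)

/-- A ring is prime if it is nonzero and `a·R·b = 0` implies `a = 0` or `b = 0`. -/
def IsPrimeRing (R : Type u) [Ring R] : Prop :=
  Nontrivial R ∧ ∀ a b : R, (∀ x : R, a * x * b = 0) → a = 0 ∨ b = 0

/-- `Q` is a central simple algebra of degree `n`: a simple ring whose center is a
field, and which has dimension `n²` over its center. -/
def IsCSAOfDegree (n : ℕ) (Q : Type u) [Ring Q] : Prop :=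
  IsSimpleRing Q ∧
  ∃ (K : Type u) (_ : Field K) (_ : Algebra K Q),
    (algebraMap K Q).range = Subring.center Q ∧ Module.finrank K Q = n ^ 2

/-- A (prime PI-) ring `R` has PI-degree `n` if its total ring of fractions — the
central localization of `R` at its nonzero central elements — is a central simple
algebra of degree `n`. -/
def HasPIDegree (n : ℕ) (R : Type u) [Ring R] : Prop :=
  ∃ (Q : Type u) (_ : Ring Q) (f : R →+* Q),
    Function.Injective f ∧
    (∀ c ∈ Subring.center R, c ≠ 0 → IsUnit (f c)) ∧
    (∀ q : Q, ∃ r : R, ∃ c ∈ Subring.center R, c ≠ 0 ∧ q * f c = f r) ∧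
    IsCSAOfDegree n Q

/-- The quotient of a ring by a two-sided ideal. -/
abbrev idealQuot {R : Type u} [Ring R] (J : TwoSidedIdeal R) : Type u := J.ringCon.Quotient

/-- `Spec_n(R)`: the set of prime (two-sided) ideals `J` of `R` such that `R/J` is a
prime ring of PI-degree `n`. -/
def SpecN (n : ℕ) (R : Type u) [Ring R] : Set (TwoSidedIdeal R) :=
  {J | IsPrimeRing (idealQuot J) ∧ HasPIDegree n (idealQuot J)}

/-- A regular map of `n`-varieties `X → Y ⊆ U_{l,n}`: a map of the form
`a ↦ (f₁(a), …, f_l(a))` with each `f_i ∈ k_n[X]`, i.e. each component is the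
restriction to `X` of an element of `G_{m,n}`. -/
def IsRegMapOn {n m l : ℕ} (X : Set (MTuple k n m)) (Y : Set (MTuple k n l))
    (φ : MTuple k n m → MTuple k n l) : Prop :=
  (∀ a ∈ X, φ a ∈ Y) ∧
  ∃ F : Fin l → MatPoly k n m, (∀ i, F i ∈ GMN k n m) ∧
    ∀ a ∈ X, ∀ i, φ a i = evalMat k a (F i)

/-- `X` and `Y` are isomorphic `n`-varieties: there are mutually inverse regular
maps of `n`-varieties between them. -/
def NIsomorphic {n m l : ℕ} (X : Set (MTuple k n m)) (Y : Set (MTuple k n l)) : Prop :=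
  ∃ (φ : MTuple k n m → MTuple k n l) (ψ : MTuple k n l → MTuple k n m),
    IsRegMapOn k X Y φ ∧ IsRegMapOn k Y X ψ ∧
    (∀ a ∈ X, ψ (φ a) = a) ∧ (∀ b ∈ Y, φ (ψ b) = b)
/-! ### Matrix identities over a commutative ring -/
section MatrixIdentities

variable {R : Type*} [CommRing R] {n : ℕ}

/-- Gram matrix of the trace form. -/
def tgram (y : Fin n × Fin n → Matrix (Fin n) (Fin n) R) :
    Matrix (Fin n × Fin n) (Fin n × Fin n) R :=
  Matrix.of fun i j => Matrix.trace (y i * y j)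

lemma tgram_symm (y : Fin n × Fin n → Matrix (Fin n) (Fin n) R) : (tgram y).transpose = tgram y := by
  ext i j
  simp [tgram, Matrix.trace_mul_comm (y i) (y j)]

/-- Coordinate matrix. -/
def cmat (y : Fin n × Fin n → Matrix (Fin n) (Fin n) R) :
    Matrix (Fin n × Fin n) (Fin n × Fin n) R :=
  Matrix.of fun i p => y i p.1 p.2

/-- Transposed coordinate matrix. -/
def cmatT (y : Fin n × Fin n → Matrix (Fin n) (Fin n) R) :
    Matrix (Fin n × Fin n) (Fin n × Fin n) R :=
  Matrix.of fun i p => y i p.2 p.1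

lemma tgram_eq (y : Fin n × Fin n → Matrix (Fin n) (Fin n) R) :
    tgram y = cmatT y * (cmat y).transpose := by
  ext i j
  simp only [tgram, Matrix.of_apply, Matrix.trace, Matrix.diag, Matrix.mul_apply, cmatT, cmat,
    Matrix.transpose_apply, Fintype.sum_prod_type]
  rw [Finset.sum_comm]

lemma tgram_kernel (y : Fin n × Fin n → Matrix (Fin n) (Fin n) R) :
    (cmat y).transpose * (tgram y).adjugate * cmatT y = (tgram y).det • 1 := by
  rw [tgram_eq, Matrix.adjugate_mul_distrib, ← Matrix.mul_assoc, Matrix.mul_adjugate,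
    Matrix.mul_assoc, Matrix.adjugate_mul, Matrix.det_mul]
  simp [smul_smul, mul_comm]

lemma tgram_kernel_apply (y : Fin n × Fin n → Matrix (Fin n) (Fin n) R) (p q : Fin n × Fin n) :
    ∑ i, ∑ j, (tgram y).adjugate i j * y i p.1 p.2 * y j q.2 q.1 =
      if p = q then (tgram y).det else 0 := by
  have h := congrFun (congrFun (tgram_kernel y) p) q
  simp only [Matrix.mul_apply, Matrix.transpose_apply, cmat, cmatT, Matrix.of_apply,
    Matrix.smul_apply, Matrix.one_apply, smul_eq_mul, mul_ite, mul_one, mul_zero,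
    Finset.sum_mul] at h
  rw [← h, Finset.sum_comm]
  refine Finset.sum_congr rfl fun i _ => Finset.sum_congr rfl fun j _ => ?_
  ring

lemma gram_dual (y : Fin n × Fin n → Matrix (Fin n) (Fin n) R) (z : Matrix (Fin n) (Fin n) R) :
    ∑ i, ∑ j, (tgram y).adjugate i j • (y i * z * y j) =
      ((tgram y).det * z.trace) • (1 : Matrix (Fin n) (Fin n) R) := by
  ext p q
  have h1 : ∀ a b, ∑ i, ∑ j, (tgram y).adjugate i j * y i p a * y j b q =
      if (p, a) = (q, b) then (tgram y).det else 0 := fun a b =>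
    tgram_kernel_apply y (p, a) (q, b)
  have h2 : (∑ i, ∑ j, (tgram y).adjugate i j • (y i * z * y j)) p q =
      ∑ a, ∑ b, z a b * ∑ i, ∑ j, (tgram y).adjugate i j * y i p a * y j b q := by
    simp only [Matrix.sum_apply, Matrix.smul_apply, smul_eq_mul, Matrix.mul_apply,
      Finset.mul_sum, Finset.sum_mul]
    have : ∀ i j, (∑ b, ∑ a, (tgram y).adjugate i j * (y i p a * z a b * y j b q)) =
        ∑ a, ∑ b, z a b * ((tgram y).adjugate i j * y i p a * y j b q) := by
      intro i j
      rw [Finset.sum_comm]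
      refine Finset.sum_congr rfl fun i _ => Finset.sum_congr rfl fun j _ => ?_
      ring
    simp_rw [this]
    calc _ = ∑ i, ∑ a, ∑ j, ∑ b, z a b * ((tgram y).adjugate i j * y i p a * y j b q) :=
          Finset.sum_congr rfl fun i _ => Finset.sum_comm
      _ = ∑ a, ∑ i, ∑ j, ∑ b, z a b * ((tgram y).adjugate i j * y i p a * y j b q) :=
          Finset.sum_comm
      _ = ∑ a, ∑ i, ∑ b, ∑ j, z a b * ((tgram y).adjugate i j * y i p a * y j b q) :=
          Finset.sum_congr rfl fun a _ => Finset.sum_congr rfl fun i _ => Finset.sum_comm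
      _ = _ := Finset.sum_congr rfl fun i _ => Finset.sum_comm
  rw [h2]
  simp_rw [h1]
  simp only [Prod.mk.injEq, mul_ite, mul_zero, Matrix.smul_apply, Matrix.one_apply, smul_eq_mul,
    mul_one]
  by_cases hpq : p = q
  · simp [hpq, Matrix.trace, Finset.mul_sum, mul_comm]
  · simp [hpq]

lemma gram_expand (y : Fin n × Fin n → Matrix (Fin n) (Fin n) R) (z : Matrix (Fin n) (Fin n) R) :
    ∑ i, (∑ j, (tgram y).adjugate i j * (z * y j).trace) • y i = (tgram y).det • z := by
  ext p q
  have h2 : (∑ i, (∑ j, (tgram y).adjugate i j * (z * y j).trace) • y i) p q =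
      ∑ a, ∑ b, z a b * ∑ i, ∑ j, (tgram y).adjugate i j * y i p q * y j b a := by
    simp only [Matrix.sum_apply, Matrix.smul_apply, smul_eq_mul, Matrix.mul_apply, Matrix.trace,
      Matrix.diag, Finset.mul_sum, Finset.sum_mul]
    calc _ = ∑ i, ∑ a, ∑ j, ∑ b, (tgram y).adjugate i j * (z a b * y j b a) * y i p q :=
          Finset.sum_congr rfl fun i _ => Finset.sum_comm
      _ = ∑ a, ∑ i, ∑ j, ∑ b, (tgram y).adjugate i j * (z a b * y j b a) * y i p q :=
          Finset.sum_comm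
      _ = ∑ a, ∑ i, ∑ b, ∑ j, (tgram y).adjugate i j * (z a b * y j b a) * y i p q :=
          Finset.sum_congr rfl fun a _ => Finset.sum_congr rfl fun i _ => Finset.sum_comm
      _ = ∑ a, ∑ b, ∑ i, ∑ j, (tgram y).adjugate i j * (z a b * y j b a) * y i p q :=
          Finset.sum_congr rfl fun i _ => Finset.sum_comm
      _ = _ := by
        refine Finset.sum_congr rfl fun a _ => Finset.sum_congr rfl fun b _ =>
          Finset.sum_congr rfl fun i _ => Finset.sum_congr rfl fun j _ => ?_
        ring
  have h1 : ∀ a b, ∑ i, ∑ j, (tgram y).adjugate i j * y i p q * y j b a =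
      if (p, q) = (a, b) then (tgram y).det else 0 := fun a b =>
    tgram_kernel_apply y (p, q) (a, b)
  rw [h2]
  simp_rw [h1]
  simp only [Prod.mk.injEq, mul_ite, mul_zero, Matrix.smul_apply, smul_eq_mul]
  rw [Finset.sum_eq_single p, Finset.sum_eq_single q]
  · simp [mul_comm]
  · intro b _ hb; simp [hb.symm]
  · simp
  · intro b _ hb; simp [hb.symm]
  · simp

lemma tgram_map {S : Type*} [CommRing S] (f : R →+* S)
    (y : Fin n × Fin n → Matrix (Fin n) (Fin n) R) :
    tgram (fun i => f.mapMatrix (y i)) = f.mapMatrix (tgram y) := by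
  ext i j
  simp only [tgram, Matrix.of_apply, RingHom.mapMatrix_apply, Matrix.map_apply, ← Matrix.map_mul]
  exact (AddMonoidHom.map_trace f.toAddMonoidHom _).symm

/-- a basis has invertible Gram matrix -/
lemma tgram_det_ne_zero_of_span {L : Type*} [Field L]
    (y : Fin n × Fin n → Matrix (Fin n) (Fin n) L)
    (hy : LinearIndependent L y) : (tgram y).det ≠ 0 := by
  have h1 : (cmat y).det ≠ 0 := by
    rw [← isUnit_iff_ne_zero, ← Matrix.isUnit_iff_isUnit_det, ← Matrix.linearIndependent_rows_iff_isUnit]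
    have := hy.map' (LinearEquiv.curry L L (Fin n) (Fin n)).symm.toLinearMap (LinearEquiv.ker _)
    exact this
  have h2 : (cmatT y).det ≠ 0 := by
    have : cmatT y = (cmat y).submatrix (Equiv.refl _) (Equiv.prodComm _ _) := by
      ext i p; simp [cmat, cmatT]
    rw [this, ← isUnit_iff_ne_zero, ← Matrix.isUnit_iff_isUnit_det, Matrix.isUnit_submatrix_equiv,
      Matrix.isUnit_iff_isUnit_det, isUnit_iff_ne_zero]
    exact h1
  rw [tgram_eq, Matrix.det_mul, Matrix.det_transpose]
  exact mul_ne_zero h2 h1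

/-- Alternating maps in the top degree and traces. -/
lemma sum_update_det {ι : Type*} [Fintype ι] [DecidableEq ι] (A T : Matrix ι ι R) :
    ∑ i, (A.updateCol i ((T * A).col i)).det = T.trace * A.det := by
  have h : ∀ i, (A.updateCol i ((T * A).col i)).det = (A.adjugate * (T * A)) i i := by
    intro i
    rw [← Matrix.cramer_apply, Matrix.cramer_eq_adjugate_mulVec]
    rfl
  simp_rw [h]
  change (A.adjugate * (T * A)).trace = _
  rw [Matrix.trace_mul_comm, Matrix.mul_assoc, Matrix.mul_adjugate, Matrix.mul_smul,
    Matrix.trace_smul]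
  simp [mul_comm]

lemma alternating_trace {ι M N : Type*} [Fintype ι] [DecidableEq ι] [AddCommGroup M] [Module R M]
    [AddCommGroup N] [Module R N] (e : Module.Basis ι R M) (F : M [⋀^ι]→ₗ[R] N) (T : M →ₗ[R] M)
    (x : ι → M) :
    ∑ i, F (Function.update x i (T (x i))) = (LinearMap.toMatrix e e T).trace • F x := by
  have key : ∀ v, F v = e.det v • F e := by
    intro v
    refine e.ext_alternating (f := F) (g := (LinearMap.toSpanSingleton R N (F e)).compAlternatingMap e.det) ?_ ▸ ?_
    · intro v hv
      have hb : Function.Bijective v := (Finite.injective_iff_bijective).1 hv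
      let σ := Equiv.ofBijective v hb
      have : (fun i => e (v i)) = e ∘ σ := rfl
      rw [this, F.map_perm]
      simp [AlternatingMap.map_perm, -Module.Basis.det_apply, Module.Basis.det_self e]
    · simp [Module.Basis.det_self e]
  have h1 : ∀ i, e.toMatrix (Function.update x i (T (x i))) =
      (e.toMatrix x).updateCol i (((LinearMap.toMatrix e e T) * (e.toMatrix x)).col i) := by
    intro i
    rw [Module.Basis.toMatrix_update]
    congr 1
    ext j
    exact (congrFun (LinearMap.toMatrix_mulVec_repr e e T (x i)) j).symm
  rw [key x]
  simp_rw [key (Function.update x _ _), Module.Basis.det_apply, h1]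
  rw [← Finset.sum_smul, sum_update_det, smul_smul]

lemma trace_mulLeft (z : Matrix (Fin n) (Fin n) R) :
    (LinearMap.toMatrix (Matrix.stdBasis R (Fin n) (Fin n)) (Matrix.stdBasis R (Fin n) (Fin n))
      (LinearMap.mulLeft R z)).trace = n * z.trace := by
  have hr : ∀ (x : Matrix (Fin n) (Fin n) R) (p : Fin n × Fin n),
      (Matrix.stdBasis R (Fin n) (Fin n)).repr x p = x p.1 p.2 := by
    intro x p
    have hx : x = ∑ q : Fin n × Fin n, x q.1 q.2 • Matrix.stdBasis R (Fin n) (Fin n) q := by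
      ext i j
      simp [Matrix.sum_apply, Fintype.sum_prod_type, Matrix.stdBasis_eq_single, Matrix.single_apply,
        ite_and]
    conv_lhs => rw [hx]
    rw [Module.Basis.repr_sum_self]
  have h2 : ∀ p : Fin n × Fin n, LinearMap.toMatrix (Matrix.stdBasis R (Fin n) (Fin n))
      (Matrix.stdBasis R (Fin n) (Fin n)) (LinearMap.mulLeft R z) p p = z p.1 p.1 := by
    rintro ⟨i, j⟩
    rw [LinearMap.toMatrix_apply, hr]
    simp [Matrix.stdBasis_eq_single]
  simp only [Matrix.trace, Matrix.diag, h2, Fintype.sum_prod_type]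
  simp [Finset.mul_sum]

end MatrixIdentities
/-! ### Traces, the conductor, and points over extension fields -/
section Conductor

variable {n m : ℕ}

/-- The algebra generated by traces of elements of `G`. -/
def trC (n m : ℕ) : Subalgebra k (PolyRing k n m) :=
  Algebra.adjoin k (Matrix.trace '' (GMN k n m : Set (MatPoly k n m)))

lemma trace_mem_trC {z : MatPoly k n m} (hz : z ∈ GMN k n m) : z.trace ∈ trC k n m :=
  Algebra.subset_adjoin ⟨z, hz, rfl⟩

/-- The capelli-type alternating map. -/
def capF (u w : Fin (n * n) → MatPoly k n m) :
    (MatPoly k n m) [⋀^Fin (n * n)]→ₗ[PolyRing k n m] (MatPoly k n m) :=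
  MultilinearMap.alternatization
    ((MultilinearMap.mkPiAlgebraFin (PolyRing k n m) (n * n) (MatPoly k n m)).compLinearMap
      (fun t => (LinearMap.mulLeft (PolyRing k n m) (u t)).comp
        (LinearMap.mulRight (PolyRing k n m) (w t))))

lemma capF_apply (u w x : Fin (n * n) → MatPoly k n m) :
    capF k u w x = ∑ σ : Equiv.Perm (Fin (n * n)), Equiv.Perm.sign σ •
      (List.ofFn fun t => u t * (x (σ t) * w t)).prod := by
  simp [capF, MultilinearMap.alternatization_apply]

/-- The conductor of `trC` in `G`. -/
def condG (n m : ℕ) : Set (MatPoly k n m) :=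
  {s | ∀ c ∈ trC k n m, c • s ∈ GMN k n m}

lemma capF_mem (u w x : Fin (n * n) → MatPoly k n m) (hu : ∀ i, u i ∈ GMN k n m)
    (hw : ∀ i, w i ∈ GMN k n m) (hx : ∀ i, x i ∈ GMN k n m) : capF k u w x ∈ GMN k n m := by
  rw [capF_apply]
  refine sum_mem fun σ _ => ?_
  have : (List.ofFn fun t => u t * (x (σ t) * w t)).prod ∈ GMN k n m := by
    refine Subalgebra.list_prod_mem _ ?_
    intro y hy
    rw [List.mem_ofFn] at hy
    obtain ⟨t, rfl⟩ := hy
    exact mul_mem (hu _) (mul_mem (hx _) (hw _))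
  rcases Int.units_eq_one_or (Equiv.Perm.sign σ) with h | h <;> rw [h]
  · simpa using this
  · simpa using neg_mem this

lemma capF_trace (u w x : Fin (n * n) → MatPoly k n m) (z : MatPoly k n m) :
    ∑ i, capF k u w (Function.update x i (z * x i)) = ((n : PolyRing k n m) * z.trace) • capF k u w x := by
  have h := alternating_trace ((Matrix.stdBasis (PolyRing k n m) (Fin n) (Fin n)).reindex
    finProdFinEquiv) (capF k u w) (LinearMap.mulLeft _ z) x
  simp only [LinearMap.mulLeft_apply] at h
  rw [h]
  congr 1
  rw [← trace_mulLeft, ← LinearMap.trace_eq_matrix_trace, ← LinearMap.trace_eq_matrix_trace]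

lemma capF_cond (hn : 1 ≤ n) (u w x : Fin (n * n) → MatPoly k n m) (hu : ∀ i, u i ∈ GMN k n m)
    (hw : ∀ i, w i ∈ GMN k n m) (hx : ∀ i, x i ∈ GMN k n m) : capF k u w x ∈ condG k n m := by
  let V : Submodule k (MatPoly k n m) :=
    Submodule.span k {s | ∃ x : Fin (n * n) → MatPoly k n m, (∀ i, x i ∈ GMN k n m) ∧ s = capF k u w x}
  have hVG : ∀ s ∈ V, s ∈ GMN k n m := by
    intro s hs
    have : V ≤ Subalgebra.toSubmodule (GMN k n m) := by
      refine Submodule.span_le.2 ?_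
      rintro _ ⟨x, hx, rfl⟩
      exact capF_mem k u w x hu hw hx
    exact this hs
  have hstep : ∀ c ∈ trC k n m, ∀ s ∈ V, c • s ∈ V := by
    intro c hc
    induction hc using Algebra.adjoin_induction with
    | mem c hc =>
      obtain ⟨z, hz, rfl⟩ := hc
      intro s hs
      induction hs using Submodule.span_induction with
      | mem s hs =>
        obtain ⟨x, hx, rfl⟩ := hs
        have h1 := capF_trace k u w x z
        have h2 : z.trace • capF k u w x =
            ((n : k)⁻¹) • ∑ i, capF k u w (Function.update x i (z * x i)) := by
          rw [h1, mul_smul, Nat.cast_smul_eq_nsmul (PolyRing k n m) n,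
            ← Nat.cast_smul_eq_nsmul k n, smul_smul, inv_mul_cancel₀, one_smul]
          exact Nat.cast_ne_zero.2 (by omega)
        rw [h2]
        refine Submodule.smul_mem _ _ (sum_mem fun i _ => Submodule.subset_span ⟨_, ?_, rfl⟩)
        intro j
        by_cases hij : j = i
        · subst hij
          simpa using mul_mem hz (hx j)
        · simpa [Function.update_of_ne hij] using hx j
      | zero => simp
      | add a b _ _ ha hb => rw [smul_add]; exact add_mem ha hb
      | smul r a _ ha => rw [smul_comm]; exact Submodule.smul_mem _ _ ha
    | algebraMap r =>
      intro s hs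
      rw [algebraMap_smul]
      exact Submodule.smul_mem _ _ hs
    | add a b _ _ ha hb =>
      intro s hs
      rw [add_smul]; exact add_mem (ha s hs) (hb s hs)
    | mul a b _ _ ha hb =>
      intro s hs
      rw [mul_smul]; exact ha _ (hb s hs)
  intro c hc
  exact hVG _ (hstep c hc _ (Submodule.subset_span ⟨x, hx, rfl⟩))

lemma condG_mul {s g g' : MatPoly k n m} (hs : s ∈ condG k n m) (hg : g ∈ GMN k n m)
    (hg' : g' ∈ GMN k n m) : g * s * g' ∈ condG k n m := by
  intro c hc
  have : c • (g * s * g') = g * (c • s) * g' := by simp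
  rw [this]
  exact mul_mem (mul_mem hg (hs c hc)) hg'

lemma condG_smul {s : MatPoly k n m} (hs : s ∈ condG k n m) {c} (hc : c ∈ trC k n m) :
    c • s ∈ condG k n m := by
  intro c' hc'
  rw [smul_smul]
  exact hs _ (mul_mem hc' hc)

lemma condG_sum {ι : Type*} (t : Finset ι) (f : ι → MatPoly k n m)
    (hf : ∀ i ∈ t, f i ∈ condG k n m) : ∑ i ∈ t, f i ∈ condG k n m := by
  intro c hc
  rw [Finset.smul_sum]
  exact sum_mem fun i hi => hf i hi c hc

lemma trC_adjugate {x : Fin n × Fin n → MatPoly k n m} (hx : ∀ i, x i ∈ GMN k n m) (i j) :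
    (tgram x).adjugate i j ∈ trC k n m := by
  have hg : ∀ i j, tgram x i j ∈ trC k n m := fun i j =>
    trace_mem_trC k (mul_mem (hx i) (hx j))
  have : tgram x = (trC k n m).val.toRingHom.mapMatrix (Matrix.of fun i j => ⟨tgram x i j, hg i j⟩) := by
    ext i j; rfl
  rw [this, ← RingHom.map_adjugate]
  exact Subtype.prop _

lemma trC_det {x : Fin n × Fin n → MatPoly k n m} (hx : ∀ i, x i ∈ GMN k n m) :
    (tgram x).det ∈ trC k n m := by
  have hg : ∀ i j, tgram x i j ∈ trC k n m := fun i j =>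
    trace_mem_trC k (mul_mem (hx i) (hx j))
  have : tgram x = (trC k n m).val.toRingHom.mapMatrix (Matrix.of fun i j => ⟨tgram x i j, hg i j⟩) := by
    ext i j; rfl
  rw [this, ← RingHom.map_det]
  exact Subtype.prop _

/-- scalar elements of the conductor -/
lemma condG_scalar {x : Fin n × Fin n → MatPoly k n m} (hx : ∀ i, x i ∈ GMN k n m)
    {z : MatPoly k n m} (hz : z ∈ condG k n m) :
    ((tgram x).det * z.trace) • (1 : MatPoly k n m) ∈ condG k n m := by
  rw [← gram_dual]
  exact condG_sum k _ _ fun i _ => condG_sum k _ _ fun j _ =>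
    condG_smul k (condG_mul k hz (hx i) (hx j)) (trC_adjugate k hx i j)

lemma evalMat_generic (a : MTuple k n m) (h : Fin m) : evalMat k a (genericMatrix k n m h) = a h := by
  ext i j
  simp [evalMat, genericMatrix, polyEval]

lemma map_evalMat_GMN (a : MTuple k n m) :
    (GMN k n m).map (evalMat k a) = Algebra.adjoin k (Set.range a) := by
  rw [GMN, AlgHom.map_adjoin, ← Set.range_comp]
  congr 2
  ext h : 1
  exact evalMat_generic k a h

lemma exists_eval_eq {a : MTuple k n m} (ha : a ∈ genTuples k n m) (M : Matrix (Fin n) (Fin n) k) :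
    ∃ z ∈ GMN k n m, evalMat k a z = M := by
  have h : M ∈ (GMN k n m).map (evalMat k a) := by
    rw [map_evalMat_GMN, show Algebra.adjoin k (Set.range a) = ⊤ from ha]
    trivial
  exact h

lemma evalMat_trace (a : MTuple k n m) (z : MatPoly k n m) :
    (evalMat k a z).trace = polyEval k a z.trace :=
  (AddMonoidHom.map_trace (polyEval k a).toRingHom.toAddMonoidHom z).symm

lemma capF_ne (hn : 1 ≤ n) {a : MTuple k n m} (ha : a ∈ genTuples k n m) :
    ∃ s ∈ condG k n m, (evalMat k a s).trace ≠ 0 := by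
  let i0 : Fin n := ⟨0, hn⟩
  let e : Fin (n * n) ≃ Fin n × Fin n := finProdFinEquiv.symm
  choose z hz hza using fun M => exists_eval_eq k ha M
  let u : Fin (n * n) → MatPoly k n m := fun t => z (Matrix.single i0 (e t).1 1)
  let w : Fin (n * n) → MatPoly k n m := fun t => z (Matrix.single (e t).2 i0 1)
  let x : Fin (n * n) → MatPoly k n m := fun t => z (Matrix.single (e t).1 (e t).2 1)
  refine ⟨capF k u w x, capF_cond k hn u w x (fun _ => hz _) (fun _ => hz _) (fun _ => hz _), ?_⟩
  have h0 : n * n ≠ 0 := by positivity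
  have key : ∀ σ : Equiv.Perm (Fin (n * n)),
      evalMat k a (List.ofFn fun t => u t * (x (σ t) * w t)).prod =
        if σ = 1 then Matrix.single i0 i0 1 else 0 := by
    intro σ
    rw [map_list_prod, List.map_ofFn]
    split_ifs with h
    · subst h
      have : (fun t => evalMat k a (u t * (x ((1 : Equiv.Perm (Fin (n * n))) t) * w t))) =
          fun t => Matrix.single i0 i0 1 := by
        ext1 t
        simp [u, x, w, hza, map_mul]
      have h2 : ((evalMat k a) ∘ fun t => (u t * (x ((1 : Equiv.Perm (Fin (n * n))) t) * w t))) =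
          fun t => Matrix.single i0 i0 1 := this
      rw [h2, List.ofFn_const, List.prod_replicate]
      have hid : IsIdempotentElem (Matrix.single i0 i0 (1 : k)) := by
        simp [IsIdempotentElem]
      exact hid.pow_eq h0
    · obtain ⟨t, ht⟩ : ∃ t, σ t ≠ t := by
        by_contra hcon
        push Not at hcon
        exact h (Equiv.ext hcon)
      apply List.prod_eq_zero
      rw [List.mem_ofFn]
      refine ⟨t, ?_⟩
      have hne : e (σ t) ≠ e t := fun h => ht (e.injective h)
      simp only [Function.comp, map_mul, u, x, w, hza]
      by_cases h1 : (e t).1 = (e (σ t)).1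
      · have h2 : (e (σ t)).2 ≠ (e t).2 := fun h2 => hne (Prod.ext h1.symm h2)
        rw [Matrix.single_mul_single_of_ne _ _ _ _ h2, mul_zero]
      · rw [← mul_assoc, Matrix.single_mul_single_of_ne _ _ _ _ h1, zero_mul]
  rw [capF_apply, map_sum]
  have hs : ∀ σ : Equiv.Perm (Fin (n * n)), evalMat k a (Equiv.Perm.sign σ •
      (List.ofFn fun t => u t * (x (σ t) * w t)).prod) = if σ = 1 then Matrix.single i0 i0 1 else 0 := by
    intro σ
    have := key σ
    split_ifs at this ⊢ with h
    · subst h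
      simpa using this
    · rcases Int.units_eq_one_or (Equiv.Perm.sign σ) with h | h <;> rw [h]
      · simpa using this
      · simpa using this
  simp_rw [hs]
  simp

end Conductor

section Points

variable {n m : ℕ} {L : Type} [Field L] [Algebra k L]

/-- A point over an extension field at which the generic matrices generate. -/
def Gen (β : PolyRing k n m →ₐ[k] L) : Prop :=
  ∃ x : Fin n × Fin n → MatPoly k n m, (∀ i, x i ∈ GMN k n m) ∧ β (tgram x).det ≠ 0

lemma tgram_ev (β : PolyRing k n m →ₐ[k] L) (x : Fin n × Fin n → MatPoly k n m) :
    tgram (fun i => β.mapMatrix (x i)) = β.mapMatrix (tgram x) :=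
  tgram_map β.toRingHom x

lemma tgram_ev_det (β : PolyRing k n m →ₐ[k] L) (x : Fin n × Fin n → MatPoly k n m) :
    (tgram (fun i => β.mapMatrix (x i))).det = β (tgram x).det := by
  rw [tgram_ev]
  exact (RingHom.map_det β.toRingHom _).symm

lemma trace_ev (β : PolyRing k n m →ₐ[k] L) (z : MatPoly k n m) :
    (β.mapMatrix z).trace = β z.trace :=
  (AddMonoidHom.map_trace β.toRingHom.toAddMonoidHom z).symm

lemma gen_of_span (β : PolyRing k n m →ₐ[k] L)
    (h : Submodule.span L (β.mapMatrix '' (GMN k n m : Set (MatPoly k n m))) = ⊤) : Gen k β := by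
  obtain ⟨b, hb, hspan, hli⟩ := exists_linearIndependent L
    (β.mapMatrix '' (GMN k n m : Set (MatPoly k n m)))
  rw [h] at hspan
  let B := Module.Basis.mk hli (by simp [hspan])
  have : Fintype b := FiniteDimensional.fintypeBasisIndex B
  have hc : Fintype.card b = Fintype.card (Fin n × Fin n) := by
    rw [← Module.finrank_eq_card_basis B, Module.finrank_matrix]
    simp
  let e := Fintype.equivOfCardEq hc
  choose x hx hxb using fun i : Fin n × Fin n => hb (e.symm i).2
  refine ⟨x, hx, ?_⟩
  rw [← tgram_ev_det]
  apply tgram_det_ne_zero_of_span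
  have : (fun i => β.mapMatrix (x i)) = (fun i : b => (i : Matrix (Fin n) (Fin n) L)) ∘ e.symm := by
    ext1 i; exact hxb i
  rw [this]
  exact hli.comp _ e.symm.injective

/-- expansion of an arbitrary matrix -/
lemma ev_expand (β : PolyRing k n m →ₐ[k] L) {x : Fin n × Fin n → MatPoly k n m}
    (hd : β (tgram x).det ≠ 0) (M : Matrix (Fin n) (Fin n) L) :
    ∃ c : Fin n × Fin n → L, M = ∑ i, c i • β.mapMatrix (x i) := by
  have h := gram_expand (fun i => β.mapMatrix (x i)) M
  rw [tgram_ev_det] at h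
  refine ⟨fun i => (β (tgram x).det)⁻¹ * (∑ j, (tgram (fun i => β.mapMatrix (x i))).adjugate i j * (M * β.mapMatrix (x j)).trace), ?_⟩
  simp_rw [mul_smul]
  rw [← Finset.smul_sum, h, smul_smul, inv_mul_cancel₀ hd, one_smul]

lemma mem_genTuples_iff (a : MTuple k n m) : a ∈ genTuples k n m ↔ Gen k (polyEval k a) := by
  constructor
  · intro ha
    apply gen_of_span
    rw [eq_top_iff]
    intro M _
    obtain ⟨z, hz, hzM⟩ := exists_eval_eq k ha M
    exact Submodule.subset_span ⟨z, hz, hzM⟩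
  · rintro ⟨x, hx, hd⟩
    change Algebra.adjoin k (Set.range a) = ⊤
    rw [← map_evalMat_GMN, eq_top_iff]
    intro M _
    obtain ⟨c, rfl⟩ := ev_expand k (polyEval k a) hd M
    refine sum_mem fun i _ => Subalgebra.smul_mem _ ?_ _
    exact Subalgebra.mem_map.2 ⟨x i, hx i, rfl⟩

lemma exists_cond_point (hn : 1 ≤ n) {a : MTuple k n m} (ha : a ∈ genTuples k n m) :
    ∃ c : PolyRing k n m, c • (1 : MatPoly k n m) ∈ condG k n m ∧ polyEval k a c ≠ 0 := by
  obtain ⟨x, hx, hd⟩ := (mem_genTuples_iff k a).1 ha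
  obtain ⟨s, hs, hs0⟩ := capF_ne k hn ha
  refine ⟨_, condG_scalar k hx hs, ?_⟩
  rw [map_mul]
  rw [evalMat_trace] at hs0
  exact mul_ne_zero hd hs0

lemma polyEval_eq_zero_imp_radical (I : Ideal (PolyRing k n m)) (f : PolyRing k n m)
    (h : ∀ a : MTuple k n m, (∀ p ∈ I, polyEval k a p = 0) → polyEval k a f = 0) : f ∈ I.radical := by
  rw [← MvPolynomial.vanishingIdeal_zeroLocus_eq_radical (K := k)]
  rw [MvPolynomial.mem_vanishingIdeal_iff]
  intro v hv
  rw [MvPolynomial.mem_zeroLocus_iff] at hv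
  exact h (fun h i j => v (h, i, j)) hv

lemma exists_cond (hn : 1 ≤ n) (β : PolyRing k n m →ₐ[k] L) (hβ : Gen k β) :
    ∃ c : PolyRing k n m, c • (1 : MatPoly k n m) ∈ condG k n m ∧ β c ≠ 0 := by
  by_contra hcon
  push Not at hcon
  obtain ⟨x, hx, hd⟩ := hβ
  have h1 : (tgram x).det ∈ (Ideal.span {c : PolyRing k n m | c • (1 : MatPoly k n m) ∈ condG k n m}).radical := by
    apply polyEval_eq_zero_imp_radical
    intro a ha
    by_contra h0
    obtain ⟨c, hc, hca⟩ := exists_cond_point k hn ((mem_genTuples_iff k a).2 ⟨x, hx, h0⟩)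
    exact hca (ha c (Ideal.subset_span hc))
  obtain ⟨N, hN⟩ := h1
  have h2 : Ideal.span {c : PolyRing k n m | c • (1 : MatPoly k n m) ∈ condG k n m} ≤
      RingHom.ker β.toRingHom := by
    refine Ideal.span_le.2 ?_
    intro c hc
    exact hcon c hc
  have h3 : β ((tgram x).det ^ N) = 0 := h2 hN
  rw [map_pow] at h3
  exact hd (eq_zero_of_pow_eq_zero h3)

end Points
/-! ### Points over extension fields give elements of `Spec_n` -/
section SpecOfPoint

variable {n m : ℕ} {L : Type} [Field L] [Algebra k L]

lemma ev_smul (β : PolyRing k n m →ₐ[k] L) (c : PolyRing k n m) (r : MatPoly k n m) :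
    β.mapMatrix (c • r) = β c • β.mapMatrix r := by
  ext i j
  simp

lemma ev_smul_one (β : PolyRing k n m →ₐ[k] L) (c : PolyRing k n m) :
    β.mapMatrix (c • (1 : MatPoly k n m)) = β c • 1 := by
  rw [ev_smul, map_one]

lemma smul_mem_of {A : Subalgebra k (MatPoly k n m)} {c : PolyRing k n m}
    (hc : c • (1 : MatPoly k n m) ∈ A) {r} (hr : r ∈ A) : c • r ∈ A := by
  have : c • r = (c • (1 : MatPoly k n m)) * r := by simp
  rw [this]; exact mul_mem hc hr

lemma mul_one_mem_of {A : Subalgebra k (MatPoly k n m)} {c d : PolyRing k n m}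
    (hc : c • (1 : MatPoly k n m) ∈ A) (hd : d • (1 : MatPoly k n m) ∈ A) :
    (c * d) • (1 : MatPoly k n m) ∈ A := by
  rw [mul_smul]; exact smul_mem_of k hc hd

/-- scalars in `A`, evaluated -/
def scalRing (A : Subalgebra k (MatPoly k n m)) (β : PolyRing k n m →ₐ[k] L) : Subring L where
  carrier := {z | ∃ c : PolyRing k n m, c • (1 : MatPoly k n m) ∈ A ∧ β c = z}
  zero_mem' := ⟨0, by simp, by simp⟩
  one_mem' := ⟨1, by simp, by simp⟩
  add_mem' := by
    rintro _ _ ⟨c, hc, rfl⟩ ⟨d, hd, rfl⟩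
    exact ⟨c + d, by rw [add_smul]; exact add_mem hc hd, by simp⟩
  neg_mem' := by
    rintro _ ⟨c, hc, rfl⟩
    exact ⟨-c, by rw [neg_smul]; exact neg_mem hc, by simp⟩
  mul_mem' := by
    rintro _ _ ⟨c, hc, rfl⟩ ⟨d, hd, rfl⟩
    exact ⟨c * d, mul_one_mem_of k hc hd, by simp⟩

/-- fraction field of the scalars -/
def scalField (A : Subalgebra k (MatPoly k n m)) (β : PolyRing k n m →ₐ[k] L) : Subfield L :=
  Subfield.closure (scalRing k A β : Set L)

lemma mem_scalField {A : Subalgebra k (MatPoly k n m)} {β : PolyRing k n m →ₐ[k] L} {z : L}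
    (hz : z ∈ scalField k A β) : ∃ c d : PolyRing k n m, c • (1 : MatPoly k n m) ∈ A ∧
      d • (1 : MatPoly k n m) ∈ A ∧ β d ≠ 0 ∧ β d * z = β c := by
  rw [scalField, Subfield.mem_closure_iff] at hz
  rw [Subring.closure_eq] at hz
  obtain ⟨_, ⟨c, hc, rfl⟩, _, ⟨d, hd, rfl⟩, rfl⟩ := hz
  by_cases h : β d = 0
  · exact ⟨0, 1, by simp, by simp, by simp, by simp [h]⟩
  · exact ⟨c, d, hc, hd, h, by field_simp⟩

lemma scal_mem {A : Subalgebra k (MatPoly k n m)} (β : PolyRing k n m →ₐ[k] L) {c : PolyRing k n m}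
    (hc : c • (1 : MatPoly k n m) ∈ A) : β c ∈ scalField k A β :=
  Subfield.subset_closure ⟨c, hc, rfl⟩

lemma trC_mem_scalField (hn : 1 ≤ n) {A : Subalgebra k (MatPoly k n m)} (hGA : GMN k n m ≤ A)
    {β : PolyRing k n m →ₐ[k] L} (hβ : Gen k β) {c : PolyRing k n m} (hc : c ∈ trC k n m) :
    β c ∈ scalField k A β := by
  obtain ⟨d, hd, hd0⟩ := exists_cond k hn β hβ
  have h1 : d • (1 : MatPoly k n m) ∈ A := hGA (by simpa using hd 1 (one_mem _))
  have h2 : (c * d) • (1 : MatPoly k n m) ∈ A := hGA (by rw [mul_smul]; exact hd c hc)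
  have h3 : β c = β (c * d) / β d := by rw [map_mul]; field_simp
  rw [h3]
  exact div_mem (scal_mem k β h2) (scal_mem k β h1)

/-- The ring of fractions of the image of `A`. -/
def fracAlg (A : Subalgebra k (MatPoly k n m)) (β : PolyRing k n m →ₐ[k] L) :
    Subalgebra (scalField k A β) (Matrix (Fin n) (Fin n) L) :=
  Algebra.adjoin (scalField k A β) (β.mapMatrix '' (A : Set (MatPoly k n m)))

lemma mem_fracAlg {A : Subalgebra k (MatPoly k n m)} {β : PolyRing k n m →ₐ[k] L}
    {q : Matrix (Fin n) (Fin n) L} (hq : q ∈ fracAlg k A β) :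
    ∃ r ∈ A, ∃ d : PolyRing k n m, d • (1 : MatPoly k n m) ∈ A ∧ β d ≠ 0 ∧
      β d • q = β.mapMatrix r := by
  induction hq using Algebra.adjoin_induction with
  | mem q hq =>
    obtain ⟨r, hr, rfl⟩ := hq
    exact ⟨r, hr, 1, by simp, by simp, by simp⟩
  | algebraMap z =>
    obtain ⟨c, d, hc, hd, hd0, h⟩ := mem_scalField k z.2
    refine ⟨c • 1, hc, d, hd, hd0, ?_⟩
    rw [ev_smul_one, ← h, mul_smul, Algebra.algebraMap_eq_smul_one]
    rfl
  | add a b _ _ ha hb =>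
    obtain ⟨r, hr, d, hd, hd0, h⟩ := ha
    obtain ⟨r', hr', d', hd', hd0', h'⟩ := hb
    refine ⟨d' • r + d • r', add_mem (smul_mem_of k hd' hr) (smul_mem_of k hd hr'), d * d',
      mul_one_mem_of k hd hd', by simp [hd0, hd0'], ?_⟩
    rw [map_add, ev_smul, ev_smul, ← h, ← h', map_mul, smul_add, smul_smul, smul_smul, mul_comm]
  | mul a b _ _ ha hb =>
    obtain ⟨r, hr, d, hd, hd0, h⟩ := ha
    obtain ⟨r', hr', d', hd', hd0', h'⟩ := hb
    refine ⟨r * r', mul_mem hr hr', d * d',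
      mul_one_mem_of k hd hd', by simp [hd0, hd0'], ?_⟩
    rw [map_mul, map_mul, ← h, ← h', smul_mul_smul_comm]

lemma ev_mem_fracAlg {A : Subalgebra k (MatPoly k n m)} (β : PolyRing k n m →ₐ[k] L)
    {r} (hr : r ∈ A) : β.mapMatrix r ∈ fracAlg k A β :=
  Algebra.subset_adjoin ⟨r, hr, rfl⟩

lemma trace_fracAlg (hn : 1 ≤ n) {A : Subalgebra k (MatPoly k n m)} (hGA : GMN k n m ≤ A)
    (htr : ∀ r ∈ A, r.trace ∈ trC k n m)
    {β : PolyRing k n m →ₐ[k] L} (hβ : Gen k β) {q : Matrix (Fin n) (Fin n) L}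
    (hq : q ∈ fracAlg k A β) : q.trace ∈ scalField k A β := by
  obtain ⟨r, hr, d, hd, hd0, h⟩ := mem_fracAlg k hq
  have h1 := congrArg Matrix.trace h
  rw [trace_ev, Matrix.trace_smul, smul_eq_mul] at h1
  have h3 : q.trace = β r.trace / β d := by rw [← h1]; field_simp
  rw [h3]
  exact div_mem (trC_mem_scalField k hn hGA hβ (htr r hr)) (scal_mem k β hd)

/-- a matrix commuting with the image of `G` is scalar -/
lemma scalar_of_commute (hn : 1 ≤ n) [CharZero L] {β : PolyRing k n m →ₐ[k] L} (hβ : Gen k β)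
    {q : Matrix (Fin n) (Fin n) L} (hq : ∀ r ∈ GMN k n m, q * β.mapMatrix r = β.mapMatrix r * q) :
    q = (q.trace / n) • 1 := by
  obtain ⟨x, hx, hd⟩ := hβ
  have h1 : ∀ M : Matrix (Fin n) (Fin n) L, q * M = M * q := by
    intro M
    obtain ⟨c, rfl⟩ := ev_expand k β hd M
    simp only [Finset.mul_sum, Finset.sum_mul, Matrix.mul_smul, Matrix.smul_mul, hq _ (hx _)]
  obtain ⟨c, hc⟩ := Matrix.mem_range_scalar_of_commute_single (M := q) (fun i j _ => (h1 _).symm)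
  have hn0 : (n : L) ≠ 0 := Nat.cast_ne_zero.2 (by omega)
  rw [← hc]
  ext i j
  simp [Matrix.trace, Matrix.diagonal_apply, Matrix.one_apply, hn0]

theorem specN_of_point (hn : 1 ≤ n) {A : Subalgebra k (MatPoly k n m)} (hGA : GMN k n m ≤ A)
    (htr : ∀ r ∈ A, r.trace ∈ trC k n m) {β : PolyRing k n m →ₐ[k] L} (hβ : Gen k β)
    (J : TwoSidedIdeal ↥A) (hJ : ∀ p : ↥A, p ∈ J ↔ β.mapMatrix (p : MatPoly k n m) = 0) :
    J ∈ SpecN n ↥A := by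
  have : CharZero L := charZero_of_injective_algebraMap (algebraMap k L).injective
  have : Nonempty (Fin n) := ⟨⟨0, hn⟩⟩
  have hn0 : (n : L) ≠ 0 := Nat.cast_ne_zero.2 (by omega)
  obtain ⟨x, hx, hd⟩ := id hβ
  let ev : ↥A →+* Matrix (Fin n) (Fin n) L := (β.mapMatrix.comp A.val).toRingHom
  have hev : ∀ p : ↥A, ev p = β.mapMatrix (p : MatPoly k n m) := fun _ => rfl
  let f0 : idealQuot J →+* Matrix (Fin n) (Fin n) L := J.ringCon.lift ev (by
    intro p q hpq
    rw [TwoSidedIdeal.rel_iff, hJ, ← hev, map_sub, sub_eq_zero] at hpq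
    exact hpq)
  have hf0 : ∀ p : ↥A, f0 (J.ringCon.mk' p) = β.mapMatrix (p : MatPoly k n m) := fun p => rfl
  have hinj : Function.Injective f0 := by
    rw [injective_iff_map_eq_zero]
    intro q hq
    obtain ⟨p, rfl⟩ := J.ringCon.mk'_surjective q
    rw [hf0, ← hJ] at hq
    exact (RingCon.eq _).2 hq
  refine ⟨⟨?_, ?_⟩, ?_⟩
  · exact f0.domain_nontrivial
  · intro a b hab
    have h1 : ∀ M : Matrix (Fin n) (Fin n) L, f0 a * M * f0 b = 0 := by
      intro M
      obtain ⟨c, rfl⟩ := ev_expand k β hd M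
      simp only [Finset.mul_sum, Finset.sum_mul, Matrix.mul_smul, Matrix.smul_mul]
      refine Finset.sum_eq_zero fun i _ => ?_
      have := congrArg f0 (hab (J.ringCon.mk' ⟨x i, hGA (hx i)⟩))
      rw [map_mul, map_mul, hf0, map_zero] at this
      rw [this, smul_zero]
    by_contra! hne
    obtain ⟨ha, hb⟩ := hne
    have ha' : f0 a ≠ 0 := fun h => ha (hinj (by simpa using h))
    have hb' : f0 b ≠ 0 := fun h => hb (hinj (by simpa using h))
    obtain ⟨i, p, hip⟩ : ∃ i p, f0 a i p ≠ 0 := by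
      by_contra! h; exact ha' (by ext i j; exact h i j)
    obtain ⟨q, j, hqj⟩ : ∃ i p, f0 b i p ≠ 0 := by
      by_contra! h; exact hb' (by ext i j; exact h i j)
    have h2 := congrFun (congrFun (h1 (Matrix.single p q 1)) i) j
    rw [Matrix.mul_assoc, Matrix.mul_apply] at h2
    rw [Finset.sum_eq_single p] at h2
    · rw [Matrix.single_mul_apply_same] at h2
      simp [hip, hqj] at h2
    · intro b' _ hb'
      rw [Matrix.single_mul_apply_of_ne _ _ _ _ _ hb', mul_zero]
    · simp
  let K0 := scalField k A β
  let Q := fracAlg k A β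
  let f : idealQuot J →+* ↥Q := f0.codRestrict Q.toSubring (by
    intro q
    obtain ⟨p, rfl⟩ := J.ringCon.mk'_surjective q
    exact ev_mem_fracAlg k β p.2)
  have hf : ∀ q, ((f q : ↥Q) : Matrix (Fin n) (Fin n) L) = f0 q := fun _ => rfl
  let y : Fin n × Fin n → ↥Q := fun i => ⟨β.mapMatrix (x i), ev_mem_fracAlg k β (hGA (hx i))⟩
  have hδ : β (tgram x).det ∈ K0 := trC_mem_scalField k hn hGA hβ (trC_det k hx)
  have hadj : ∀ i j, (tgram (fun i => β.mapMatrix (x i))).adjugate i j ∈ K0 := by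
    intro i j
    rw [tgram_ev]
    have : (β.mapMatrix (tgram x)).adjugate = β.mapMatrix (tgram x).adjugate :=
      (RingHom.map_adjugate β.toRingHom (tgram x)).symm
    rw [this]
    exact trC_mem_scalField k hn hGA hβ (trC_adjugate k hx i j)
  have htrQ : ∀ q : ↥Q, (q : Matrix (Fin n) (Fin n) L).trace ∈ K0 := fun q =>
    trace_fracAlg k hn hGA htr hβ q.2
  have hlin : LinearIndependent K0 y := by
    have h1 : LinearIndependent L (fun i => β.mapMatrix (x i)) := by
      apply linearIndependent_of_top_le_span_of_card_eq_finrank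
      · intro M _
        obtain ⟨c, rfl⟩ := ev_expand k β hd M
        exact sum_mem fun i _ => Submodule.smul_mem _ _ (Submodule.subset_span ⟨i, rfl⟩)
      · rw [Module.finrank_matrix]; simp
    have h2 : LinearIndependent K0 (fun i => β.mapMatrix (x i)) := h1.restrict_scalars (by
      intro a b hab
      simpa [Subfield.smul_def] using hab)
    exact LinearIndependent.of_comp Q.val.toLinearMap h2
  have hspan : ⊤ ≤ Submodule.span K0 (Set.range y) := by
    intro q _
    have h := gram_expand (fun i => β.mapMatrix (x i)) (q : Matrix (Fin n) (Fin n) L)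
    rw [tgram_ev_det] at h
    have hmem : ∀ i, (∑ j, (tgram (fun i => β.mapMatrix (x i))).adjugate i j *
        ((q : Matrix (Fin n) (Fin n) L) * β.mapMatrix (x j)).trace) ∈ K0 := fun i =>
      sum_mem fun j _ => mul_mem (hadj i j) (htrQ (q * y j))
    have hq : q = ∑ i, (⟨_, mul_mem (inv_mem hδ) (hmem i)⟩ : K0) • y i := by
      apply Subtype.ext
      rw [AddSubmonoidClass.coe_finsetSum]
      have : ∀ i, (((⟨_, mul_mem (inv_mem hδ) (hmem i)⟩ : K0) • y i : ↥Q) :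
          Matrix (Fin n) (Fin n) L) = (β (tgram x).det)⁻¹ • ((∑ j, (tgram (fun i => β.mapMatrix (x i))).adjugate i j *
        ((q : Matrix (Fin n) (Fin n) L) * β.mapMatrix (x j)).trace) • β.mapMatrix (x i)) := by
        intro i
        rw [smul_smul]
        rfl
      simp_rw [this]
      rw [← Finset.smul_sum, h, smul_smul, inv_mul_cancel₀ hd, one_smul]
    rw [hq]
    exact sum_mem fun i _ => Submodule.smul_mem _ _ (Submodule.subset_span ⟨i, rfl⟩)
  refine ⟨↥Q, inferInstance, f, ?_, ?_, ?_, ?_, ↥K0, inferInstance, inferInstance, ?_, ?_⟩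
  · intro a b hab
    exact hinj (by rw [← hf, ← hf, hab])
  · intro c hc hc0
    obtain ⟨p, rfl⟩ := J.ringCon.mk'_surjective c
    have h1 : β.mapMatrix (p : MatPoly k n m) = ((β.mapMatrix (p : MatPoly k n m)).trace / n) • 1 := by
      refine scalar_of_commute k hn hβ fun r hr => ?_
      have := congrArg f0 (Subring.mem_center_iff.1 hc (J.ringCon.mk' ⟨r, hGA hr⟩))
      rw [map_mul, map_mul, hf0, hf0] at this
      exact this.symm
    set t := (β.mapMatrix (p : MatPoly k n m)).trace / n with ht
    have htK : t ∈ K0 := div_mem (htrQ ⟨_, ev_mem_fracAlg k β p.2⟩) (natCast_mem _ _)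
    have ht0 : t ≠ 0 := by
      intro h
      rw [h, zero_smul] at h1
      exact hc0 (hinj (by rw [hf0, h1, map_zero]))
    have h2 : f (J.ringCon.mk' p) = algebraMap K0 Q ⟨t, htK⟩ := by
      apply Subtype.ext
      rw [hf, hf0, h1, Algebra.algebraMap_eq_smul_one]
      rfl
    rw [h2]
    exact (IsUnit.mk0 (⟨t, htK⟩ : K0) (fun h => ht0 (congrArg Subtype.val h))).map _
  · intro q
    obtain ⟨r, hr, d, hd, hd0, h⟩ := mem_fracAlg k q.2
    refine ⟨J.ringCon.mk' ⟨r, hr⟩, J.ringCon.mk' ⟨d • 1, hd⟩, ?_, ?_, ?_⟩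
    · rw [Subring.mem_center_iff]
      intro g
      obtain ⟨g, rfl⟩ := J.ringCon.mk'_surjective g
      rw [← map_mul, ← map_mul]
      congr 1
      apply Subtype.ext
      simp
    · intro h0
      have := congrArg f0 h0
      rw [hf0, ev_smul_one, map_zero] at this
      simp [hd0] at this
    · apply Subtype.ext
      rw [hf, hf0, ← h]
      change (q : Matrix (Fin n) (Fin n) L) * β.mapMatrix (d • (1 : MatPoly k n m)) = _
      rw [ev_smul_one]
      simp
  · have : Nontrivial ↥Q := inferInstance
    refine ⟨⟨fun I => ?_⟩⟩
    by_cases hI : I = ⊥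
    · exact Or.inl hI
    right
    obtain ⟨q, hqI, hq0⟩ : ∃ q ∈ I, q ≠ 0 := by
      by_contra! h
      exact hI (le_bot_iff.1 fun q hq => by rw [TwoSidedIdeal.mem_bot]; exact h q hq)
    have hex : ∃ j, ((q : Matrix (Fin n) (Fin n) L) * β.mapMatrix (x j)).trace ≠ 0 := by
      by_contra! h
      have h' := gram_expand (fun i => β.mapMatrix (x i)) (q : Matrix (Fin n) (Fin n) L)
      rw [tgram_ev_det] at h'
      simp only [h, mul_zero, Finset.sum_const_zero, zero_smul] at h'
      rcases smul_eq_zero.1 h'.symm with h1 | h1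
      · exact hd h1
      · exact hq0 (Subtype.ext h1)
    obtain ⟨j, hj⟩ := hex
    have h := gram_dual (fun i => β.mapMatrix (x i)) ((q : Matrix (Fin n) (Fin n) L) * β.mapMatrix (x j))
    rw [tgram_ev_det] at h
    set t := β (tgram x).det * ((q : Matrix (Fin n) (Fin n) L) * β.mapMatrix (x j)).trace with ht
    have htK : t ∈ K0 := mul_mem hδ (htrQ (q * y j))
    have ht0 : t ≠ 0 := mul_ne_zero hd hj
    have h2 : algebraMap K0 Q ⟨t, htK⟩ ∈ I := by
      have : algebraMap K0 Q ⟨t, htK⟩ = ∑ i, ∑ l, algebraMap K0 Q ⟨_, hadj i l⟩ * (y i * (q * y j) * y l) := by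
        apply Subtype.ext
        rw [AddSubmonoidClass.coe_finsetSum]
        simp only [AddSubmonoidClass.coe_finsetSum]
        have h3 : ((algebraMap K0 Q ⟨t, htK⟩ : ↥Q) : Matrix (Fin n) (Fin n) L) = t • 1 := by
          rw [Algebra.algebraMap_eq_smul_one]; rfl
        rw [h3, ← h]
        refine Finset.sum_congr rfl fun i _ => Finset.sum_congr rfl fun l _ => ?_
        rw [← Algebra.smul_def]
        rfl
      rw [this]
      refine sum_mem fun i _ => sum_mem fun l _ => ?_
      exact I.mul_mem_left _ _ (I.mul_mem_right _ _ (I.mul_mem_left _ _ (I.mul_mem_right _ _ hqI)))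
    rw [eq_top_iff]
    intro s _
    have h4 : s = s * algebraMap K0 Q (⟨t, htK⟩⁻¹) * algebraMap K0 Q ⟨t, htK⟩ := by
      rw [mul_assoc, ← map_mul, inv_mul_cancel₀, map_one, mul_one]
      exact fun h => ht0 (congrArg Subtype.val h)
    rw [h4]
    exact I.mul_mem_left _ _ h2
  · ext q
    rw [Subring.mem_center_iff]
    constructor
    · rintro ⟨z, rfl⟩ g
      exact (Algebra.commutes z g).symm
    · intro hq
      have h1 : (q : Matrix (Fin n) (Fin n) L) = ((q : Matrix (Fin n) (Fin n) L).trace / n) • 1 := by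
        refine scalar_of_commute k hn hβ fun r hr => ?_
        exact (congrArg Subtype.val (hq ⟨_, ev_mem_fracAlg k β (hGA hr)⟩)).symm
      refine ⟨⟨_, div_mem (htrQ q) (natCast_mem _ n)⟩, ?_⟩
      apply Subtype.ext
      conv_rhs => rw [h1]
      rw [Algebra.algebraMap_eq_smul_one]
      rfl
  · rw [Module.finrank_eq_card_basis (Module.Basis.mk hlin hspan)]
    simp [sq]

end SpecOfPoint

section TraceRing
variable {n m : ℕ}

lemma trace_TMN {r : MatPoly k n m} (hr : r ∈ TMN k n m) : r.trace ∈ trC k n m := by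
  have key : ∀ s : MatPoly k n m, (∀ g ∈ GMN k n m, (s * g).trace ∈ trC k n m) →
      ∀ g ∈ GMN k n m, (r * s * g).trace ∈ trC k n m := by
    induction hr using Algebra.adjoin_induction with
    | mem z hz =>
      rcases hz with hz | ⟨w, hw, rfl⟩
      · intro s hs g hg
        rw [mul_assoc, Matrix.trace_mul_comm, mul_assoc]
        exact hs _ (mul_mem hg hz)
      · intro s hs g hg
        rw [traceScalar, mul_assoc, ← Algebra.smul_def, Matrix.trace_smul]
        exact mul_mem (trace_mem_trC k hw) (hs g hg)
    | algebraMap z =>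
      intro s hs g hg
      rw [mul_assoc, ← Algebra.smul_def, Matrix.trace_smul]
      exact Subalgebra.smul_mem _ (hs g hg) z
    | add a b _ _ ha hb =>
      intro s hs g hg
      rw [add_mul, add_mul, Matrix.trace_add]
      exact add_mem (ha s hs g hg) (hb s hs g hg)
    | mul a b _ _ ha hb =>
      intro s hs g hg
      rw [mul_assoc a b s]
      exact ha _ (hb s hs) g hg
  have := key 1 (fun g hg => by rw [one_mul]; exact trace_mem_trC k hg) 1 (one_mem _)
  simpa using this

end TraceRing
/-! ### Splitting central simple algebras -/
section Split
open scoped TensorProduct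

lemma tensor_simple {K Q L : Type} [Field K] [Ring Q] [Algebra K Q] [Field L] [Algebra K L]
    (hQ : IsSimpleRing Q) (hc : (algebraMap K Q).range = Subring.center Q) :
    IsSimpleRing (L ⊗[K] Q) := by
  classical
  have : Nontrivial Q := inferInstance
  have hnt : Nontrivial (L ⊗[K] Q) := inferInstance
  refine ⟨⟨fun I => ?_⟩⟩
  by_cases hI : I = ⊥
  · exact Or.inl hI
  right
  let b := Module.Basis.ofVectorSpace K L
  let e := TensorProduct.equivFinsuppOfBasisLeft (N := Q) b
  have hl : ∀ (r : Q) (y : L ⊗[K] Q) i, e ((1 ⊗ₜ r) * y) i = r * e y i := by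
    intro r y i
    induction y using TensorProduct.induction_on with
    | zero => simp
    | tmul l q => simp [e, TensorProduct.equivFinsuppOfBasisLeft_apply_tmul_apply]
    | add a b ha hb => rw [mul_add, map_add, map_add, Finsupp.add_apply, Finsupp.add_apply, ha, hb, mul_add]
  have hr : ∀ (r : Q) (y : L ⊗[K] Q) i, e (y * (1 ⊗ₜ r)) i = e y i * r := by
    intro r y i
    induction y using TensorProduct.induction_on with
    | zero => simp
    | tmul l q => simp [e, TensorProduct.equivFinsuppOfBasisLeft_apply_tmul_apply]
    | add a b ha hb => rw [add_mul, map_add, map_add, Finsupp.add_apply, Finsupp.add_apply, ha, hb, add_mul]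
  have hex : ∃ N, ∃ x ∈ I, x ≠ 0 ∧ (e x).support.card = N := by
    by_contra! h
    exact hI (le_bot_iff.1 fun q hq => by
      rw [TwoSidedIdeal.mem_bot]
      by_contra h0
      exact h _ q hq h0 rfl)
  obtain ⟨x, hxI, hx0, hxN⟩ := Nat.find_spec hex
  have hmin : ∀ y ∈ I, y ≠ 0 → (e x).support.card ≤ (e y).support.card := by
    intro y hy hy0
    rw [hxN]
    exact Nat.find_min' hex ⟨y, hy, hy0, rfl⟩
  have hex0 : e x ≠ 0 := by simpa using hx0
  obtain ⟨i0, hi0⟩ := Finsupp.support_nonempty_iff.2 hex0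
  let W : TwoSidedIdeal Q := TwoSidedIdeal.mk'
    {w | ∃ y ∈ I, (e y).support ⊆ (e x).support ∧ e y i0 = w}
    ⟨0, I.zero_mem, by simp, by simp⟩
    (by
      rintro _ _ ⟨y, hy, hs, rfl⟩ ⟨z, hz, hs', rfl⟩
      refine ⟨y + z, I.add_mem hy hz, ?_, by simp⟩
      rw [map_add]
      exact Finsupp.support_add.trans (Finset.union_subset hs hs'))
    (by
      rintro _ ⟨y, hy, hs, rfl⟩
      refine ⟨-y, I.neg_mem hy, ?_, by simp⟩
      rw [map_neg, Finsupp.support_neg]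
      exact hs)
    (by
      rintro r _ ⟨y, hy, hs, rfl⟩
      refine ⟨(1 ⊗ₜ r) * y, I.mul_mem_left _ _ hy, ?_, hl _ _ _⟩
      intro i hi
      apply hs
      rw [Finsupp.mem_support_iff] at hi ⊢
      intro h
      rw [hl, h, mul_zero] at hi
      exact hi rfl)
    (by
      rintro _ r ⟨y, hy, hs, rfl⟩
      refine ⟨y * (1 ⊗ₜ r), I.mul_mem_right _ _ hy, ?_, hr _ _ _⟩
      intro i hi
      apply hs
      rw [Finsupp.mem_support_iff] at hi ⊢
      intro h
      rw [hr, h, zero_mul] at hi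
      exact hi rfl)
  have hW : ∀ w, w ∈ W ↔ ∃ y ∈ I, (e y).support ⊆ (e x).support ∧ e y i0 = w := fun w =>
    TwoSidedIdeal.mem_mk' _ _ _ _ _ _ _
  have hWtop : W = ⊤ := by
    rcases hQ.simple.eq_bot_or_eq_top W with h | h
    · exfalso
      have : e x i0 ∈ W := (hW _).2 ⟨x, hxI, subset_rfl, rfl⟩
      rw [h, TwoSidedIdeal.mem_bot] at this
      exact (Finsupp.mem_support_iff.1 hi0) this
    · exact h
  obtain ⟨y, hyI, hys, hy1⟩ := (hW 1).1 (by rw [hWtop]; trivial)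
  have hcom : ∀ r : Q, (1 ⊗ₜ r) * y - y * (1 ⊗ₜ r) = 0 := by
    intro r
    by_contra hne
    have h1 := hmin _ (I.sub_mem (I.mul_mem_left (1 ⊗ₜ r) _ hyI) (I.mul_mem_right _ (1 ⊗ₜ r) hyI)) hne
    have h2 : (e ((1 ⊗ₜ r) * y - y * (1 ⊗ₜ r))).support ⊆ (e x).support.erase i0 := by
      intro i hi
      rw [Finsupp.mem_support_iff, map_sub, Finsupp.sub_apply, hl, hr] at hi
      rw [Finset.mem_erase]
      refine ⟨?_, hys ?_⟩
      · rintro rfl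
        rw [hy1] at hi
        simp at hi
      · rw [Finsupp.mem_support_iff]
        intro h
        simp [h] at hi
    have h3 := Finset.card_le_card h2
    rw [Finset.card_erase_of_mem hi0] at h3
    have : 0 < (e x).support.card := Finset.card_pos.2 ⟨i0, hi0⟩
    omega
  have hcen : ∀ i, ∃ c : K, algebraMap K Q c = e y i := by
    intro i
    have : e y i ∈ Subring.center Q := by
      rw [Subring.mem_center_iff]
      intro r
      rw [← hl, ← hr, sub_eq_zero.1 (hcom r)]
    rw [← hc] at this
    exact this
  choose c hc' using hcen
  obtain ⟨l, hl'⟩ : ∃ l : L, y = l ⊗ₜ 1 := by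
    refine ⟨∑ i ∈ (e y).support, c i • b i, ?_⟩
    apply e.injective
    rw [TensorProduct.sum_tmul, map_sum]
    ext i
    rw [Finsupp.finsetSum_apply]
    have : ∀ j ∈ (e y).support, e ((c j • b j) ⊗ₜ[K] (1 : Q)) i = if j = i then e y i else 0 := by
      intro j _
      rw [TensorProduct.equivFinsuppOfBasisLeft_apply_tmul_apply]
      simp only [map_smul, Module.Basis.repr_self, Finsupp.smul_apply]
      by_cases hji : j = i
      · subst hji
        simp [← hc', Algebra.algebraMap_eq_smul_one]
      · simp [hji]
    rw [Finset.sum_congr rfl this]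
    by_cases hi : i ∈ (e y).support
    · simp only [Finset.sum_ite_eq', hi, if_true]
    · simp only [Finset.sum_ite_eq', hi, if_false]
      simpa using hi
  have hl0 : l ≠ 0 := by
    rintro rfl
    rw [TensorProduct.zero_tmul] at hl'
    rw [hl'] at hy1
    simp at hy1
  rw [eq_top_iff]
  intro s _
  have : s = s * (l⁻¹ ⊗ₜ 1) * y := by
    rw [hl', mul_assoc, Algebra.TensorProduct.tmul_mul_tmul, inv_mul_cancel₀ hl0, mul_one,
      ← Algebra.TensorProduct.one_def, mul_one]
  rw [this]
  exact I.mul_mem_left _ _ hyI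

theorem csa_split {n : ℕ} (hn : 1 ≤ n) {Q : Type} [Ring Q] (h : IsCSAOfDegree n Q) :
    ∃ (L : Type) (_ : Field L) (φ : Q →+* Matrix (Fin n) (Fin n) L), Function.Injective φ ∧
      Submodule.span L (Set.range φ) = ⊤ := by
  obtain ⟨hQ, K, _, _, hc, hfr⟩ := h
  have hfin : FiniteDimensional K Q := by
    apply Module.finite_of_finrank_pos
    rw [hfr]; positivity
  let L := AlgebraicClosure K
  have hs := tensor_simple (L := L) hQ hc
  obtain ⟨d, hd, ⟨e⟩⟩ := IsSimpleRing.exists_algEquiv_matrix_of_isAlgClosed L (L ⊗[K] Q)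
  have hdn : d = n := by
    have h1 := e.toLinearEquiv.finrank_eq
    rw [Module.finrank_baseChange, hfr, Module.finrank_matrix] at h1
    simp at h1
    nlinarith
  subst hdn
  refine ⟨L, inferInstance, (e.toRingEquiv.toRingHom).comp
    (Algebra.TensorProduct.includeRight : Q →ₐ[K] L ⊗[K] Q).toRingHom, ?_, ?_⟩
  · intro a b hab
    have := e.injective hab
    exact Algebra.TensorProduct.includeRight_injective (algebraMap K L).injective this
  · rw [eq_top_iff]
    intro M _
    obtain ⟨t, rfl⟩ := e.surjective M
    induction t using TensorProduct.induction_on with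
    | zero => simp
    | add a b ha hb =>
      rw [map_add]
      exact add_mem (ha trivial) (hb trivial)
    | tmul l q =>
      have : l ⊗ₜ[K] q = l • ((1 : L) ⊗ₜ[K] q) := by simp [TensorProduct.smul_tmul']
      rw [this, map_smul]
      exact Submodule.smul_mem _ _ (Submodule.subset_span ⟨q, rfl⟩)

end Split
/-! ### Elements of `Spec_n` come from points -/
section PointOfSpec
variable {n m : ℕ}

lemma scalar_of_commute_span {L : Type} [Field L] (S : Set (Matrix (Fin n) (Fin n) L))
    (hS : Submodule.span L S = ⊤) {q : Matrix (Fin n) (Fin n) L} (hq : ∀ s ∈ S, q * s = s * q) :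
    ∃ l : L, q = l • 1 := by
  have h1 : ∀ M : Matrix (Fin n) (Fin n) L, q * M = M * q := by
    intro M
    have hM : M ∈ Submodule.span L S := by rw [hS]; trivial
    induction hM using Submodule.span_induction with
    | mem x hx => exact hq x hx
    | zero => simp
    | add a b _ _ ha hb => rw [mul_add, add_mul, ha, hb]
    | smul c a _ ha => rw [Matrix.mul_smul, Matrix.smul_mul, ha]
  obtain ⟨c, hc⟩ := Matrix.mem_range_scalar_of_commute_single (M := q) (fun i j _ => (h1 _).symm)
  refine ⟨c, ?_⟩
  rw [← hc]
  ext i j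
  simp [Matrix.diagonal_apply, Matrix.one_apply]

theorem hom_of_spec (hn : 1 ≤ n) {R : Type} [Ring R] [Algebra k R] {J : TwoSidedIdeal R}
    (hJ : J ∈ SpecN n R) :
    ∃ (L : Type) (_ : Field L) (_ : Algebra k L) (ψ : R →ₐ[k] Matrix (Fin n) (Fin n) L),
      (∀ p, p ∈ J ↔ ψ p = 0) ∧ Submodule.span L (Set.range ψ) = ⊤ := by
  obtain ⟨-, Q, _, f, finj, funit, ffrac, hcsa⟩ := hJ
  obtain ⟨L, _, φ, φinj, φspan⟩ := csa_split hn hcsa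
  have : Nonempty (Fin n) := ⟨⟨0, hn⟩⟩
  have hcen : ∀ c ∈ Subring.center (idealQuot J), c ≠ 0 → ∀ q : Q, f c * q = q * f c := by
    intro c hc hc0 q
    obtain ⟨r, d, hd, hd0, h⟩ := ffrac q
    obtain ⟨u, hu⟩ := funit d hd hd0
    have h1 : f c * f r = f r * f c := by
      rw [← map_mul, ← map_mul, Subring.mem_center_iff.1 hc r]
    have h2 : f c * f d = f d * f c := by
      rw [← map_mul, ← map_mul, Subring.mem_center_iff.1 hc d]
    rw [← hu] at h h2
    apply u.isUnit.mul_left_injective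
    change f c * q * u = q * f c * u
    rw [mul_assoc, h, mul_assoc q, h2, ← mul_assoc, h, h1]
  let ψ0 : R →+* Matrix (Fin n) (Fin n) L := (φ.comp f).comp J.ringCon.mk'
  have hψ0 : ∀ p, ψ0 p = φ (f (J.ringCon.mk' p)) := fun _ => rfl
  have hker : ∀ p, p ∈ J ↔ ψ0 p = 0 := by
    intro p
    rw [hψ0, map_eq_zero_iff φ φinj, map_eq_zero_iff f finj]
    exact (RingCon.eq _).symm
  have hspan : Submodule.span L (Set.range ψ0) = ⊤ := by
    rw [eq_top_iff, ← φspan, Submodule.span_le]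
    rintro _ ⟨q, rfl⟩
    obtain ⟨r, d, hd, hd0, h⟩ := ffrac q
    obtain ⟨l, hl⟩ := scalar_of_commute_span (Set.range φ) φspan (q := φ (f d)) (by
      rintro _ ⟨q', rfl⟩
      rw [← map_mul, ← map_mul, hcen d hd hd0])
    have hl0 : l ≠ 0 := by
      rintro rfl
      rw [zero_smul, map_eq_zero_iff φ φinj, map_eq_zero_iff f finj] at hl
      exact hd0 hl
    have h1 : φ q = l⁻¹ • φ (f r) := by
      rw [← h, map_mul, hl]
      simp [smul_smul, hl0]
    obtain ⟨p, rfl⟩ := J.ringCon.mk'_surjective r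
    rw [h1]
    exact Submodule.smul_mem _ _ (Submodule.subset_span ⟨p, rfl⟩)
  have hscal : ∀ a : k, ∃ l : L, ψ0 (algebraMap k R a) = l • 1 := by
    intro a
    apply scalar_of_commute_span (Set.range ψ0) hspan
    rintro _ ⟨p, rfl⟩
    rw [← map_mul, ← map_mul, Algebra.commutes]
  choose ι hι using hscal
  have hsinj : ∀ a b : L, a • (1 : Matrix (Fin n) (Fin n) L) = b • 1 → a = b := by
    intro a b hab
    have := congrFun (congrFun hab ⟨0, hn⟩) ⟨0, hn⟩
    simpa using this
  let ιr : k →+* L :=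
    { toFun := ι
      map_one' := hsinj _ _ (by rw [← hι, map_one, map_one, one_smul])
      map_zero' := hsinj _ _ (by rw [← hι, map_zero, map_zero, zero_smul])
      map_add' := fun a b => hsinj _ _ (by rw [← hι, map_add, map_add, hι, hι, add_smul])
      map_mul' := fun a b => hsinj _ _ (by rw [← hι, map_mul, map_mul, hι, hι]; simp [smul_smul, mul_comm]) }
  let _ : Algebra k L := ιr.toAlgebra
  refine ⟨L, inferInstance, inferInstance, { ψ0 with commutes' := ?_ }, hker, hspan⟩
  intro a
  change ψ0 (algebraMap k R a) = _
  rw [hι, IsScalarTower.algebraMap_apply k L (Matrix (Fin n) (Fin n) L), Algebra.algebraMap_eq_smul_one]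
  rfl

theorem point_of_spec (hn : 1 ≤ n) {A : Subalgebra k (MatPoly k n m)} (hGA : GMN k n m ≤ A)
    {S : Set (MatPoly k n m)} (hS : S ⊆ traceScalar k '' (GMN k n m : Set (MatPoly k n m)))
    (hAS : A = Algebra.adjoin k ((GMN k n m : Set (MatPoly k n m)) ∪ S))
    {J : TwoSidedIdeal ↥A} (hJ : J ∈ SpecN n ↥A) :
    ∃ (L : Type) (_ : Field L) (_ : Algebra k L) (β : PolyRing k n m →ₐ[k] L),
      Gen k β ∧ ∀ p : ↥A, p ∈ J ↔ β.mapMatrix (p : MatPoly k n m) = 0 := by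
  obtain ⟨L, _, _, ψ, hker, hspan⟩ := hom_of_spec k hn hJ
  have hgen : ∀ h, genericMatrix k n m h ∈ GMN k n m := fun h => Algebra.subset_adjoin ⟨h, rfl⟩
  let β : PolyRing k n m →ₐ[k] L := MvPolynomial.aeval
    fun x : MIdx n m => ψ ⟨genericMatrix k n m x.1, hGA (hgen x.1)⟩ x.2.1 x.2.2
  have h1 : ∀ p (hp : p ∈ GMN k n m), ψ ⟨p, hGA hp⟩ = β.mapMatrix p := by
    intro p hp
    induction hp using Algebra.adjoin_induction with
    | mem x hx =>
      obtain ⟨h, rfl⟩ := hx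
      ext i j
      simp [β, genericMatrix]
    | algebraMap z =>
      rw [AlgHom.commutes]
      exact ψ.commutes z
    | add a b ha hb iha ihb =>
      rw [map_add, ← iha, ← ihb, ← map_add]
      rfl
    | mul a b ha hb iha ihb =>
      rw [map_mul, ← iha, ← ihb, ← map_mul]
      rfl
  have hcl : ∀ v ∈ Submodule.span L (β.mapMatrix '' (GMN k n m : Set (MatPoly k n m))),
      ∀ w ∈ Submodule.span L (β.mapMatrix '' (GMN k n m : Set (MatPoly k n m))),
      v * w ∈ Submodule.span L (β.mapMatrix '' (GMN k n m : Set (MatPoly k n m))) := by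
    intro v hv w hw
    have h := Submodule.mul_mem_mul hv hw
    rw [Submodule.span_mul_span] at h
    refine Submodule.span_mono ?_ h
    rintro _ ⟨_, ⟨x, hx, rfl⟩, _, ⟨y, hy, rfl⟩, rfl⟩
    exact ⟨x * y, mul_mem hx hy, map_mul _ _ _⟩
  have hsc : ∀ (w) (hw : traceScalar k w ∈ A), ∃ l : L, ψ ⟨traceScalar k w, hw⟩ = l • 1 := by
    intro w hw
    apply scalar_of_commute_span (Set.range ψ) hspan
    rintro _ ⟨p, rfl⟩
    rw [← map_mul, ← map_mul]
    congr 1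
    apply Subtype.ext
    change traceScalar k w * p = p * traceScalar k w
    rw [traceScalar, Algebra.commutes]
  have h2 : ∀ p (hp : p ∈ A), ψ ⟨p, hp⟩ ∈
      Submodule.span L (β.mapMatrix '' (GMN k n m : Set (MatPoly k n m))) := by
    intro p hp
    have hp' := hp
    rw [hAS] at hp'
    induction hp' using Algebra.adjoin_induction with
    | mem x hx =>
      rcases hx with hx | hx
      · rw [h1 x hx]
        exact Submodule.subset_span ⟨x, hx, rfl⟩
      · obtain ⟨w, hw, rfl⟩ := hS hx
        obtain ⟨l, hl⟩ := hsc w hp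
        rw [hl]
        exact Submodule.smul_mem _ _ (Submodule.subset_span ⟨1, one_mem _, map_one _⟩)
    | algebraMap z =>
      rw [h1 _ (Subalgebra.algebraMap_mem _ z)]
      exact Submodule.subset_span ⟨_, Subalgebra.algebraMap_mem _ z, rfl⟩
    | add a b ha hb iha ihb =>
      rw [← hAS] at ha hb
      have := add_mem (iha ha) (ihb hb)
      rw [← map_add] at this
      exact this
    | mul a b ha hb iha ihb =>
      rw [← hAS] at ha hb
      have := hcl _ (iha ha) _ (ihb hb)
      rw [← map_mul] at this
      exact this
  have hGen : Gen k β := by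
    apply gen_of_span
    rw [eq_top_iff, ← hspan, Submodule.span_le]
    rintro _ ⟨p, rfl⟩
    exact h2 p p.2
  refine ⟨L, inferInstance, inferInstance, β, hGen, ?_⟩
  obtain ⟨c0, hc0, hc00⟩ := exists_cond k hn β hGen
  have hc1 : c0 • (1 : MatPoly k n m) ∈ GMN k n m := by simpa using hc0 1 (one_mem _)
  suffices h3 : ∀ p (hp : p ∈ A), ψ ⟨p, hp⟩ = β.mapMatrix p by
    intro p
    rw [hker, h3 p p.2]
  intro p hp
  have hp' := hp
  rw [hAS] at hp'
  induction hp' using Algebra.adjoin_induction with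
  | mem x hx =>
    rcases hx with hx | hx
    · exact h1 x hx
    · obtain ⟨w, hw, rfl⟩ := hS hx
      have e1 : (w.trace * c0) • (1 : MatPoly k n m) ∈ GMN k n m := by
        rw [mul_smul]; exact hc0 _ (trace_mem_trC k hw)
      have e2 := h1 _ e1
      have e3 : (⟨(w.trace * c0) • (1 : MatPoly k n m), hGA e1⟩ : ↥A) =
          ⟨c0 • (1 : MatPoly k n m), hGA hc1⟩ * ⟨traceScalar k w, hp⟩ := by
        apply Subtype.ext
        change _ = (c0 • (1 : MatPoly k n m)) * traceScalar k w
        rw [traceScalar, Algebra.algebraMap_eq_smul_one]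
        simp [smul_smul, mul_comm]
      rw [e3, map_mul, h1 _ hc1, ev_smul_one, ev_smul_one, map_mul] at e2
      have e4 : β c0 • ψ ⟨traceScalar k w, hp⟩ = β c0 • (β w.trace • (1 : Matrix (Fin n) (Fin n) L)) := by
        rw [smul_smul, mul_comm (β c0), ← e2]; simp
      have e5 := smul_right_injective _ hc00 e4
      rw [e5, traceScalar, Algebra.algebraMap_eq_smul_one, ev_smul_one]
  | algebraMap z => exact h1 _ (Subalgebra.algebraMap_mem _ z)
  | add a b ha hb iha ihb =>
    rw [← hAS] at ha hb
    rw [map_add, ← iha ha, ← ihb hb, ← map_add]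
    rfl
  | mul a b ha hb iha ihb =>
    rw [← hAS] at ha hb
    rw [map_mul, ← iha ha, ← ihb hb, ← map_mul]
    rfl

end PointOfSpec
/-! ### Conjugation of points -/
section Conj
variable {n m : ℕ} {L : Type} [CommRing L] [Algebra k L]

/-- the point given by a tuple of matrices -/
def mkPt (M : Fin m → Matrix (Fin n) (Fin n) L) : PolyRing k n m →ₐ[k] L :=
  MvPolynomial.aeval fun x : MIdx n m => M x.1 x.2.1 x.2.2

lemma mkPt_generic (M : Fin m → Matrix (Fin n) (Fin n) L) (h : Fin m) :
    (mkPt k M).mapMatrix (genericMatrix k n m h) = M h := by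
  ext i j
  simp [mkPt, genericMatrix]

lemma pt_ext {β γ : PolyRing k n m →ₐ[k] L}
    (h : ∀ t, β.mapMatrix (genericMatrix k n m t) = γ.mapMatrix (genericMatrix k n m t)) : β = γ := by
  apply MvPolynomial.algHom_ext
  rintro ⟨t, i, j⟩
  have := congrFun (congrFun (h t) i) j
  simpa [genericMatrix] using this

/-- conjugate of a point -/
def conjP (g : GL (Fin n) L) (β : PolyRing k n m →ₐ[k] L) : PolyRing k n m →ₐ[k] L :=
  mkPt k fun h => (g : Matrix (Fin n) (Fin n) L) * β.mapMatrix (genericMatrix k n m h) *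
    ((g⁻¹ : GL (Fin n) L) : Matrix (Fin n) (Fin n) L)

lemma conjP_generic (g : GL (Fin n) L) (β : PolyRing k n m →ₐ[k] L) (h : Fin m) :
    (conjP k g β).mapMatrix (genericMatrix k n m h) =
    (g : Matrix (Fin n) (Fin n) L) * β.mapMatrix (genericMatrix k n m h) *
    ((g⁻¹ : GL (Fin n) L) : Matrix (Fin n) (Fin n) L) := mkPt_generic k _ h

lemma conj_mul_conj (g : GL (Fin n) L) (a b : Matrix (Fin n) (Fin n) L) :
    ((g : Matrix (Fin n) (Fin n) L) * a * ((g⁻¹ : GL (Fin n) L) : Matrix (Fin n) (Fin n) L)) *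
    ((g : Matrix (Fin n) (Fin n) L) * b * ((g⁻¹ : GL (Fin n) L) : Matrix (Fin n) (Fin n) L)) =
    (g : Matrix (Fin n) (Fin n) L) * (a * b) * ((g⁻¹ : GL (Fin n) L) : Matrix (Fin n) (Fin n) L) := by
  have h : ((g⁻¹ : GL (Fin n) L) : Matrix (Fin n) (Fin n) L) * (g : Matrix (Fin n) (Fin n) L) = 1 := by
    rw [← Units.val_mul, inv_mul_cancel, Units.val_one]
  calc _ = (g : Matrix (Fin n) (Fin n) L) * a *
      (((g⁻¹ : GL (Fin n) L) : Matrix (Fin n) (Fin n) L) * (g : Matrix (Fin n) (Fin n) L)) * b *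
      ((g⁻¹ : GL (Fin n) L) : Matrix (Fin n) (Fin n) L) := by simp only [mul_assoc]
    _ = _ := by rw [h]; simp only [mul_assoc, one_mul]

lemma conj_scalar (g : GL (Fin n) L) (c : L) :
    (g : Matrix (Fin n) (Fin n) L) * (c • 1) * ((g⁻¹ : GL (Fin n) L) : Matrix (Fin n) (Fin n) L) =
    c • 1 := by
  rw [Matrix.mul_smul, mul_one, Matrix.smul_mul, ← Units.val_mul, mul_inv_cancel, Units.val_one]

lemma ev_smul_one' (β : PolyRing k n m →ₐ[k] L) (c : PolyRing k n m) :
    β.mapMatrix (c • (1 : MatPoly k n m)) = β c • 1 := by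
  ext i j
  by_cases h : i = j
  · subst h; simp
  · simp [h]

lemma trace_ev' (β : PolyRing k n m →ₐ[k] L) (z : MatPoly k n m) :
    (β.mapMatrix z).trace = β z.trace :=
  (AddMonoidHom.map_trace β.toRingHom.toAddMonoidHom z).symm

lemma conjP_G (g : GL (Fin n) L) (β : PolyRing k n m →ₐ[k] L) {p : MatPoly k n m}
    (hp : p ∈ GMN k n m) : (conjP k g β).mapMatrix p =
    (g : Matrix (Fin n) (Fin n) L) * β.mapMatrix p *
    ((g⁻¹ : GL (Fin n) L) : Matrix (Fin n) (Fin n) L) := by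
  induction hp using Algebra.adjoin_induction with
  | mem x hx =>
    obtain ⟨h, rfl⟩ := hx
    exact conjP_generic k g β h
  | algebraMap z =>
    rw [AlgHom.commutes, AlgHom.commutes, IsScalarTower.algebraMap_apply k L, Algebra.algebraMap_eq_smul_one,
      conj_scalar]
  | add a b _ _ ha hb => rw [map_add, map_add, ha, hb, mul_add, add_mul]
  | mul a b _ _ ha hb => rw [map_mul, map_mul, ha, hb, conj_mul_conj]

lemma conjP_trace (g : GL (Fin n) L) (β : PolyRing k n m →ₐ[k] L) {p : MatPoly k n m}
    (hp : p ∈ GMN k n m) : conjP k g β p.trace = β p.trace := by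
  rw [← trace_ev', ← trace_ev', conjP_G k g β hp, Matrix.trace_mul_comm, ← mul_assoc, ← Units.val_mul,
    inv_mul_cancel, Units.val_one, one_mul]

lemma conjP_T (g : GL (Fin n) L) (β : PolyRing k n m →ₐ[k] L) {p : MatPoly k n m}
    (hp : p ∈ TMN k n m) : (conjP k g β).mapMatrix p =
    (g : Matrix (Fin n) (Fin n) L) * β.mapMatrix p *
    ((g⁻¹ : GL (Fin n) L) : Matrix (Fin n) (Fin n) L) := by
  induction hp using Algebra.adjoin_induction with
  | mem x hx =>
    rcases hx with hx | ⟨w, hw, rfl⟩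
    · exact conjP_G k g β hx
    · rw [traceScalar, Algebra.algebraMap_eq_smul_one, ev_smul_one', ev_smul_one', conj_scalar,
        conjP_trace k g β hw]
  | algebraMap z =>
    rw [AlgHom.commutes, AlgHom.commutes, IsScalarTower.algebraMap_apply k L, Algebra.algebraMap_eq_smul_one,
      conj_scalar]
  | add a b _ _ ha hb => rw [map_add, map_add, ha, hb, mul_add, add_mul]
  | mul a b _ _ ha hb => rw [map_mul, map_mul, ha, hb, conj_mul_conj]

lemma conjP_zero_iff (g : GL (Fin n) L) (β : PolyRing k n m →ₐ[k] L) {p : MatPoly k n m}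
    (hp : p ∈ TMN k n m) : (conjP k g β).mapMatrix p = 0 ↔ β.mapMatrix p = 0 := by
  rw [conjP_T k g β hp]
  constructor
  · intro h
    have h2 := congrArg (fun M => ((g⁻¹ : GL (Fin n) L) : Matrix (Fin n) (Fin n) L) * M *
      (g : Matrix (Fin n) (Fin n) L)) h
    have h3 : ((g⁻¹ : GL (Fin n) L) : Matrix (Fin n) (Fin n) L) * (g : Matrix (Fin n) (Fin n) L) = 1 := by
      rw [← Units.val_mul, inv_mul_cancel, Units.val_one]
    simp only [mul_zero, zero_mul] at h2
    calc β.mapMatrix p = (((g⁻¹ : GL (Fin n) L) : Matrix (Fin n) (Fin n) L) * (g : Matrix (Fin n) (Fin n) L))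
        * β.mapMatrix p * (((g⁻¹ : GL (Fin n) L) : Matrix (Fin n) (Fin n) L) * (g : Matrix (Fin n) (Fin n) L)) := by
          rw [h3, one_mul, mul_one]
      _ = _ := by simpa only [mul_assoc] using h2
  · intro h
    rw [h, mul_zero, zero_mul]

lemma conjP_conjP (g h : GL (Fin n) L) (β : PolyRing k n m →ₐ[k] L) :
    conjP k g (conjP k h β) = conjP k (g * h) β := by
  apply pt_ext
  intro t
  rw [conjP_generic, conjP_generic, conjP_generic, mul_inv_rev, Units.val_mul, Units.val_mul]
  simp only [mul_assoc]

lemma conjP_one (β : PolyRing k n m →ₐ[k] L) : conjP k 1 β = β := by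
  apply pt_ext
  intro t
  rw [conjP_generic]
  simp

lemma mapMatrix_comp {L' : Type} [CommRing L'] [Algebra k L'] (φ : L →ₐ[k] L')
    (β : PolyRing k n m →ₐ[k] L) (p : MatPoly k n m) :
    (φ.comp β).mapMatrix p = φ.mapMatrix (β.mapMatrix p) := by
  ext i j; simp

lemma conjP_comp {L' : Type} [CommRing L'] [Algebra k L'] (φ : L →ₐ[k] L') (g : GL (Fin n) L)
    (β : PolyRing k n m →ₐ[k] L) :
    φ.comp (conjP k g β) = conjP k (Units.map (φ.mapMatrix : Matrix (Fin n) (Fin n) L →ₐ[k] _).toRingHom.toMonoidHom g) (φ.comp β) := by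
  apply pt_ext
  intro t
  rw [mapMatrix_comp, conjP_generic, conjP_generic, mapMatrix_comp, map_mul, map_mul]
  rfl

lemma polyEval_conjAct (g : GL (Fin n) k) (a : MTuple k n m) :
    polyEval k (conjAct k g a) = conjP k g (polyEval k a) := by
  apply pt_ext
  intro t
  rw [conjP_generic]
  exact (evalMat_generic k _ t).trans (by rw [conjAct]; congr 2; exact (evalMat_generic k _ t).symm)

/-- evaluation on `P[g]` -/
def evG (g : Matrix (Fin n) (Fin n) L) (β : PolyRing k n m →ₐ[k] L) :
    MvPolynomial (Fin n × Fin n) (PolyRing k n m) →+* L :=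
  MvPolynomial.eval₂Hom β.toRingHom fun x => g x.1 x.2

/-- generic group element -/
def gGen (n m : ℕ) : Matrix (Fin n) (Fin n) (MvPolynomial (Fin n × Fin n) (PolyRing k n m)) :=
  Matrix.of fun i j => MvPolynomial.X (i, j)

lemma evG_gGen (g : Matrix (Fin n) (Fin n) L) (β : PolyRing k n m →ₐ[k] L) :
    (evG k g β).mapMatrix (gGen k n m) = g := by
  ext i j
  simp [evG, gGen]

lemma evG_C (g : Matrix (Fin n) (Fin n) L) (β : PolyRing k n m →ₐ[k] L) (p : MatPoly k n m) :
    (evG k g β).mapMatrix (MvPolynomial.C.mapMatrix p) = β.mapMatrix p := by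
  ext i j
  simp [evG]

/-- homogenization -/
lemma exists_hat (p : PolyRing k n m) :
    ∃ (N : ℕ) (q : MvPolynomial (Fin n × Fin n) (PolyRing k n m)),
      ∀ (L : Type) [CommRing L] [Algebra k L] (g : GL (Fin n) L) (β : PolyRing k n m →ₐ[k] L),
        evG k (g : Matrix (Fin n) (Fin n) L) β q =
          (g : Matrix (Fin n) (Fin n) L).det ^ N * conjP k g β p := by
  have hD : ∀ (L : Type) [CommRing L] [Algebra k L] (g : GL (Fin n) L) (β : PolyRing k n m →ₐ[k] L),
      evG k (g : Matrix (Fin n) (Fin n) L) β (gGen k n m).det = (g : Matrix (Fin n) (Fin n) L).det := by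
    intro L _ _ g β
    rw [RingHom.map_det, evG_gGen]
  induction p using MvPolynomial.induction_on with
  | C a =>
    refine ⟨0, MvPolynomial.C (MvPolynomial.C a), ?_⟩
    intro L _ _ g β
    simp only [evG, MvPolynomial.coe_eval₂Hom, MvPolynomial.eval₂_C, pow_zero, one_mul]
    exact (β.commutes a).trans ((conjP k g β).commutes a).symm
  | add p q hp hq =>
    obtain ⟨N, p', hp⟩ := hp
    obtain ⟨N', q', hq⟩ := hq
    refine ⟨N + N', p' * (gGen k n m).det ^ N' + q' * (gGen k n m).det ^ N, ?_⟩
    intro L _ _ g β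
    simp only [map_add, map_mul, map_pow, hD, hp, hq]
    ring
  | mul_X p x hp =>
    obtain ⟨N, p', hp⟩ := hp
    obtain ⟨h, i, j⟩ := x
    refine ⟨N + 1, p' * (gGen k n m * MvPolynomial.C.mapMatrix (genericMatrix k n m h) *
      (gGen k n m).adjugate : Matrix (Fin n) (Fin n) (MvPolynomial (Fin n × Fin n) (PolyRing k n m))) i j, ?_⟩
    intro L _ _ g β
    rw [map_mul, hp, map_mul, pow_succ]
    have h1 : evG k (g : Matrix (Fin n) (Fin n) L) β ((gGen k n m * MvPolynomial.C.mapMatrix (genericMatrix k n m h) *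
      (gGen k n m).adjugate : Matrix (Fin n) (Fin n) (MvPolynomial (Fin n × Fin n) (PolyRing k n m))) i j) = ((evG k (g : Matrix (Fin n) (Fin n) L) β).mapMatrix (gGen k n m * MvPolynomial.C.mapMatrix (genericMatrix k n m h) *
      (gGen k n m).adjugate : Matrix (Fin n) (Fin n) (MvPolynomial (Fin n × Fin n) (PolyRing k n m)))) i j := rfl
    have h2 : conjP k g β (MvPolynomial.X (h, i, j)) =
      ((conjP k g β).mapMatrix (genericMatrix k n m h)) i j := rfl
    have h3 : (g : Matrix (Fin n) (Fin n) L).adjugate = (g : Matrix (Fin n) (Fin n) L).det •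
        ((g⁻¹ : GL (Fin n) L) : Matrix (Fin n) (Fin n) L) := by
      have e1 : (g : Matrix (Fin n) (Fin n) L) * ((g⁻¹ : GL (Fin n) L) : Matrix (Fin n) (Fin n) L) = 1 := by
        rw [← Units.val_mul, mul_inv_cancel, Units.val_one]
      calc _ = (g : Matrix (Fin n) (Fin n) L).adjugate * ((g : Matrix (Fin n) (Fin n) L) * ((g⁻¹ : GL (Fin n) L) : Matrix (Fin n) (Fin n) L)) := by rw [e1, mul_one]
        _ = _ := by rw [← mul_assoc, Matrix.adjugate_mul, Matrix.smul_mul, one_mul]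
    rw [h1, h2, map_mul, map_mul, RingHom.map_adjugate, evG_gGen, evG_C, conjP_generic, h3,
      Matrix.mul_smul, Matrix.smul_apply, smul_eq_mul]
    ring

/-- a polynomial in the group entries vanishing on all invertible matrices vanishes -/
lemma vanish_GL {F : Type} [Field F] [Infinite F] (q : MvPolynomial (Fin n × Fin n) F)
    (h : ∀ g : GL (Fin n) F, MvPolynomial.eval (fun x => (g : Matrix (Fin n) (Fin n) F) x.1 x.2) q = 0) :
    q = 0 := by
  have h1 : q * (Matrix.mvPolynomialX (Fin n) (Fin n) F).det = 0 := by
    apply MvPolynomial.funext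
    intro x
    rw [map_mul, map_zero]
    let M : Matrix (Fin n) (Fin n) F := Matrix.of fun i j => x (i, j)
    have h2 : MvPolynomial.eval x (Matrix.mvPolynomialX (Fin n) (Fin n) F).det = M.det := by
      rw [RingHom.map_det]
      congr 1
      ext i j
      simp [M]
    rw [h2]
    by_cases hM : M.det = 0
    · rw [hM, mul_zero]
    · have := h (Matrix.GeneralLinearGroup.mkOfDetNeZero M hM)
      have e : (fun y : Fin n × Fin n => (Matrix.GeneralLinearGroup.mkOfDetNeZero M hM : Matrix (Fin n) (Fin n) F) y.1 y.2) = x := by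
        ext ⟨i, j⟩
        rfl
      rw [e] at this
      rw [this, zero_mul]
  exact (mul_eq_zero.1 h1).resolve_right (Matrix.det_mvPolynomialX_ne_zero (Fin n) F)

lemma evG_eq (g : Matrix (Fin n) (Fin n) L) (β : PolyRing k n m →ₐ[k] L) (q) :
    evG k g β q = MvPolynomial.eval (fun x => g x.1 x.2) (MvPolynomial.map β.toRingHom q) := by
  rw [MvPolynomial.eval_map]; rfl

lemma hat_zero {F : Type} [Field F] [Algebra k F] {β : PolyRing k n m →ₐ[k] F} {p : PolyRing k n m}
    {N : ℕ} {q : MvPolynomial (Fin n × Fin n) (PolyRing k n m)}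
    (hq : ∀ (L : Type) [CommRing L] [Algebra k L] (g : GL (Fin n) L) (β : PolyRing k n m →ₐ[k] L),
        evG k (g : Matrix (Fin n) (Fin n) L) β q =
          (g : Matrix (Fin n) (Fin n) L).det ^ N * conjP k g β p)
    (h : ∀ g : GL (Fin n) F, conjP k g β p = 0) : MvPolynomial.map β.toRingHom q = 0 := by
  have : CharZero F := charZero_of_injective_algebraMap (algebraMap k F).injective
  apply vanish_GL
  intro g
  rw [← evG_eq, hq, h, mul_zero]

/-- (i) -/
theorem conj_vanish {X : Set (MTuple k n m)} (hX : ∀ g : GL (Fin n) k, ∀ a ∈ X, conjAct k g a ∈ X)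
    {β : PolyRing k n m →ₐ[k] L} (hβ : ∀ f, (∀ a ∈ X, polyEval k a f = 0) → β f = 0)
    {p : PolyRing k n m} (hp : ∀ a ∈ X, polyEval k a p = 0) (g : GL (Fin n) L) :
    conjP k g β p = 0 := by
  obtain ⟨N, q, hq⟩ := exists_hat k p
  have h1 : ∀ a ∈ X, MvPolynomial.map (polyEval k a).toRingHom q = 0 := by
    intro a ha
    apply hat_zero k hq
    intro g
    rw [← polyEval_conjAct]
    exact hp _ (hX g a ha)
  have h2 : MvPolynomial.map β.toRingHom q = 0 := by
    ext s
    rw [MvPolynomial.coeff_map]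
    apply hβ
    intro a ha
    have := congrArg (MvPolynomial.coeff s) (h1 a ha)
    rwa [MvPolynomial.coeff_map] at this
  have h3 := hq L g β
  rw [evG_eq, h2, map_zero] at h3
  have hu : IsUnit ((g : Matrix (Fin n) (Fin n) L).det ^ N) :=
    ((Matrix.isUnit_iff_isUnit_det _).1 g.isUnit).pow N
  exact (hu.mul_right_eq_zero).1 h3.symm

/-- (ii) -/
def orbIdeal {F : Type} [Field F] [Algebra k F] (β : PolyRing k n m →ₐ[k] F) : Ideal (PolyRing k n m) where
  carrier := {f | ∀ g : GL (Fin n) F, conjP k g β f = 0}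
  zero_mem' := fun g => map_zero _
  add_mem' := fun ha hb g => by rw [map_add, ha g, hb g, add_zero]
  smul_mem' := fun c f hf g => by rw [smul_eq_mul, map_mul, hf g, mul_zero]

lemma orbIdeal_prime {F : Type} [Field F] [Algebra k F] (β : PolyRing k n m →ₐ[k] F) :
    (orbIdeal k β).IsPrime := by
  constructor
  · rw [Ideal.ne_top_iff_one]
    intro h
    exact one_ne_zero ((map_one (conjP k 1 β)).symm.trans (h 1))
  · intro x y hxy
    obtain ⟨N, q, hq⟩ := exists_hat k x
    obtain ⟨N', q', hq'⟩ := exists_hat k y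
    have : CharZero F := charZero_of_injective_algebraMap (algebraMap k F).injective
    have h1 : MvPolynomial.map β.toRingHom q * MvPolynomial.map β.toRingHom q' = 0 := by
      apply vanish_GL
      intro g
      rw [map_mul, ← evG_eq, ← evG_eq, hq, hq']
      have : conjP k g β x * conjP k g β y = 0 := by rw [← map_mul]; exact hxy g
      linear_combination (g : Matrix (Fin n) (Fin n) F).det ^ N * (g : Matrix (Fin n) (Fin n) F).det ^ N' * this
    have key : ∀ (p : PolyRing k n m) (N) (q), (∀ (L : Type) [CommRing L] [Algebra k L] (g : GL (Fin n) L) (β : PolyRing k n m →ₐ[k] L),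
        evG k (g : Matrix (Fin n) (Fin n) L) β q =
          (g : Matrix (Fin n) (Fin n) L).det ^ N * conjP k g β p) →
        MvPolynomial.map β.toRingHom q = 0 → p ∈ orbIdeal k β := by
      intro p N q hq h0 g
      have h3 := hq F g β
      rw [evG_eq, h0, map_zero] at h3
      have hu : IsUnit ((g : Matrix (Fin n) (Fin n) F).det ^ N) :=
        ((Matrix.isUnit_iff_isUnit_det _).1 g.isUnit).pow N
      exact (hu.mul_right_eq_zero).1 h3.symm
    rcases mul_eq_zero.1 h1 with h | h
    · exact Or.inl (key x N q hq h)
    · exact Or.inr (key y N' q' hq' h)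

/-- invariance of `orbIdeal` -/
lemma orbIdeal_conj {F : Type} [Field F] [Algebra k F] (β : PolyRing k n m →ₐ[k] F) {a : MTuple k n m}
    (ha : ∀ f ∈ orbIdeal k β, polyEval k a f = 0) (g : GL (Fin n) k) :
    ∀ f ∈ orbIdeal k β, polyEval k (conjAct k g a) f = 0 := by
  intro f hf
  let gP : GL (Fin n) (PolyRing k n m) :=
    Units.map ((Algebra.ofId k (PolyRing k n m)).mapMatrix : Matrix (Fin n) (Fin n) k →ₐ[k] _).toRingHom.toMonoidHom g
  let f' := conjP k gP (AlgHom.id k (PolyRing k n m)) f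
  have hf' : f' ∈ orbIdeal k β := by
    intro h
    have e := conjP_comp k (conjP k h β) gP (AlgHom.id k (PolyRing k n m))
    have e2 : conjP k h β f' = ((conjP k h β).comp (conjP k gP (AlgHom.id k (PolyRing k n m)))) f := rfl
    rw [e2, e, AlgHom.comp_id, conjP_conjP]
    exact hf _
  have h1 := ha f' hf'
  have e := conjP_comp k (polyEval k a) gP (AlgHom.id k (PolyRing k n m))
  have e2 : polyEval k a f' = ((polyEval k a).comp (conjP k gP (AlgHom.id k (PolyRing k n m)))) f := rfl
  rw [e2, e, AlgHom.comp_id] at h1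
  rw [polyEval_conjAct]
  convert h1 using 2
  congr 1
  apply Units.ext
  ext i j
  simp [gP, Algebra.ofId_apply]

end Conj
/-! ### Points with the same traces are conjugate -/
section SameTrace
open scoped Matrix
variable {n m : ℕ} {F : Type} [Field F] [Algebra k F]

lemma sum_single_eq (M : Matrix (Fin n) (Fin n) F) :
    ∑ i : Fin n × Fin n, M i.1 i.2 • Matrix.single i.1 i.2 (1 : F) = M := by
  rw [Fintype.sum_prod_type]
  conv_rhs => rw [Matrix.matrix_eq_sum_single M]
  refine Finset.sum_congr rfl fun i _ => Finset.sum_congr rfl fun j _ => ?_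
  rw [Matrix.smul_single, smul_eq_mul, mul_one]

lemma gram_single_ne : (tgram fun i : Fin n × Fin n => Matrix.single i.1 i.2 (1 : F)).det ≠ 0 := by
  apply tgram_det_ne_zero_of_span
  have h := (Matrix.stdBasis F (Fin n) (Fin n)).linearIndependent
  convert h using 1
  ext i : 1
  rw [Matrix.stdBasis_eq_single]

lemma conj_of_trace (hn : 1 ≤ n) {δ ε : PolyRing k n m →ₐ[k] F} {x : Fin n × Fin n → MatPoly k n m}
    (hx : ∀ i, x i ∈ GMN k n m) (hε : ∀ i, ε.mapMatrix (x i) = Matrix.single i.1 i.2 1)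
    (htr : ∀ p ∈ GMN k n m, δ p.trace = ε p.trace) : ∃ h : GL (Fin n) F, ε = conjP k h δ := by
  have hgram : (tgram fun i => δ.mapMatrix (x i)).det ≠ 0 := by
    have h1 : (tgram fun i => δ.mapMatrix (x i)) = tgram fun i => ε.mapMatrix (x i) := by
      ext i j
      simp only [tgram, Matrix.of_apply]
      rw [← map_mul, ← map_mul, trace_ev', trace_ev', htr _ (mul_mem (hx i) (hx j))]
    rw [h1]
    simp only [hε]
    exact gram_single_ne
  have key : ∀ p ∈ GMN k n m, δ.mapMatrix p = ∑ i, ε.mapMatrix p i.1 i.2 • δ.mapMatrix (x i) := by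
    intro p hp
    rw [← sub_eq_zero]
    set d := δ.mapMatrix p - ∑ i, ε.mapMatrix p i.1 i.2 • δ.mapMatrix (x i) with hd
    have h1 : ∀ l, (d * δ.mapMatrix (x l)).trace = 0 := by
      intro l
      rw [hd, sub_mul, Matrix.trace_sub, Finset.sum_mul, Matrix.trace_sum, ← map_mul, trace_ev',
        htr _ (mul_mem hp (hx l)), ← trace_ev', map_mul]
      have h2 : ∀ i, (ε.mapMatrix p i.1 i.2 • δ.mapMatrix (x i) * δ.mapMatrix (x l)).trace =
          (ε.mapMatrix p i.1 i.2 • Matrix.single i.1 i.2 1 * ε.mapMatrix (x l)).trace := by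
        intro i
        rw [Matrix.smul_mul, Matrix.trace_smul, ← map_mul, trace_ev', htr _ (mul_mem (hx i) (hx l)),
          ← trace_ev', map_mul, Matrix.smul_mul, Matrix.trace_smul, hε i]
      rw [Finset.sum_congr rfl fun i _ => h2 i, ← Matrix.trace_sum, ← Finset.sum_mul, sum_single_eq,
        sub_self]
    have h3 := gram_expand (fun i => δ.mapMatrix (x i)) d
    simp only [h1, mul_zero, Finset.sum_const_zero, zero_smul] at h3
    exact (smul_eq_zero.1 h3.symm).resolve_left hgram
  have hmul : ∀ i j l r, δ.mapMatrix (x (i, j)) * δ.mapMatrix (x (l, r)) =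
      if j = l then δ.mapMatrix (x (i, r)) else 0 := by
    intro i j l r
    rw [← map_mul, key _ (mul_mem (hx _) (hx _)), map_mul, hε, hε]
    by_cases h : j = l
    · subst h
      rw [if_pos rfl, key _ (hx (i, r)), hε]
      simp
    · rw [if_neg h]
      simp [h]
  let i0 : Fin n := ⟨0, hn⟩
  have hne : δ.mapMatrix (x (i0, i0)) ≠ 0 := by
    intro h0
    have h1 : ∀ i, δ.mapMatrix (x i) = 0 := by
      rintro ⟨i, j⟩
      have := hmul i i0 i0 j
      rw [if_pos rfl] at this
      rw [← this]
      have h2 := hmul i0 i0 i0 j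
      rw [h0, zero_mul, if_pos rfl] at h2
      rw [← h2, mul_zero]
    have h2 := key 1 (one_mem _)
    simp only [h1, smul_zero, Finset.sum_const_zero, map_one] at h2
    exact one_ne_zero (congrFun (congrFun h2 i0) i0)
  obtain ⟨s, t, hst⟩ : ∃ s t, δ.mapMatrix (x (i0, i0)) s t ≠ 0 := by
    by_contra! h
    exact hne (by ext i j; exact h i j)
  let W : Matrix (Fin n) (Fin n) F := Matrix.of fun r i => δ.mapMatrix (x (i, i0)) r t
  have hW1 : ∀ i, δ.mapMatrix (x i) * W = W * Matrix.single i.1 i.2 1 := by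
    rintro ⟨i, j⟩
    ext r l
    have h1 : (δ.mapMatrix (x (i, j)) * W) r l =
        (δ.mapMatrix (x (i, j)) * δ.mapMatrix (x (l, i0))) r t := by
      simp only [Matrix.mul_apply, W, Matrix.of_apply]
    rw [h1, hmul]
    by_cases h : j = l
    · subst h
      simp [W]
    · rw [if_neg h, Matrix.mul_single_apply_of_ne _ _ _ _ _ (Ne.symm h)]
      rfl
  have hW2 : ∀ p ∈ GMN k n m, δ.mapMatrix p * W = W * ε.mapMatrix p := by
    intro p hp
    conv_rhs => rw [← sum_single_eq (ε.mapMatrix p)]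
    rw [key p hp, Finset.sum_mul, Finset.mul_sum]
    refine Finset.sum_congr rfl fun i _ => ?_
    rw [Matrix.smul_mul, Matrix.mul_smul, hW1]
  have hdet : W.det ≠ 0 := by
    intro h0
    obtain ⟨v, hv0, hv⟩ := Matrix.exists_mulVec_eq_zero_iff.2 h0
    apply hv0
    ext j
    have h1 := congrArg (fun w => δ.mapMatrix (x (i0, j)) *ᵥ w) hv
    simp only [Matrix.mulVec_mulVec, Matrix.mulVec_zero] at h1
    rw [hW1, ← Matrix.mulVec_mulVec] at h1
    have h2 := congrFun h1 s
    simp only [Matrix.mulVec, dotProduct] at h2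
    rw [Finset.sum_eq_single i0] at h2
    · simp [W, Matrix.single_apply] at h2
      simpa using h2.resolve_left hst
    · intro b _ hb
      simp [Ne.symm hb]
    · simp
  let w := Matrix.GeneralLinearGroup.mkOfDetNeZero W hdet
  refine ⟨w⁻¹, ?_⟩
  apply pt_ext
  intro h
  rw [conjP_generic, inv_inv, mul_assoc]
  change _ = _ * (_ * W)
  rw [hW2 _ (Algebra.subset_adjoin ⟨h, rfl⟩), ← mul_assoc]
  change _ = (((w⁻¹ : GL (Fin n) F) : Matrix (Fin n) (Fin n) F) * (w : Matrix (Fin n) (Fin n) F)) * _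
  rw [← Units.val_mul, inv_mul_cancel, Units.val_one, one_mul]

end SameTrace
/-! ### Reduction along a valuation ring -/
section Valuation
open scoped Matrix
variable {n m : ℕ}

lemma lattice_basis {K : Type} [Field K] (V : ValuationSubring K) {ι : Type} [Fintype ι]
    (v : ι → (Fin n → K)) (hspan : Submodule.span K (Set.range v) = ⊤) :
    ∃ b : Module.Basis (Fin n) K (Fin n → K),
      Submodule.span V (Set.range b) = Submodule.span V (Set.range v) := by
  classical
  have hex : ∃ N, ∃ S : Finset ι, Submodule.span V (v '' S) = Submodule.span V (Set.range v) ∧ S.card = N :=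
    ⟨_, Finset.univ, by simp, rfl⟩
  obtain ⟨S, hS, hN⟩ := Nat.find_spec hex
  have hmin : ∀ T : Finset ι, Submodule.span V (v '' T) = Submodule.span V (Set.range v) →
      S.card ≤ T.card := fun T hT => by
    rw [hN]; exact Nat.find_min' hex ⟨T, hT, rfl⟩
  have hli : LinearIndependent K (fun i : S => v i) := by
    by_contra hcon
    rw [Fintype.not_linearIndependent_iff] at hcon
    obtain ⟨c, hc, i1, hi1⟩ := hcon
    obtain ⟨j, -, hj⟩ := Finset.exists_max_image Finset.univ (fun i => V.valuation (c i)) ⟨i1, Finset.mem_univ _⟩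
    have hj0 : c j ≠ 0 := by
      intro h0
      have := hj i1 (Finset.mem_univ _)
      simp only [h0, map_zero, le_zero_iff, map_eq_zero] at this
      exact hi1 this
    have hmem : ∀ i, c i / c j ∈ V := by
      intro i
      rw [← V.valuation_le_one_iff, map_div₀]
      exact div_le_one_of_le₀ (hj i (Finset.mem_univ _)) zero_le
    have hvj : v j = ∑ i ∈ Finset.univ.erase j, (-(⟨_, hmem i⟩ : V)) • v i := by
      have h1 : c j • v j = - ∑ i ∈ Finset.univ.erase j, c i • v i := by
        rw [← Finset.add_sum_erase _ _ (Finset.mem_univ j)] at hc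
        exact eq_neg_of_add_eq_zero_left hc
      have h2 : v j = (c j)⁻¹ • (c j • v j) := by rw [smul_smul, inv_mul_cancel₀ hj0, one_smul]
      rw [h2, h1, smul_neg, Finset.smul_sum, ← Finset.sum_neg_distrib]
      refine Finset.sum_congr rfl fun i _ => ?_
      rw [neg_smul, smul_smul, mul_comm, ← div_eq_mul_inv]
      rfl
    have hle : Submodule.span V (v '' (S.erase j : Finset ι)) = Submodule.span V (Set.range v) := by
      apply le_antisymm
      · exact Submodule.span_mono (Set.image_subset_range _ _)
      · rw [← hS, Submodule.span_le]
        rintro _ ⟨i, hi, rfl⟩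
        by_cases hij : i = j
        · rw [hij, hvj]
          refine sum_mem fun l hl => Submodule.smul_mem _ _ (Submodule.subset_span ⟨l, ?_, rfl⟩)
          simp only [Finset.coe_erase, Set.mem_sdiff, Finset.mem_coe, Set.mem_singleton_iff]
          exact ⟨l.2, fun h => (Finset.mem_erase.1 hl).1 (Subtype.ext h)⟩
        · refine Submodule.subset_span ⟨i, ?_, rfl⟩
          simp only [Finset.coe_erase, Set.mem_sdiff, Finset.mem_coe, Set.mem_singleton_iff]
          exact ⟨hi, hij⟩
    have h3 := hmin _ hle
    rw [Finset.card_erase_of_mem j.2] at h3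
    have : 0 < S.card := Finset.card_pos.2 ⟨j, j.2⟩
    omega
  have hrange : Set.range (fun i : S => v i) = v '' S := by
    ext w
    simp
  have hsp : ⊤ ≤ Submodule.span K (Set.range (fun i : S => v i)) := by
    rw [← hspan, Submodule.span_le]
    rintro _ ⟨i, rfl⟩
    have h1 : v i ∈ Submodule.span V (v '' S) := by rw [hS]; exact Submodule.subset_span ⟨i, rfl⟩
    rw [hrange]
    exact Submodule.span_le_restrictScalars V K _ h1
  let b0 := Module.Basis.mk hli hsp
  have hcard : Fintype.card S = n := by
    have := Module.finrank_eq_card_basis b0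
    rw [Module.finrank_fin_fun] at this
    exact this.symm
  refine ⟨b0.reindex (Fintype.equivFinOfCardEq hcard), ?_⟩
  rw [Module.Basis.range_reindex, Module.Basis.coe_mk, hrange, hS]

theorem zero_of_kill (hn : 1 ≤ n) {X : Set (MTuple k n m)}
    (hX : ∀ g : GL (Fin n) k, ∀ a ∈ X, conjAct k g a ∈ X)
    {K : Type} [Field K] [Algebra k K]
    {β : PolyRing k n m →ₐ[k] K} (hβ : ∀ f, (∀ a ∈ X, polyEval k a f = 0) → β f = 0)
    {a : MTuple k n m} (ha : a ∈ genTuples k n m)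
    (hkill : ∀ p ∈ GMN k n m, β.mapMatrix p = 0 → evalMat k a p = 0)
    {f : PolyRing k n m} (hf : ∀ b ∈ X, polyEval k b f = 0) : polyEval k a f = 0 := by
  have : Nonempty (Fin n) := ⟨⟨0, hn⟩⟩
  let i0 : Fin n := ⟨0, hn⟩
  -- Step 1
  have step1 : ∀ f ∈ trC k n m, β f = 0 → polyEval k a f = 0 := by
    intro f hf h0
    obtain ⟨c, hc, hc0⟩ := exists_cond_point k hn ha
    have h1 := hkill _ (hc f hf) (by rw [smul_smul, ev_smul_one, map_mul, h0, zero_mul, zero_smul])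
    rw [smul_smul, evalMat, ev_smul_one] at h1
    have h2 := congrFun (congrFun h1 i0) i0
    simp [hc0] at h2
    exact h2
  -- Step 2
  let A0 : Subring K := ((trC k n m).map β).toSubring
  let I0 : Ideal A0 :=
    { carrier := {z | ∃ f ∈ trC k n m, polyEval k a f = 0 ∧ β f = z}
      zero_mem' := ⟨0, zero_mem _, by simp, by simp⟩
      add_mem' := by
        rintro x y ⟨f, hf, h1, h2⟩ ⟨g, hg, h3, h4⟩
        exact ⟨f + g, add_mem hf hg, by simp [h1, h3], by simp [h2, h4]⟩
      smul_mem' := by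
        rintro ⟨_, g, hg, rfl⟩ y ⟨f, hf, h1, h2⟩
        exact ⟨g * f, mul_mem hg hf, by simp [h1], by simp [h2]⟩ }
  have hI0 : I0 ≠ ⊤ := by
    rw [Ideal.ne_top_iff_one]
    rintro ⟨f, hf, h1, h2⟩
    have h3 := step1 (f - 1) (sub_mem hf (one_mem _)) (by rw [map_sub, h2, map_one]; exact sub_self _)
    rw [map_sub, h1, map_one] at h3
    simp at h3
  obtain ⟨V, hAV, hIV⟩ := Ideal.image_subset_nonunits_valuationSubring I0 hI0
  have hVmem : ∀ f ∈ trC k n m, β f ∈ V := fun f hf => hAV ⟨f, hf, rfl⟩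
  have hVk : ∀ c : k, algebraMap k K c ∈ V := by
    intro c
    have := hVmem (algebraMap k _ c) (Subalgebra.algebraMap_mem _ c)
    rwa [AlgHom.commutes] at this
  let _ : Algebra k V := ((algebraMap k K).codRestrict V.toSubring hVk).toAlgebra
  let F := IsLocalRing.ResidueField V
  let ιV : V →ₐ[k] K := { V.subtype with commutes' := fun c => rfl }
  let res : V →ₐ[k] F := IsScalarTower.toAlgHom k V F
  have hιV : ∀ v : V, ιV v = v := fun _ => rfl
  have hres : ∀ f (hf : f ∈ trC k n m), res ⟨β f, hVmem f hf⟩ = algebraMap k F (polyEval k a f) := by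
    intro f hf
    have h1 : β (f - algebraMap k _ (polyEval k a f)) ∈ V.nonunits := by
      apply hIV
      have hm : f - algebraMap k _ (polyEval k a f) ∈ trC k n m := sub_mem hf (Subalgebra.algebraMap_mem _ _)
      refine ⟨⟨_, _, hm, rfl⟩, ⟨_, hm, ?_, rfl⟩, rfl⟩
      rw [map_sub, AlgHom.commutes]
      exact sub_self _
    obtain ⟨h2, h3⟩ := ValuationSubring.mem_nonunits_iff_exists_mem_maximalIdeal.1 h1
    have h4 : res ⟨_, h2⟩ = 0 := (IsLocalRing.residue_eq_zero_iff _).2 h3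
    have h5 : (⟨_, h2⟩ : V) = ⟨β f, hVmem f hf⟩ - algebraMap k V (polyEval k a f) := by
      apply Subtype.ext
      change β (f - algebraMap k _ (polyEval k a f)) = β f - algebraMap k K (polyEval k a f)
      rw [map_sub, AlgHom.commutes]
    rw [h5, map_sub, AlgHom.commutes, sub_eq_zero] at h4
    exact h4
  -- Step 3
  choose x hx hxa using fun i : Fin n × Fin n => exists_eval_eq k ha (Matrix.single i.1 i.2 1)
  have hda : polyEval k a (tgram x).det ≠ 0 := by
    rw [← tgram_ev_det]
    have : (fun i => (polyEval k a).mapMatrix (x i)) = fun i => Matrix.single i.1 i.2 1 := funext hxa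
    rw [this]
    exact gram_single_ne
  have hδV := hVmem _ (trC_det k hx)
  have hunit : IsUnit (⟨_, hδV⟩ : V) := by
    by_contra h
    have h1 : res ⟨_, hδV⟩ = 0 := (IsLocalRing.residue_eq_zero_iff _).2 h
    rw [hres _ (trC_det k hx), map_eq_zero_iff _ (algebraMap k F).injective] at h1
    exact hda h1
  obtain ⟨u, hu⟩ := hunit
  have hδ0 : β (tgram x).det ≠ 0 := by
    intro h0
    have h1 := step1 _ (trC_det k hx) h0
    exact hda h1
  have hinvV : (β (tgram x).det)⁻¹ ∈ V := by
    have h1 : ((u⁻¹ : Vˣ) : V) * (u : V) = 1 := u.inv_mul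
    have h2 := congrArg (fun z : V => (z : K)) h1
    rw [hu] at h2
    have h3 : (((u⁻¹ : Vˣ) : V) : K) * β (tgram x).det = 1 := h2
    rw [← eq_inv_of_mul_eq_one_left h3]
    exact ((u⁻¹ : Vˣ) : V).2
  have hexp : ∀ p ∈ GMN k n m, ∃ c : Fin n × Fin n → V, β.mapMatrix p = ∑ i, (c i : K) • β.mapMatrix (x i) := by
    intro p hp
    have h := gram_expand (fun i => β.mapMatrix (x i)) (β.mapMatrix p)
    rw [tgram_ev_det, tgram_ev] at h
    have hadj : (β.mapMatrix (tgram x)).adjugate = β.mapMatrix (tgram x).adjugate :=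
      (RingHom.map_adjugate β.toRingHom (tgram x)).symm
    rw [hadj] at h
    have hmem : ∀ i, (β (tgram x).det)⁻¹ * ∑ j, β.mapMatrix (tgram x).adjugate i j *
        (β.mapMatrix p * β.mapMatrix (x j)).trace ∈ V := by
      intro i
      refine mul_mem hinvV (sum_mem fun j _ => mul_mem (hVmem _ (trC_adjugate k hx i j)) ?_)
      rw [← map_mul, trace_ev]
      exact hVmem _ (trace_mem_trC k (mul_mem hp (hx j)))
    refine ⟨fun i => ⟨_, hmem i⟩, ?_⟩
    simp only [mul_smul]
    rw [← Finset.smul_sum, h, smul_smul, inv_mul_cancel₀ hδ0, one_smul]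
  -- Step 4
  let e : Fin n → K := Pi.single i0 1
  let v : Fin n × Fin n → (Fin n → K) := fun i => β.mapMatrix (x i) *ᵥ e
  have hvspan : Submodule.span K (Set.range v) = ⊤ := by
    rw [eq_top_iff]
    intro w _
    obtain ⟨c, hc⟩ := ev_expand k β hδ0 (Matrix.of fun i _ => w i)
    have h1 : w = (Matrix.of fun i (_ : Fin n) => w i) *ᵥ e := by
      ext i
      simp [e]
    rw [h1, hc, Matrix.sum_mulVec]
    refine sum_mem fun i _ => ?_
    rw [Matrix.smul_mulVec]
    exact Submodule.smul_mem _ _ (Submodule.subset_span ⟨i, rfl⟩)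
  obtain ⟨b, hb⟩ := lattice_basis V v hvspan
  have hstab : ∀ p ∈ GMN k n m, ∀ w ∈ Submodule.span V (Set.range v),
      β.mapMatrix p *ᵥ w ∈ Submodule.span V (Set.range v) := by
    intro p hp w hw
    induction hw using Submodule.span_induction with
    | mem w hw =>
      obtain ⟨i, rfl⟩ := hw
      obtain ⟨c, hc⟩ := hexp (p * x i) (mul_mem hp (hx i))
      have h1 : β.mapMatrix p *ᵥ v i = ∑ j, c j • v j := by
        simp only [v]
        rw [Matrix.mulVec_mulVec, ← map_mul, hc, Matrix.sum_mulVec]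
        refine Finset.sum_congr rfl fun j _ => ?_
        rw [Matrix.smul_mulVec]
        rfl
      rw [h1]
      exact sum_mem fun j _ => Submodule.smul_mem _ _ (Submodule.subset_span ⟨j, rfl⟩)
    | zero => rw [Matrix.mulVec_zero]; exact zero_mem _
    | add w w' _ _ hw hw' => rw [Matrix.mulVec_add]; exact add_mem hw hw'
    | smul c w _ hw =>
      have : β.mapMatrix p *ᵥ (c • w) = c • (β.mapMatrix p *ᵥ w) := Matrix.mulVec_smul _ (c : K) w
      rw [this]
      exact Submodule.smul_mem _ _ hw
  have hC : ∀ h : Fin m, ∀ j, ∃ c : Fin n → V,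
      ∑ i, c i • b i = β.mapMatrix (genericMatrix k n m h) *ᵥ b j := by
    intro h j
    apply (Submodule.mem_span_range_iff_exists_fun V).1
    rw [hb]
    apply hstab _ (Algebra.subset_adjoin ⟨h, rfl⟩)
    rw [← hb]
    exact Submodule.subset_span ⟨j, rfl⟩
  choose c hc using hC
  let B : Matrix (Fin n) (Fin n) K := Matrix.of fun i j => b j i
  have hBdet : B.det ≠ 0 := by
    rw [← isUnit_iff_ne_zero, ← Matrix.isUnit_iff_isUnit_det, ← Matrix.linearIndependent_cols_iff_isUnit]
    exact b.linearIndependent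
  let Bu := Matrix.GeneralLinearGroup.mkOfDetNeZero B hBdet
  let Cm : Fin m → Matrix (Fin n) (Fin n) V := fun h => Matrix.of fun i j => c h j i
  have hBC : ∀ h, β.mapMatrix (genericMatrix k n m h) * B = B * ιV.mapMatrix (Cm h) := by
    intro h
    ext r j
    have h1 := congrFun (hc h j) r
    have h2 : (β.mapMatrix (genericMatrix k n m h) * B) r j =
        (β.mapMatrix (genericMatrix k n m h) *ᵥ b j) r := rfl
    rw [h2, ← h1, Matrix.mul_apply, Finset.sum_apply]
    refine Finset.sum_congr rfl fun i _ => ?_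
    change (c h j i : K) * b i r = b i r * (c h j i : K)
    rw [mul_comm]
  let γV : PolyRing k n m →ₐ[k] V := mkPt k Cm
  have hγ : ιV.comp γV = conjP k Bu⁻¹ β := by
    apply pt_ext
    intro h
    rw [mapMatrix_comp, mkPt_generic, conjP_generic, inv_inv, mul_assoc]
    change _ = _ * (_ * B)
    rw [hBC, ← mul_assoc]
    change _ = (((Bu⁻¹ : GL (Fin n) K) : Matrix (Fin n) (Fin n) K) * (Bu : Matrix (Fin n) (Fin n) K)) * _
    rw [← Units.val_mul, inv_mul_cancel, Units.val_one, one_mul]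
  let δ : PolyRing k n m →ₐ[k] F := res.comp γV
  have hδ : ∀ f, (∀ a ∈ X, polyEval k a f = 0) → δ f = 0 := by
    intro f hf
    have h1 : ιV (γV f) = 0 := by
      have := congrArg (fun φ => φ f) hγ
      exact this.trans (conj_vanish k hX hβ hf _)
    have h2 : γV f = 0 := Subtype.ext h1
    change res (γV f) = 0
    rw [h2, map_zero]
  let ε : PolyRing k n m →ₐ[k] F := (Algebra.ofId k F).comp (polyEval k a)
  have htr : ∀ p ∈ GMN k n m, δ p.trace = ε p.trace := by
    intro p hp
    have h1 : ιV (γV p.trace) = β p.trace := by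
      have := congrArg (fun φ => φ p.trace) hγ
      exact this.trans (conjP_trace k _ β hp)
    have h2 : γV p.trace = ⟨β p.trace, hVmem _ (trace_mem_trC k hp)⟩ := Subtype.ext h1
    change res (γV p.trace) = algebraMap k F (polyEval k a p.trace)
    rw [h2, hres]
    exact trace_mem_trC k hp
  obtain ⟨g, hg⟩ := conj_of_trace k hn hx (δ := δ) (ε := ε) (by
    intro i
    rw [mapMatrix_comp]
    have : (polyEval k a).mapMatrix (x i) = Matrix.single i.1 i.2 1 := hxa i
    rw [this]
    ext r s
    simp [Matrix.single_apply, apply_ite]) htr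
  have h1 : ε f = 0 := by rw [hg]; exact conj_vanish k hX hδ hf g
  exact (map_eq_zero_iff _ (algebraMap k F).injective).1 h1

end Valuation

section assembly
variable {n m : ℕ}

lemma conjP_gram {L : Type} [Field L] [Algebra k L] (g : GL (Fin n) L) (β : PolyRing k n m →ₐ[k] L)
    {x : Fin n × Fin n → MatPoly k n m} (hx : ∀ i, x i ∈ GMN k n m) :
    conjP k g β (tgram x).det = β (tgram x).det := by
  rw [← tgram_ev_det, ← tgram_ev_det]
  congr 1
  rw [tgram_ev, tgram_ev]
  ext i j
  exact conjP_trace k g β (mul_mem (hx i) (hx j))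

lemma genTuples_conj {a : MTuple k n m} (ha : a ∈ genTuples k n m) (g : GL (Fin n) k) :
    conjAct k g a ∈ genTuples k n m := by
  obtain ⟨x, hx, hd⟩ := (mem_genTuples_iff k a).1 ha
  refine (mem_genTuples_iff k _).2 ⟨x, hx, ?_⟩
  rwa [polyEval_conjAct, conjP_gram k g _ hx]

lemma mem_vanishIdeal_iff' {A : Subalgebra k (MatPoly k n m)} {X : Set (MTuple k n m)} (p : ↥A) :
    p ∈ vanishIdeal k A X ↔ ∀ a ∈ X, evalMat k a (p : MatPoly k n m) = 0 := by
  unfold vanishIdeal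
  rw [TwoSidedIdeal.mem_mk']
  rfl

/-- the ideal of polynomials vanishing on `X` -/
def polyIdeal (X : Set (MTuple k n m)) : Ideal (PolyRing k n m) where
  carrier := {f | ∀ a ∈ X, polyEval k a f = 0}
  zero_mem' := fun a _ => map_zero _
  add_mem' := fun hf hg a ha => by rw [map_add, hf a ha, hg a ha, add_zero]
  smul_mem' := fun c f hf a ha => by rw [smul_eq_mul, map_mul, hf a ha, mul_zero]

lemma polyIdeal_prime {X : Set (MTuple k n m)} (hX : IsIrredSubset k X) :
    (polyIdeal k X).IsPrime := by
  obtain ⟨⟨a, ha⟩, hirr⟩ := hX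
  constructor
  · rw [Ideal.ne_top_iff_one]
    intro h
    exact one_ne_zero ((map_one (polyEval k a)).symm.trans (h a ha))
  · intro f g hfg
    have := hirr {a | ∀ p ∈ ({f} : Set (PolyRing k n m)), polyEval k a p = 0}
      {a | ∀ p ∈ ({g} : Set (PolyRing k n m)), polyEval k a p = 0} ⟨_, rfl⟩ ⟨_, rfl⟩ (by
        intro b hb
        have h1 : polyEval k b (f * g) = 0 := hfg b hb
        rw [map_mul, mul_eq_zero] at h1
        rcases h1 with h1 | h1
        · left; intro p hp; rw [Set.mem_singleton_iff.1 hp]; exact h1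
        · right; intro p hp; rw [Set.mem_singleton_iff.1 hp]; exact h1)
    rcases this with h | h
    · left; intro b hb; exact h hb f rfl
    · right; intro b hb; exact h hb g rfl

/-- the generic point of a prime ideal -/
lemma exists_generic_point (I : Ideal (PolyRing k n m)) (hI : I.IsPrime) :
    ∃ (K : Type) (_ : Field K) (_ : Algebra k K) (β : PolyRing k n m →ₐ[k] K),
      ∀ f, β f = 0 ↔ f ∈ I := by
  refine ⟨FractionRing (PolyRing k n m ⧸ I), inferInstance, inferInstance,
    (IsScalarTower.toAlgHom k (PolyRing k n m ⧸ I) (FractionRing (PolyRing k n m ⧸ I))).comp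
      (Ideal.Quotient.mkₐ k I), fun f => ?_⟩
  rw [AlgHom.comp_apply, IsScalarTower.coe_toAlgHom', Ideal.Quotient.mkₐ_eq_mk,
    FaithfulSMul.algebraMap_eq_zero_iff, Ideal.Quotient.eq_zero_iff_mem]

theorem part_one (hn : 1 ≤ n) {A : Subalgebra k (MatPoly k n m)} (hGA : GMN k n m ≤ A)
    (htr : ∀ r ∈ A, r.trace ∈ trC k n m) {X : Set (MTuple k n m)}
    (hX : IsNVariety k X) (hXi : IsIrredSubset k X) :
    vanishIdeal k A X ∈ SpecN n ↥A ∧ zeroLocusI k (vanishIdeal k A X) = X := by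
  obtain ⟨K, _, _, β, hβ⟩ := exists_generic_point k (polyIdeal k X) (polyIdeal_prime k hXi)
  obtain ⟨hXU, hXg, C, ⟨S, rfl⟩, hXC⟩ := hX
  have hmat : ∀ p : MatPoly k n m, β.mapMatrix p = 0 ↔ ∀ a ∈ X, evalMat k a p = 0 := by
    intro p
    constructor
    · intro h a ha
      ext i j
      exact (hβ (p i j)).1 (congrFun (congrFun h i) j) a ha
    · intro h
      ext i j
      exact (hβ (p i j)).2 fun a ha => congrFun (congrFun (h a ha) i) j
  constructor
  · obtain ⟨a, ha⟩ := hXi.1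
    obtain ⟨x, hx, hd⟩ := (mem_genTuples_iff k a).1 (hXU ha)
    refine specN_of_point k hn hGA htr (β := β) ⟨x, hx, fun h => hd ((hβ _).1 h a ha)⟩ _ fun p => ?_
    rw [mem_vanishIdeal_iff', hmat]
  · apply Set.Subset.antisymm
    · rintro a ⟨haU, ha⟩
      rw [hXC]
      refine ⟨fun p hp => ?_, haU⟩
      refine zero_of_kill k hn hXg (β := β) (fun f hf => (hβ f).2 hf) haU ?_ (f := p) ?_
      · intro q hq h0
        exact ha ⟨q, hGA hq⟩ ((mem_vanishIdeal_iff' k _).2 ((hmat q).1 h0))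
      · intro b hb
        rw [hXC] at hb
        exact hb.1 p hp
    · intro a ha
      exact ⟨hXU ha, fun p hp => (mem_vanishIdeal_iff' k p).1 hp a ha⟩

theorem part_two (hn : 1 ≤ n) {A : Subalgebra k (MatPoly k n m)} (hGA : GMN k n m ≤ A)
    (hAT : A ≤ TMN k n m)
    (htr : ∀ r ∈ A, r.trace ∈ trC k n m)
    {S : Set (MatPoly k n m)} (hS : S ⊆ traceScalar k '' (GMN k n m : Set (MatPoly k n m)))
    (hAS : A = Algebra.adjoin k ((GMN k n m : Set (MatPoly k n m)) ∪ S))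
    {J : TwoSidedIdeal ↥A} (hJ : J ∈ SpecN n ↥A) :
    (IsNVariety k (zeroLocusI k J) ∧ IsIrredSubset k (zeroLocusI k J)) ∧
      vanishIdeal k A (zeroLocusI k J) = J := by
  obtain ⟨L, _, _, β, ⟨x, hx, hd⟩, hβ⟩ := point_of_spec k hn hGA hS hAS hJ
  have hpr := orbIdeal_prime k β
  set X : Set (MTuple k n m) :=
    {a | ∀ f ∈ (orbIdeal k β : Set (PolyRing k n m)), polyEval k a f = 0} ∩ genTuples k n m with hXdef
  have hXI : ∀ f, (∀ a ∈ X, polyEval k a f = 0) → f ∈ orbIdeal k β := by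
    intro f hf
    have h1 : f * (tgram x).det ∈ (orbIdeal k β).radical := by
      apply polyEval_eq_zero_imp_radical
      intro a ha
      rw [map_mul]
      by_cases h0 : polyEval k a (tgram x).det = 0
      · rw [h0, mul_zero]
      · rw [hf a ⟨ha, (mem_genTuples_iff k a).2 ⟨x, hx, h0⟩⟩, zero_mul]
    rw [hpr.radical] at h1
    refine (hpr.mem_or_mem h1).resolve_right fun h => hd ?_
    have := h 1
    rwa [conjP_one] at this
  have hXV : IsNVariety k X := by
    refine ⟨fun a ha => ha.2, fun g a ha => ⟨orbIdeal_conj k β ha.1 g, genTuples_conj k ha.2 g⟩,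
      _, ⟨_, rfl⟩, hXdef⟩
  have hXirr : IsIrredSubset k X := by
    constructor
    · by_contra h
      rw [Set.not_nonempty_iff_eq_empty] at h
      refine hpr.ne_top ((Ideal.eq_top_iff_one _).2 (hXI 1 ?_))
      rw [h]
      intro a ha
      exact ha.elim
    · rintro _ _ ⟨S₁, rfl⟩ ⟨S₂, rfl⟩ hsub
      by_contra hcon
      rw [not_or, Set.not_subset, Set.not_subset] at hcon
      obtain ⟨⟨a, ha, ha'⟩, b, hb, hb'⟩ := hcon
      simp only [Set.mem_ofPred_eq, not_forall] at ha' hb'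
      obtain ⟨f, hf, hfa⟩ := ha'
      obtain ⟨g, hg, hgb⟩ := hb'
      have h1 : f * g ∈ orbIdeal k β := by
        apply hXI
        intro c hc
        rw [map_mul]
        rcases hsub hc with h | h
        · rw [h f hf, zero_mul]
        · rw [h g hg, mul_zero]
      rcases hpr.mem_or_mem h1 with h | h
      · exact hfa (ha.1 f h)
      · exact hgb (hb.1 g h)
  have hvan : vanishIdeal k A X = J := by
    ext p
    rw [mem_vanishIdeal_iff', hβ]
    constructor
    · intro h
      ext i j
      have h2 := hXI ((p : MatPoly k n m) i j) (fun a ha => congrFun (congrFun (h a ha) i) j) 1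
      rw [conjP_one] at h2
      exact h2
    · intro h a ha
      ext i j
      refine ha.1 _ fun g => ?_
      exact congrFun (congrFun ((conjP_zero_iff k g β (hAT p.2)).2 h) i) j
  have hZ : zeroLocusI k J = X := by
    rw [← hvan]
    exact (part_one k hn hGA htr hXV hXirr).2
  rw [hZ]
  exact ⟨⟨hXV, hXirr⟩, hvan⟩

theorem part_three {A : Subalgebra k (MatPoly k n m)} {J J' : TwoSidedIdeal ↥A} (h : J ≤ J') :
    zeroLocusI k J' ⊆ zeroLocusI k J :=
  fun _ ha => ⟨ha.1, fun p hp => ha.2 p (h hp)⟩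

theorem part_four {A : Subalgebra k (MatPoly k n m)} {X Y : Set (MTuple k n m)} (h : X ⊆ Y) :
    vanishIdeal k A Y ≤ vanishIdeal k A X :=
  fun p hp => (mem_vanishIdeal_iff' k p).2 fun a ha => (mem_vanishIdeal_iff' k p).1 hp a (h ha)

end assembly

/-- **Statement 13** (Theorem thm.inverse.bijections).  Let `n ≥ 1`, `m ≥ 2`.
(a) `Z(–)` and `I(–)` are mutually inverse inclusion-reversing bijections between
`Spec_n(G_{m,n})` and the set of irreducible `n`-varieties `X ⊆ U_{m,n}`.
(b) `Z(–)` and `I_T(–)` are mutually inverse inclusion-reversing bijections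
between `Spec_n(T_{m,n})` and the set of irreducible `n`-varieties `X ⊆ U_{m,n}`. -/
theorem inverse_bijections (n m : ℕ) (hn : 1 ≤ n) (hm : 2 ≤ m) :
    -- (a) the generic matrix algebra G_{m,n}
    ((∀ J ∈ SpecN n ↥(GMN k n m),
        (IsNVariety k (zeroLocusI k J) ∧ IsIrredSubset k (zeroLocusI k J)) ∧
        vanishIdeal k (GMN k n m) (zeroLocusI k J) = J) ∧
     (∀ X : Set (MTuple k n m), IsNVariety k X → IsIrredSubset k X →
        vanishIdeal k (GMN k n m) X ∈ SpecN n ↥(GMN k n m) ∧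
        zeroLocusI k (vanishIdeal k (GMN k n m) X) = X) ∧
     (∀ J J' : TwoSidedIdeal ↥(GMN k n m), J ∈ SpecN n ↥(GMN k n m) →
        J' ∈ SpecN n ↥(GMN k n m) → J ≤ J' → zeroLocusI k J' ⊆ zeroLocusI k J) ∧
     (∀ X Y : Set (MTuple k n m), IsNVariety k X → IsIrredSubset k X →
        IsNVariety k Y → IsIrredSubset k Y → X ⊆ Y →
        vanishIdeal k (GMN k n m) Y ≤ vanishIdeal k (GMN k n m) X)) ∧
    -- (b) the trace ring T_{m,n}
    ((∀ J ∈ SpecN n ↥(TMN k n m),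
        (IsNVariety k (zeroLocusI k J) ∧ IsIrredSubset k (zeroLocusI k J)) ∧
        vanishIdeal k (TMN k n m) (zeroLocusI k J) = J) ∧
     (∀ X : Set (MTuple k n m), IsNVariety k X → IsIrredSubset k X →
        vanishIdeal k (TMN k n m) X ∈ SpecN n ↥(TMN k n m) ∧
        zeroLocusI k (vanishIdeal k (TMN k n m) X) = X) ∧
     (∀ J J' : TwoSidedIdeal ↥(TMN k n m), J ∈ SpecN n ↥(TMN k n m) →
        J' ∈ SpecN n ↥(TMN k n m) → J ≤ J' → zeroLocusI k J' ⊆ zeroLocusI k J) ∧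
     (∀ X Y : Set (MTuple k n m), IsNVariety k X → IsIrredSubset k X →
        IsNVariety k Y → IsIrredSubset k Y → X ⊆ Y →
        vanishIdeal k (TMN k n m) Y ≤ vanishIdeal k (TMN k n m) X)) := by
  refine ⟨⟨fun J hJ => ?_, fun X hX hXi => ?_, fun J J' _ _ h => part_three k h,
    fun X Y _ _ _ _ h => part_four k h⟩, ⟨fun J hJ => ?_, fun X hX hXi => ?_,
    fun J J' _ _ h => part_three k h, fun X Y _ _ _ _ h => part_four k h⟩⟩
  · exact part_two k hn le_rfl (GMN_le_TMN k n m)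
      (fun r hr => trace_TMN k (GMN_le_TMN k n m hr)) (S := ∅) (Set.empty_subset _)
      (by rw [Set.union_empty, Algebra.adjoin_eq]) hJ
  · exact part_one k hn le_rfl (fun r hr => trace_TMN k (GMN_le_TMN k n m hr)) hX hXi
  · exact part_two k hn (GMN_le_TMN k n m) le_rfl (fun r hr => trace_TMN k hr)
      (Set.Subset.refl _) rfl hJ
  · exact part_one k hn (GMN_le_TMN k n m) (fun r hr => trace_TMN k hr) hX hXi

end
end

section
/- Two n-varieties X ⊆ U_{m,n} and Y ⊆ U_{l,n} are isomorphic as n-varieties if and only if their PI-coordinate rings k_n[X] and k_n[Y] are isomorphic as k-algebras. -/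
set_option linter.unusedSectionVars false

noncomputable section

universe u

-- Throughout, `k` is an algebraically closed base field of characteristic zero.
variable (k : Type) [Field k] [IsAlgClosed k] [CharZero k]

open Polynomial in
theorem aux_derivative_det {n : Type*} [Fintype n] [DecidableEq n] {A : Type*} [CommRing A]
    (M : Matrix n n A[X]) :
    derivative M.det = (M.adjugate * M.map derivative).trace := by
  have h1 : (M.adjugate * M.map derivative).trace
      = ∑ i, (M.updateCol i (fun j => derivative (M j i))).det := by
    rw [Matrix.trace]
    refine Finset.sum_congr rfl fun i _ => ?_
    rw [← Matrix.cramer_apply, Matrix.cramer_eq_adjugate_mulVec]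
    rfl
  rw [h1, Matrix.det_apply]
  simp_rw [Matrix.det_apply]
  rw [Finset.sum_comm, map_sum]
  refine Finset.sum_congr rfl fun σ _ => ?_
  rw [← Finset.smul_sum]
  have : derivative (∏ i, M (σ i) i) = ∑ i, ∏ j, M.updateCol i (fun j => derivative (M j i)) (σ j) j := by
    rw [Polynomial.derivative_prod_finset]
    refine Finset.sum_congr rfl fun i _ => ?_
    rw [← Finset.prod_erase_mul _ _ (Finset.mem_univ i)]
    congr 1
    · refine Finset.prod_congr rfl fun j hj => ?_
      rw [Matrix.updateCol_ne (Finset.ne_of_mem_erase hj)]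
    · simp
  rw [← this]
  rcases Int.units_eq_one_or (Equiv.Perm.sign σ) with h | h <;> simp [h, Units.smul_def]

open Polynomial in
theorem aux_derivative_charpoly {n : Type*} [Fintype n] [DecidableEq n] {A : Type*} [CommRing A]
    (M : Matrix n n A) :
    derivative M.charpoly = (M.charmatrix.adjugate).trace := by
  rw [Matrix.charpoly, aux_derivative_det]
  have : M.charmatrix.map derivative = 1 := by
    ext i j
    by_cases h : i = j
    · subst h; simp [Matrix.charmatrix_apply_eq]
    · simp [h]
  rw [this, mul_one]

/-- adjugate of a singular matrix has rank at most one -/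
theorem aux_adj_rank_one {n : Type*} [Fintype n] [DecidableEq n] {K : Type*} [Field K]
    (M : Matrix n n K) (hM : M.det = 0) :
    ∃ v φ : n → K, M.adjugate = Matrix.vecMulVec v φ := by
  obtain ⟨L, L', D, h⟩ := Matrix.Pivot.exists_list_transvec_mul_diagonal_mul_list_transvec M
  set P := (L.map Matrix.TransvectionStruct.toMatrix).prod with hP
  set Q := (L'.map Matrix.TransvectionStruct.toMatrix).prod with hQ
  have hD : ∃ i, D i = 0 := by
    rw [h] at hM
    simpa [hP, hQ, Finset.prod_eq_zero_iff] using hM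
  obtain ⟨i, hi⟩ := hD
  have hadj : (Matrix.diagonal D).adjugate
      = Matrix.vecMulVec (Pi.single i (∏ j ∈ Finset.univ.erase i, D j)) (Pi.single i 1) := by
    rw [Matrix.adjugate_diagonal]
    ext a b
    rw [Matrix.vecMulVec_apply, Matrix.diagonal_apply]
    by_cases hai : a = i
    · subst hai
      by_cases hab : a = b
      · subst hab; simp
      · simp [hab, Ne.symm hab]
    · have : ∏ j ∈ Finset.univ.erase a, D j = 0 :=
        Finset.prod_eq_zero (i := i) (by simp [Ne.symm hai]) hi
      simp [this, hai]
  rw [h, Matrix.adjugate_mul_distrib, Matrix.adjugate_mul_distrib, hadj]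
  refine ⟨Q.adjugate.mulVec (Pi.single i (∏ j ∈ Finset.univ.erase i, D j)),
    Matrix.vecMul (Pi.single i 1) P.adjugate, ?_⟩
  rw [Matrix.vecMulVec_mul, Matrix.mul_vecMulVec]

/-- Homogenisation of a polynomial. -/
theorem aux_homog {σ K : Type*} [Field K] (f : MvPolynomial σ K) :
    ∃ (N : ℕ) (F : MvPolynomial (Option σ) K), ∀ (δ : K) (c : σ → K), δ ≠ 0 →
      MvPolynomial.eval (fun o => o.elim δ c) F
        = δ ^ N * MvPolynomial.eval (fun s => c s / δ) f := by
  induction f using MvPolynomial.induction_on with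
  | C a => exact ⟨0, MvPolynomial.C a, fun δ c _ => by simp⟩
  | add p q hp hq =>
    obtain ⟨N, F, h⟩ := hp
    obtain ⟨N', F', h'⟩ := hq
    refine ⟨N + N', MvPolynomial.X none ^ N' * F + MvPolynomial.X none ^ N * F', fun δ c hδ => ?_⟩
    simp [h δ c hδ, h' δ c hδ]
    ring
  | mul_X p s hp =>
    obtain ⟨N, F, h⟩ := hp
    refine ⟨N + 1, F * MvPolynomial.X (some s), fun δ c hδ => ?_⟩
    simp [h δ c hδ]
    field_simp
    ring

/-- A polynomial killing all eigenvalues has trace zero at the matrix. -/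
theorem aux_trace_aeval {n : Type*} [Fintype n] [DecidableEq n] {K : Type*} [Field K]
    [IsAlgClosed K] (M : Matrix n n K) (p : Polynomial K)
    (hp : ∀ x, (Matrix.scalar n x - M).det = 0 → p.eval x = 0) :
    (Polynomial.aeval M p).trace = 0 := by
  classical
  have hdvd : M.charpoly ∣ p ^ M.charpoly.natDegree := by
    by_cases h0 : p = 0
    · by_cases hd : M.charpoly.natDegree = 0
      · have := (Matrix.charpoly_monic M).natDegree_eq_zero.mp hd
        rw [this]; exact one_dvd _
      · rw [h0, zero_pow hd]; exact dvd_zero _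
    have hs := IsAlgClosed.splits M.charpoly
    rw [hs.dvd_iff_roots_le_roots (Matrix.charpoly_monic M).ne_zero (pow_ne_zero _ h0)]
    rw [Multiset.le_iff_count]
    intro a
    rw [Polynomial.roots_pow, Multiset.count_nsmul]
    by_cases ha : a ∈ M.charpoly.roots
    · have h1 : M.charpoly.IsRoot a := (Polynomial.mem_roots'.mp ha).2
      have h2 : p.eval a = 0 := hp a (by rw [← Matrix.eval_charpoly]; exact h1)
      have h3 : 1 ≤ p.roots.count a := by
        rw [Multiset.one_le_count_iff_mem]
        exact (Polynomial.mem_roots h0).mpr h2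
      calc M.charpoly.roots.count a ≤ M.charpoly.roots.card := Multiset.count_le_card _ _
        _ ≤ M.charpoly.natDegree := Polynomial.card_roots' _
        _ ≤ _ := Nat.le_mul_of_pos_right _ h3
    · rw [Multiset.count_eq_zero_of_notMem ha]; exact Nat.zero_le _
  obtain ⟨r, hr⟩ := hdvd
  have hnil : IsNilpotent (Polynomial.aeval M p) := by
    refine ⟨M.charpoly.natDegree, ?_⟩
    rw [← map_pow, hr, map_mul, Matrix.aeval_self_charpoly, zero_mul]
  exact (Matrix.isNilpotent_trace_of_isNilpotent hnil).eq_zero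
theorem aux_alt_trace_scalar {ι A W : Type*} [Fintype ι] [DecidableEq ι] [CommRing A]
    [AddCommGroup W] [Module A W] (e : Module.Basis ι A W) (T : W →ₗ[A] W)
    (E : W [⋀^ι]→ₗ[A] A) (w : ι → W) :
    ∑ i, E (Function.update w i (T (w i))) = LinearMap.trace A W T * E w := by
  have hE : ∀ v, E v = E e * e.det v := fun v => by
    conv_lhs => rw [E.eq_smul_basis_det e]
    simp
  have key : ∑ i, e.det (Function.update w i (T (w i))) = LinearMap.trace A W T * e.det w := by
    have h1 : ∀ i, e.det (Function.update w i (T (w i)))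
        = ((e.toMatrix w).adjugate * (LinearMap.toMatrix e e T * e.toMatrix w)) i i := by
      intro i
      have h2 : e.toMatrix (Function.update w i (T (w i)))
          = (e.toMatrix w).updateCol i ((LinearMap.toMatrix e e T).mulVec ((e.toMatrix w).col i)) := by
        rw [Module.Basis.toMatrix_update]
        congr 1
        ext j
        have := congrFun (LinearMap.toMatrix_mulVec_repr e e T (w i)) j
        rw [← this]
        rfl
      rw [Module.Basis.det_apply, h2, ← Matrix.cramer_apply, Matrix.cramer_eq_adjugate_mulVec]
      rfl
    simp_rw [h1]
    change Matrix.trace _ = _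
    rw [Matrix.trace_mul_comm, mul_assoc, Matrix.mul_adjugate, Matrix.mul_smul, mul_one,
      Matrix.trace_smul, LinearMap.trace_eq_matrix_trace A e, Module.Basis.det_apply, smul_eq_mul,
      mul_comm]
  rw [Finset.sum_congr rfl fun i _ => hE (Function.update w i (T (w i))), ← Finset.mul_sum, key,
    hE w]
  ring

theorem aux_trace_mulLeft {A : Type*} [CommRing A] {n : ℕ} (u : Matrix (Fin n) (Fin n) A) :
    LinearMap.trace A _ (LinearMap.mulLeft A u) = n * u.trace := by
  rw [LinearMap.trace_eq_matrix_trace A (Matrix.stdBasis A (Fin n) (Fin n))]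
  simp only [Matrix.trace, Matrix.diag, LinearMap.toMatrix_apply, Fintype.sum_prod_type]
  have : ∀ i j : Fin n, ((Matrix.stdBasis A (Fin n) (Fin n)).repr
      ((LinearMap.mulLeft A u) ((Matrix.stdBasis A (Fin n) (Fin n)) (i, j)))) (i, j) = u i i := by
    intro i j
    rw [Matrix.stdBasis_eq_single]
    change (u * (Matrix.single i j 1 : Matrix (Fin n) (Fin n) A)) i j = _
    simp
  simp only [this]
  simp [Finset.mul_sum]

theorem aux_alt_trace {ι A : Type*} [Fintype ι] [DecidableEq ι] [CommRing A] {n : ℕ}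
    (e : Module.Basis ι A (Matrix (Fin n) (Fin n) A)) (u : Matrix (Fin n) (Fin n) A)
    (E : (Matrix (Fin n) (Fin n) A) [⋀^ι]→ₗ[A] (Matrix (Fin n) (Fin n) A))
    (w : ι → Matrix (Fin n) (Fin n) A) :
    ∑ i, E (Function.update w i (u * w i)) = (n * u.trace) • E w := by
  ext a b
  have := aux_alt_trace_scalar e (LinearMap.mulLeft A u)
    ((Matrix.entryLinearMap A A a b).compAlternatingMap E) w
  rw [aux_trace_mulLeft] at this
  simpa [Matrix.sum_apply] using this

/-- the trace algebra -/
def auxT {k A : Type*} [Field k] [CommRing A] [Algebra k A] {n : ℕ}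
    (G : Subalgebra k (Matrix (Fin n) (Fin n) A)) : Subalgebra k A :=
  Algebra.adjoin k (Matrix.trace '' (G : Set (Matrix (Fin n) (Fin n) A)))

theorem aux_T_mul {k A : Type*} [Field k] [CharZero k] [CommRing A] [Algebra k A] {n : ℕ}
    (hn : 1 ≤ n) (G : Subalgebra k (Matrix (Fin n) (Fin n) A)) (t : A) (ht : t ∈ auxT G) :
    ∀ (E : (Matrix (Fin n) (Fin n) A) [⋀^Fin (n * n)]→ₗ[A] (Matrix (Fin n) (Fin n) A)),
      (∀ w, (∀ i, w i ∈ G) → E w ∈ G) → ∀ w, (∀ i, w i ∈ G) → t • E w ∈ G := by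
  unfold auxT at ht
  induction ht using Algebra.adjoin_induction with
  | mem x hx =>
    obtain ⟨u, hu, rfl⟩ := hx
    intro E hE w hw
    have h := aux_alt_trace ((Matrix.stdBasis A (Fin n) (Fin n)).reindex finProdFinEquiv) u E w
    have h2 : (n * u.trace) • E w ∈ G := by
      rw [← h]
      refine sum_mem fun i _ => hE _ fun j => ?_
      by_cases hj : j = i
      · subst hj; simpa using mul_mem hu (hw j)
      · simpa [hj] using hw j
    have hn0 : (n : k) ≠ 0 := by exact_mod_cast (by omega : n ≠ 0)
    have h3 : u.trace • E w = (n : k)⁻¹ • ((n * u.trace) • E w) := by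
      rw [mul_smul, Nat.cast_smul_eq_nsmul, ← Nat.cast_smul_eq_nsmul k, smul_smul,
        inv_mul_cancel₀ hn0, one_smul]
    rw [h3]
    exact G.smul_mem h2 _
  | algebraMap r =>
    intro E hE w hw
    rw [algebraMap_smul]
    exact G.smul_mem (hE w hw) _
  | add x y _ _ hx hy =>
    intro E hE w hw
    rw [add_smul]
    exact add_mem (hx E hE w hw) (hy E hE w hw)
  | mul x y _ _ hx hy =>
    intro E hE w hw
    rw [mul_smul]
    exact hx (y • E) (fun w hw => hy E hE w hw) w hw

/-- Capelli-type alternating map. -/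
def auxE {A : Type*} [CommRing A] {n N : ℕ} (y z : Fin N → Matrix (Fin n) (Fin n) A) :
    (Matrix (Fin n) (Fin n) A) [⋀^Fin N]→ₗ[A] (Matrix (Fin n) (Fin n) A) :=
  MultilinearMap.alternatization
    ((MultilinearMap.mkPiAlgebraFin A N (Matrix (Fin n) (Fin n) A)).compLinearMap
      (fun i => LinearMap.mulLeft A (y i) ∘ₗ LinearMap.mulRight A (z i)))

theorem auxE_apply {A : Type*} [CommRing A] {n N : ℕ} (y z w : Fin N → Matrix (Fin n) (Fin n) A) :
    auxE y z w = ∑ σ : Equiv.Perm (Fin N), Equiv.Perm.sign σ •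
      (List.ofFn fun i => y i * (w (σ i) * z i)).prod := by
  simp [auxE, MultilinearMap.alternatization_apply]

theorem auxE_mem {k A : Type*} [Field k] [CommRing A] [Algebra k A] {n N : ℕ}
    (G : Subalgebra k (Matrix (Fin n) (Fin n) A)) (y z w : Fin N → Matrix (Fin n) (Fin n) A)
    (hy : ∀ i, y i ∈ G) (hz : ∀ i, z i ∈ G) (hw : ∀ i, w i ∈ G) : auxE y z w ∈ G := by
  rw [auxE_apply]
  refine sum_mem fun σ _ => ?_
  have : (List.ofFn fun i => y i * (w (σ i) * z i)).prod ∈ G := by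
    refine list_prod_mem fun x hx => ?_
    obtain ⟨i, rfl⟩ := (List.mem_ofFn' _ _).mp hx
    exact mul_mem (hy i) (mul_mem (hw _) (hz i))
  rcases Int.units_eq_one_or (Equiv.Perm.sign σ) with h | h
  · simpa [h] using this
  · simpa [h, Units.smul_def] using this

theorem auxE_map {A B : Type*} [CommRing A] [CommRing B] {n N : ℕ} (f : A →+* B)
    (y z w : Fin N → Matrix (Fin n) (Fin n) A) :
    f.mapMatrix (auxE y z w) = auxE (fun i => f.mapMatrix (y i)) (fun i => f.mapMatrix (z i))
      (fun i => f.mapMatrix (w i)) := by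
  rw [auxE_apply, auxE_apply, map_sum]
  refine Finset.sum_congr rfl fun σ _ => ?_
  have : f.mapMatrix (List.ofFn fun i => y i * (w (σ i) * z i)).prod
      = (List.ofFn fun i => f.mapMatrix (y i) * (f.mapMatrix (w (σ i)) * f.mapMatrix (z i))).prod := by
    rw [map_list_prod, List.map_ofFn]
    congr 2
    ext1 i
    simp only [Function.comp, map_mul]
  rw [← this]
  rcases Int.units_eq_one_or (Equiv.Perm.sign σ) with h | h
  · simp [h]
  · simp only [h, Units.smul_def, Units.val_neg, Units.val_one, neg_smul, one_smul, map_neg]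

theorem auxE_units {K : Type*} [Field K] {n : ℕ} (o : Fin n) (e : Fin (n * n) ≃ Fin n × Fin n) :
    (auxE (fun i => Matrix.single o (e i).1 (1 : K)) (fun i => Matrix.single (e i).2 o (1 : K))
      (fun i => Matrix.single (e i).1 (e i).2 (1 : K))) = Matrix.single o o 1 := by
  have hN : n * n ≠ 0 := by have := o.pos; positivity
  rw [auxE_apply, Finset.sum_eq_single 1]
  · have : (fun i => Matrix.single o (e i).1 (1 : K) * (Matrix.single (e ((1 : Equiv.Perm (Fin (n * n))) i)).1
      (e ((1 : Equiv.Perm (Fin (n * n))) i)).2 (1 : K) * Matrix.single (e i).2 o (1 : K)))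
      = fun _ => Matrix.single o o (1 : K) := by
      ext1 i; simp
    rw [this]
    have hid : IsIdempotentElem (Matrix.single o o (1 : K)) := by
      simp [IsIdempotentElem]
    simp [List.ofFn_const, hid.pow_eq hN]
  · intro σ _ hσ
    have : ∃ i, σ i ≠ i := by
      by_contra h; push Not at h; exact hσ (Equiv.ext h)
    obtain ⟨i, hi⟩ := this
    have : (List.ofFn fun i => Matrix.single o (e i).1 (1 : K) * (Matrix.single (e (σ i)).1
      (e (σ i)).2 (1 : K) * Matrix.single (e i).2 o (1 : K))).prod = 0 := by
      apply List.prod_eq_zero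
      rw [List.mem_ofFn']
      refine ⟨i, ?_⟩
      beta_reduce
      by_cases h2 : (e (σ i)).2 = (e i).2
      · by_cases h1 : (e (σ i)).1 = (e i).1
        · exact absurd (e.injective (Prod.ext h1 h2)) hi
        · simp only [h2, Matrix.single_mul_single_same]
          rw [Matrix.single_mul_single_of_ne _ _ _ _ (Ne.symm h1)]
      · rw [Matrix.single_mul_single_of_ne _ _ _ _ h2, mul_zero]
    rw [this, smul_zero]
  · simp

open Polynomial in
theorem aux_adj_coeff {k A : Type*} [Field k] [CharZero k] [CommRing A] [Nontrivial A] [Algebra k A] {n : ℕ}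
    (G : Subalgebra k (Matrix (Fin n) (Fin n) A)) (w : Matrix (Fin n) (Fin n) A) (hw : w ∈ G)
    (u : Matrix (Fin n) (Fin n) A) (hu : u ∈ G) (i : ℕ) :
    ((u.map C * w.charmatrix.adjugate).trace).coeff i ∈ auxT G := by
  set q := matPolyEquiv w.charmatrix.adjugate with hqdef
  set χ := w.charpoly with hχ
  have hT : ∀ v ∈ G, v.trace ∈ auxT G := fun v hv => Algebra.subset_adjoin ⟨v, hv, rfl⟩
  have hmul : (X - C w) * q = χ.map (algebraMap A (Matrix (Fin n) (Fin n) A)) := by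
    rw [hqdef, ← Matrix.matPolyEquiv_charmatrix, ← map_mul, Matrix.mul_adjugate,
      matPolyEquiv_smul_one]
    rfl
  have hrec : ∀ j, q.coeff j = w * q.coeff (j + 1)
      + algebraMap A (Matrix (Fin n) (Fin n) A) (χ.coeff (j + 1)) := by
    intro j
    have := congrArg (fun p => p.coeff (j + 1)) hmul
    simp only [sub_mul, coeff_sub, coeff_X_mul, coeff_C_mul, coeff_map] at this
    rw [← this]; abel
  have htr : ∀ j, (q.coeff j).trace = χ.coeff (j + 1) * (j + 1) := by
    intro j
    rw [← coeff_derivative, hχ, aux_derivative_charpoly]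
    simp only [Matrix.trace, Matrix.diag, finsetSum_coeff, hqdef, matPolyEquiv_coeff_apply]
  have hmain : ∀ j i, q.natDegree < i + j → ∀ u ∈ G, (u * q.coeff i).trace ∈ auxT G := by
    intro j
    induction j with
    | zero =>
      intro i hi u hu
      rw [coeff_eq_zero_of_natDegree_lt (by simpa using hi)]
      simp [zero_mem]
    | succ j ih =>
      intro i hi u hu
      have ih' := ih (i + 1) (by omega)
      have hc : χ.coeff (i + 1) ∈ auxT G := by
        have hdeg : χ.natDegree = n := by
          have := Matrix.charpoly_natDegree_eq_dim w
          rwa [Fintype.card_fin] at this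
        rcases lt_trichotomy (i + 1) n with h | h | h
        · have h1 := htr i
          rw [hrec i, Matrix.trace_add, Matrix.algebraMap_eq_diagonal, Matrix.trace_diagonal] at h1
          simp only [Pi.algebraMap_apply, Algebra.algebraMap_self, RingHom.id_apply,
            Finset.sum_const, Finset.card_univ, Fintype.card_fin, nsmul_eq_mul] at h1
          have h0 : ((n : k) - (i + 1)) ≠ 0 := by
            have : ((i + 1 : ℕ) : k) ≠ (n : k) := by exact_mod_cast h.ne
            intro h2
            apply this
            push_cast
            exact (sub_eq_zero.mp h2).symm
          have h2 : χ.coeff (i + 1) = - (((n : k) - (i + 1))⁻¹ • (w * q.coeff (i + 1)).trace) := by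
            have h3 : (w * q.coeff (i + 1)).trace = - (((n : k) - (i + 1)) • χ.coeff (i + 1)) := by
              rw [Algebra.smul_def]
              push_cast [map_sub, map_add, map_natCast, map_one]
              linear_combination h1
            rw [h3, smul_neg, neg_neg, smul_smul, inv_mul_cancel₀ h0, one_smul]
          rw [h2]
          exact neg_mem ((auxT G).smul_mem (ih' w hw) _)
        · have : χ.coeff (i + 1) = 1 := by
            rw [h, ← hdeg]; exact Matrix.charpoly_monic w
          rw [this]; exact one_mem _
        · rw [coeff_eq_zero_of_natDegree_lt (by omega)]; exact zero_mem _
      rw [hrec i, mul_add, Matrix.trace_add, ← mul_assoc, ← Algebra.commutes, ← Algebra.smul_def,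
        Matrix.trace_smul, smul_eq_mul]
      exact add_mem (ih' _ (mul_mem hu hw)) (mul_mem hc (hT u hu))
  have : ((u.map C * w.charmatrix.adjugate).trace).coeff i = (u * q.coeff i).trace := by
    simp only [Matrix.trace, Matrix.diag, finsetSum_coeff, Matrix.mul_apply, Matrix.map_apply,
      coeff_C_mul, hqdef, matPolyEquiv_coeff_apply]
  rw [this]
  exact hmain (q.natDegree + 1) i (by omega) u hu

theorem aux_aeval_idem {K B : Type*} [Field K] [Ring B] [Algebra K B] (e : B) (he : e * e = e)
    (p : Polynomial K) :
    Polynomial.aeval e p = (p.eval 0) • (1 - e) + (p.eval 1) • e := by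
  induction p using Polynomial.induction_on' with
  | add p q hp hq => simp only [map_add, hp, hq, Polynomial.eval_add, add_smul]; abel
  | monomial i c =>
    have hid : IsIdempotentElem e := he
    rcases Nat.eq_zero_or_pos i with h | h
    · subst h
      simp [Algebra.algebraMap_eq_smul_one, ← smul_add]
    · rw [Polynomial.aeval_monomial, hid.pow_eq (by omega)]
      simp [zero_pow (by omega : i ≠ 0), Algebra.smul_def]

theorem aux_evalMat_surj {n m : ℕ} (b : MTuple k n m) (hb : b ∈ genTuples k n m)
    (M : Matrix (Fin n) (Fin n) k) : ∃ p ∈ GMN k n m, evalMat k b p = M := by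
  have h1 : (GMN k n m).map (evalMat k b) = ⊤ := by
    rw [GMN, AlgHom.map_adjoin, ← Set.range_comp]
    have : (evalMat k b) ∘ genericMatrix k n m = b := by
      ext h i j
      simp [evalMat, genericMatrix, polyEval]
    rw [this]
    exact hb
  have h2 : M ∈ (GMN k n m).map (evalMat k b) := by rw [h1]; trivial
  obtain ⟨p, hp, rfl⟩ := h2
  exact ⟨p, hp, rfl⟩

theorem aux_evalMat_generic {n m : ℕ} (a : MTuple k n m) (h : Fin m) :
    evalMat k a (genericMatrix k n m h) = a h := by
  ext i j
  simp [evalMat, genericMatrix, polyEval]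

theorem aux_evalMat_smul {n m : ℕ} (a : MTuple k n m) (t : PolyRing k n m) (p : MatPoly k n m) :
    evalMat k a (t • p) = polyEval k a t • evalMat k a p := by
  ext i j
  simp [evalMat]

theorem aux_sep_trace {n m : ℕ} (hn : 1 ≤ n) (X : Set (MTuple k n m)) (b : MTuple k n m)
    (hb : b ∈ genTuples k n m)
    (H : ∀ p ∈ GMN k n m, (∀ a ∈ X, evalMat k a p = 0) → evalMat k b p = 0)
    (t : PolyRing k n m) (ht : t ∈ auxT (GMN k n m)) (hX : ∀ a ∈ X, polyEval k a t = 0) :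
    polyEval k b t = 0 := by
  choose P hPG hPb using aux_evalMat_surj k b hb
  let o : Fin n := ⟨0, hn⟩
  let e : Fin (n * n) ≃ Fin n × Fin n := finProdFinEquiv.symm
  let y : Fin (n * n) → MatPoly k n m := fun i => P (Matrix.single o (e i).1 1)
  let z : Fin (n * n) → MatPoly k n m := fun i => P (Matrix.single (e i).2 o 1)
  let w : Fin (n * n) → MatPoly k n m := fun i => P (Matrix.single (e i).1 (e i).2 1)
  have hmem : t • auxE y z w ∈ GMN k n m :=
    aux_T_mul hn _ t ht (auxE y z)
      (fun w hw => auxE_mem _ y z w (fun _ => hPG _) (fun _ => hPG _) hw) w (fun _ => hPG _)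
  have h0 := H _ hmem (fun a ha => by rw [aux_evalMat_smul, hX a ha, zero_smul])
  have h1 : evalMat k b (auxE y z w) = Matrix.single o o 1 := by
    rw [← auxE_units o e]
    have := auxE_map (polyEval k b : PolyRing k n m →+* k) y z w
    refine Eq.trans this ?_
    have hy : (fun i => (polyEval k b : PolyRing k n m →+* k).mapMatrix (y i))
        = fun i => Matrix.single o (e i).1 1 := funext fun i => hPb _
    have hz : (fun i => (polyEval k b : PolyRing k n m →+* k).mapMatrix (z i))
        = fun i => Matrix.single (e i).2 o 1 := funext fun i => hPb _
    have hw : (fun i => (polyEval k b : PolyRing k n m →+* k).mapMatrix (w i))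
        = fun i => Matrix.single (e i).1 (e i).2 1 := funext fun i => hPb _
    rw [hy, hz, hw]
  rw [aux_evalMat_smul, h1] at h0
  simpa using congrFun (congrFun h0 o) o

/-- polynomials with coefficients in a subalgebra -/
def auxS {A : Type*} [CommRing A] [Algebra k A] (T : Subalgebra k A) :
    Subalgebra k (Polynomial A) :=
  (Polynomial.mapAlgHom T.val).range

theorem aux_mem_auxS {A : Type*} [CommRing A] [Algebra k A] (T : Subalgebra k A)
    (p : Polynomial A) : p ∈ auxS k T ↔ ∀ i, p.coeff i ∈ T := by
  have h := Polynomial.lifts_iff_coeff_lifts (f := (T.val : T →+* A)) p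
  rw [Polynomial.mem_lifts] at h
  have h2 : p ∈ auxS k T ↔ ∃ q : Polynomial T, Polynomial.map (T.val : T →+* A) q = p := Iff.rfl
  rw [h2, h]
  simp

/-- evaluation at a point and at a scalar -/
def auxEv {n m : ℕ} (a : MTuple k n m) (x : k) : Polynomial (PolyRing k n m) →+* k :=
  Polynomial.eval₂RingHom (polyEval k a : PolyRing k n m →+* k) x

theorem aux_ev_adj {n m : ℕ} (a : MTuple k n m) (x : k) (u w : MatPoly k n m) :
    auxEv k a x ((u.map Polynomial.C * w.charmatrix.adjugate).trace)
      = (evalMat k a u * (Matrix.scalar (Fin n) x - evalMat k a w).adjugate).trace := by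
  have h1 : (auxEv k a x).mapMatrix (u.map Polynomial.C) = evalMat k a u := by
    ext i j
    simp [auxEv, evalMat]
  have h2 : (auxEv k a x).mapMatrix w.charmatrix
      = Matrix.scalar (Fin n) x - evalMat k a w := by
    ext i j
    by_cases h : i = j
    · subst h; simp [auxEv, evalMat, Matrix.charmatrix_apply_eq]
    · simp [auxEv, evalMat, h]
  rw [← h1, ← h2, ← RingHom.map_adjugate, ← map_mul]
  simp only [Matrix.trace, map_sum]
  rfl

theorem aux_ev_C {n m : ℕ} (a : MTuple k n m) (x : k) (r : k) :
    auxEv k a x (algebraMap k (Polynomial (PolyRing k n m)) r) = r := by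
  rw [IsScalarTower.algebraMap_apply k (PolyRing k n m) (Polynomial (PolyRing k n m))]
  simp [auxEv]

theorem aux_frame {n : ℕ} (r s : Fin n → Matrix (Fin n) (Fin n) k) (v φ : Fin n → k)
    (M : Matrix (Fin n) (Fin n) k) (i j : Fin n) :
    (r i * M * s j * Matrix.vecMulVec v φ).trace
      = ((Matrix.of fun i j => Matrix.vecMul φ (r i) j) * M *
        (Matrix.of fun i j => Matrix.mulVec (s j) v i)) i j := by
  rw [Matrix.mul_vecMulVec, Matrix.trace_vecMulVec, ← Matrix.mulVec_mulVec, ← Matrix.mulVec_mulVec,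
    dotProduct_comm, Matrix.dotProduct_mulVec, mul_assoc]
  rfl

/-- the key pointwise computation -/
theorem aux_conj {n m : ℕ} (X : Set (MTuple k n m))
    (hinv : ∀ g : GL (Fin n) k, ∀ a ∈ X, conjAct k g a ∈ X)
    (f : PolyRing k n m) (hf : ∀ a ∈ X, polyEval k a f = 0) (a : MTuple k n m) (ha : a ∈ X)
    (r s : Fin n → Matrix (Fin n) (Fin n) k) (Q : Matrix (Fin n) (Fin n) k) (hQ : Q.det = 0)
    (D : Matrix (Fin n) (Fin n) k) (hD : ∀ i j, D i j = (r i * s j * Q.adjugate).trace)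
    (c : Fin m → Matrix (Fin n) (Fin n) k)
    (hc : ∀ h i j, c h i j = (r i * a h * s j * Q.adjugate).trace) (hδ : D.det ≠ 0) :
    MvPolynomial.eval (fun x : MIdx n m => (D.adjugate * c x.1) x.2.1 x.2.2 / D.det) f = 0 := by
  obtain ⟨v, φ, hvφ⟩ := aux_adj_rank_one Q hQ
  set g' : Matrix (Fin n) (Fin n) k := Matrix.of fun i j => Matrix.vecMul φ (r i) j with hg'
  set g : Matrix (Fin n) (Fin n) k := Matrix.of fun i j => Matrix.mulVec (s j) v i with hg
  have hD' : D = g' * g := by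
    ext i j
    have := aux_frame k r s v φ 1 i j
    rw [mul_one, mul_one] at this
    rw [hD, hvφ, this]
  have hc' : ∀ h, c h = g' * a h * g := by
    intro h
    ext i j
    rw [hc, hvφ, aux_frame]
  have hdet : D.det = g'.det * g.det := by rw [hD', Matrix.det_mul]
  have hg0 : g.det ≠ 0 := fun h => hδ (by rw [hdet, h, mul_zero])
  have hg'0 : g'.det ≠ 0 := fun h => hδ (by rw [hdet, h, zero_mul])
  let gu : GL (Fin n) k := Matrix.GeneralLinearGroup.mkOfDetNeZero g hg0
  have hgu : (gu : Matrix (Fin n) (Fin n) k) = g := rfl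
  have hmem := hf _ (hinv gu⁻¹ a ha)
  have hpt : ∀ h, conjAct k gu⁻¹ a h = (D.det)⁻¹ • (D.adjugate * c h) := by
    intro h
    unfold conjAct
    rw [inv_inv, Matrix.coe_units_inv, hgu, hc', hD', Matrix.adjugate_mul_distrib, Matrix.inv_def,
      Ring.inverse_eq_inv', Matrix.det_mul]
    have : g.adjugate * g'.adjugate * (g' * a h * g) = g.adjugate * (g'.adjugate * g') * a h * g := by
      simp only [mul_assoc]
    rw [this, Matrix.adjugate_mul]
    simp only [Matrix.smul_mul, Matrix.mul_smul, mul_one, smul_smul]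
    congr 1
    field_simp
  rw [← hmem]
  unfold polyEval
  rw [MvPolynomial.aeval_eq_eval]
  change _ = MvPolynomial.eval _ f
  congr 2
  ext x
  rw [hpt, Matrix.smul_apply, smul_eq_mul, div_eq_inv_mul]

theorem aux_sep_poly {n m : ℕ} (hn : 1 ≤ n) (X : Set (MTuple k n m))
    (hinv : ∀ g : GL (Fin n) k, ∀ a ∈ X, conjAct k g a ∈ X) (b : MTuple k n m)
    (hb : b ∈ genTuples k n m)
    (H : ∀ p ∈ GMN k n m, (∀ a ∈ X, evalMat k a p = 0) → evalMat k b p = 0)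
    (f : PolyRing k n m) (hf : ∀ a ∈ X, polyEval k a f = 0) :
    polyEval k b f = 0 := by
  choose P hPG hPb using aux_evalMat_surj k b hb
  let o : Fin n := ⟨0, hn⟩
  let r : Fin n → MatPoly k n m := fun i => P (Matrix.single o i 1)
  let s : Fin n → MatPoly k n m := fun j => P (Matrix.single j o 1)
  let w : MatPoly k n m := P (Matrix.single o o 1)
  have hw : w ∈ GMN k n m := hPG _
  have hgen : ∀ h, genericMatrix k n m h ∈ GMN k n m := fun h =>
    Algebra.subset_adjoin ⟨h, rfl⟩
  obtain ⟨N, F, hF⟩ := aux_homog f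
  let S := auxS k (auxT (GMN k n m))
  have hS : ∀ u ∈ GMN k n m,
      ((u.map Polynomial.C * w.charmatrix.adjugate).trace) ∈ S := fun u hu =>
    (aux_mem_auxS k _ _).mpr fun i => aux_adj_coeff _ w hw u hu i
  let D : Matrix (Fin n) (Fin n) S := Matrix.of fun i j =>
    ⟨_, hS (r i * s j) (mul_mem (hPG _) (hPG _))⟩
  let c : Fin m → Matrix (Fin n) (Fin n) S := fun h => Matrix.of fun i j =>
    ⟨_, hS (r i * genericMatrix k n m h * s j) (mul_mem (mul_mem (hPG _) (hgen h)) (hPG _))⟩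
  let Xs : S := ⟨Polynomial.X, ⟨Polynomial.X, by simp⟩⟩
  let Ψ : S := Xs * D.det * MvPolynomial.aeval
    (fun y : Option (MIdx n m) => y.elim D.det (fun x => (D.adjugate * c x.1) x.2.1 x.2.2)) F
  let ρ : MTuple k n m → k → S →ₐ[k] k := fun a x =>
    { ((auxEv k a x).comp (S.val : S →+* Polynomial (PolyRing k n m))) with
      commutes' := fun y => aux_ev_C k a x y }
  let Da : MTuple k n m → k → Matrix (Fin n) (Fin n) k := fun a x => (ρ a x).mapMatrix D
  let ca : MTuple k n m → k → Fin m → Matrix (Fin n) (Fin n) k := fun a x h =>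
    (ρ a x).mapMatrix (c h)
  have hDa : ∀ a x i j, Da a x i j = (evalMat k a (r i) * evalMat k a (s j) *
      (Matrix.scalar (Fin n) x - evalMat k a w).adjugate).trace := by
    intro a x i j
    rw [← map_mul]
    exact aux_ev_adj k a x (r i * s j) w
  have hca : ∀ a x h i j, ca a x h i j = (evalMat k a (r i) * a h * evalMat k a (s j) *
      (Matrix.scalar (Fin n) x - evalMat k a w).adjugate).trace := by
    intro a x h i j
    rw [← aux_evalMat_generic k a h, ← map_mul, ← map_mul]
    exact aux_ev_adj k a x (r i * genericMatrix k n m h * s j) w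
  have hρ : ∀ a x, ρ a x Ψ = x * (Da a x).det * MvPolynomial.eval
      (fun y : Option (MIdx n m) => y.elim (Da a x).det
        (fun z => ((Da a x).adjugate * ca a x z.1) z.2.1 z.2.2)) F := by
    intro a x
    have h1 : ρ a x Xs = x := by
      change auxEv k a x Polynomial.X = x
      simp [auxEv]
    have h2 : ρ a x D.det = (Da a x).det := AlgHom.map_det _ _
    have h3 : ∀ h i j, ρ a x ((D.adjugate * c h) i j) = ((Da a x).adjugate * ca a x h) i j := by
      intro h i j
      have : (ρ a x).mapMatrix (D.adjugate * c h) = (Da a x).adjugate * ca a x h := by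
        rw [map_mul, AlgHom.map_adjugate]
      exact congrFun (congrFun this i) j
    rw [map_mul, map_mul, h1, h2, MvPolynomial.comp_aeval_apply, MvPolynomial.aeval_eq_eval]
    change _ * MvPolynomial.eval _ F = _
    congr 3
    ext y
    cases y with
    | none => exact h2
    | some z => exact h3 _ _ _
  have hzero : ∀ a ∈ X, ∀ x, (Matrix.scalar (Fin n) x - evalMat k a w).det = 0 →
      ρ a x Ψ = 0 := by
    intro a ha x hx
    rw [hρ]
    by_cases hδ : (Da a x).det = 0
    · rw [hδ]; simp
    · rw [hF _ _ hδ, aux_conj k X hinv f hf a ha _ _ _ hx _ (hDa a x) _ (hca a x) hδ]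
      simp
  let Ψ' : Polynomial (PolyRing k n m) := Ψ
  let t : PolyRing k n m := (Polynomial.aeval w Ψ').trace
  have htT : t ∈ auxT (GMN k n m) := by
    change Matrix.trace _ ∈ _
    rw [Polynomial.aeval_eq_sum_range, Matrix.trace_sum]
    refine sum_mem fun i _ => ?_
    rw [Matrix.trace_smul, smul_eq_mul]
    exact mul_mem ((aux_mem_auxS k _ _).mp Ψ.2 i)
      (Algebra.subset_adjoin ⟨_, pow_mem hw i, rfl⟩)
  have heval : ∀ a, polyEval k a t = (Polynomial.aeval (evalMat k a w)
      (Ψ'.map (polyEval k a : PolyRing k n m →+* k))).trace := by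
    intro a
    have h1 : evalMat k a (Polynomial.aeval w Ψ') = Polynomial.aeval (evalMat k a w)
        (Ψ'.map (polyEval k a : PolyRing k n m →+* k)) := by
      refine Polynomial.map_aeval_eq_aeval_map (φ := (polyEval k a : PolyRing k n m →+* k))
        (ψ := (evalMat k a : MatPoly k n m →+* Matrix (Fin n) (Fin n) k)) ?_ Ψ' w
      refine RingHom.ext fun p => ?_
      ext i j
      by_cases hij : i = j <;> simp [evalMat, Matrix.algebraMap_matrix_apply, hij]
    rw [← h1]
    simp [t, Matrix.trace, map_sum, evalMat]
  have hρe : ∀ a x, (Ψ'.map (polyEval k a : PolyRing k n m →+* k)).eval x = ρ a x Ψ := by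
    intro a x
    rw [Polynomial.eval_map]
    rfl
  have ht := aux_sep_trace k hn X b hb H t htT (fun a ha => by
    rw [heval]
    exact aux_trace_aeval _ _ fun x hx => by rw [hρe]; exact hzero a ha x hx)
  have hwb : evalMat k b w = Matrix.single o o 1 := hPb _
  rw [heval, aux_aeval_idem _ (by rw [hwb]; simp), hρe, hρe, hρ b 0] at ht
  simp only [zero_mul, zero_smul, zero_add, Matrix.trace_smul, hwb, Matrix.trace_single_eq_same,
    smul_eq_mul, mul_one] at ht
  rw [hρ] at ht
  have hadj : (Matrix.scalar (Fin n) (1 : k) - evalMat k b w).adjugate = Matrix.single o o 1 := by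
    have : Matrix.scalar (Fin n) (1 : k) - evalMat k b w
        = Matrix.diagonal (fun i => if i = o then 0 else 1) := by
      rw [hwb]
      ext i j
      by_cases hij : i = j
      · subst hij
        by_cases hio : i = o
        · subst hio; simp
        · simp [hio, Matrix.single_apply, Ne.symm hio]
      · simp only [Matrix.scalar_apply, Matrix.sub_apply, Matrix.diagonal_apply_ne _ hij,
          Matrix.single_apply, zero_sub, neg_eq_zero, ite_eq_right_iff]
        rintro ⟨h1, h2⟩
        exact absurd (h1.symm.trans h2) hij
    rw [this, Matrix.adjugate_diagonal]
    ext i j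
    by_cases hij : i = j
    · subst hij
      by_cases hio : i = o
      · subst hio
        rw [Matrix.diagonal_apply_eq, Matrix.single_apply_same]
        exact Finset.prod_eq_one fun j hj => by simp [Finset.ne_of_mem_erase hj]
      · rw [Matrix.diagonal_apply_eq, Finset.prod_eq_zero (i := o) (by simp [Ne.symm hio]) (by simp)]
        simp [Matrix.single_apply, Ne.symm hio]
    · rw [Matrix.diagonal_apply_ne _ hij, Matrix.single_apply, if_neg]
      rintro ⟨h1, h2⟩
      exact absurd (h1.symm.trans h2) hij
  have hgenb : ∀ (M : Matrix (Fin n) (Fin n) k) i j,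
      (Matrix.single o i 1 * M * Matrix.single j o 1 * Matrix.single o o 1).trace = M i j := by
    intro M i j
    simp [Matrix.mul_assoc, Matrix.trace_mul_comm (Matrix.single o i (1:k)),
      Matrix.trace_mul_single, Matrix.mul_apply, Matrix.single_apply]
  have hr : ∀ i, evalMat k b (r i) = Matrix.single o i 1 := fun i => hPb _
  have hs : ∀ i, evalMat k b (s i) = Matrix.single i o 1 := fun i => hPb _
  have hD1 : Da b 1 = 1 := by
    ext i j
    rw [hDa, hadj, hr, hs]
    have := hgenb 1 i j
    rwa [mul_one] at this
  have hc1 : ∀ h, ca b 1 h = b h := by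
    intro h
    ext i j
    rw [hca, hadj, hr, hs, hgenb]
  rw [hD1, Matrix.det_one, hF _ _ one_ne_zero] at ht
  simp only [one_mul, one_pow, Matrix.adjugate_one, hc1, div_one] at ht
  rw [← ht]
  unfold polyEval
  rw [MvPolynomial.aeval_eq_eval]

theorem aux_mem_of_vanish {n m : ℕ} (hn : 1 ≤ n) (X : Set (MTuple k n m)) (hX : IsNVariety k X)
    (b : MTuple k n m) (hb : b ∈ genTuples k n m)
    (H : ∀ p ∈ GMN k n m, (∀ a ∈ X, evalMat k a p = 0) → evalMat k b p = 0) : b ∈ X := by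
  obtain ⟨_, hinv, C, ⟨S, rfl⟩, hC⟩ := hX
  have : b ∈ {a | ∀ p ∈ S, polyEval k a p = 0} := fun p hp =>
    aux_sep_poly k hn X hinv b hb H p fun a ha => by
      rw [hC] at ha
      exact ha.1 p hp
  rw [hC]
  exact ⟨this, hb⟩

theorem aux_res_mem {n m : ℕ} (X : Set (MTuple k n m)) (p : MatPoly k n m) (hp : p ∈ GMN k n m) :
    restrictTo k X p ∈ coordRing k X := ⟨p, hp, rfl⟩

/-- restriction `G → k_n[X]` -/
def auxRes {n m : ℕ} (X : Set (MTuple k n m)) : ↥(GMN k n m) →ₐ[k] ↥(coordRing k X) :=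
  ((restrictTo k X).comp (GMN k n m).val).codRestrict _ fun p => aux_res_mem k X p.1 p.2

theorem auxRes_apply {n m : ℕ} (X : Set (MTuple k n m)) (p : ↥(GMN k n m)) (a : X) :
    (auxRes k X p : X → Matrix (Fin n) (Fin n) k) a = evalMat k a.1 p.1 := rfl

theorem auxRes_surj {n m : ℕ} (X : Set (MTuple k n m)) : Function.Surjective (auxRes k X) := by
  rintro ⟨_, p, hp, rfl⟩
  exact ⟨⟨p, hp⟩, rfl⟩

/-- generator in `G` -/
def auxGen (n m : ℕ) (h : Fin m) : ↥(GMN k n m) :=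
  ⟨genericMatrix k n m h, Algebra.subset_adjoin ⟨h, rfl⟩⟩

/-- evaluation `k_n[Y] → M_n` -/
def auxAt {n l : ℕ} (Y : Set (MTuple k n l)) (y : Y) :
    ↥(coordRing k Y) →ₐ[k] Matrix (Fin n) (Fin n) k :=
  (Pi.evalAlgHom k (fun _ : Y => Matrix (Fin n) (Fin n) k) y).comp (coordRing k Y).val

theorem aux_pull {n m l : ℕ} (X : Set (MTuple k n m)) (Y : Set (MTuple k n l))
    (α : ↥(coordRing k X) →ₐ[k] ↥(coordRing k Y)) (F : Fin m → ↥(GMN k n l))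
    (hF : ∀ h, auxRes k Y (F h) = α (auxRes k X (auxGen k n m h))) (y : Y) (p : ↥(GMN k n m)) :
    evalMat k (fun h => evalMat k y.1 (F h).1) p.1 = auxAt k Y y (α (auxRes k X p)) := by
  obtain ⟨p, hp⟩ := p
  unfold GMN at hp
  induction hp using Algebra.adjoin_induction with
  | mem x hx =>
    obtain ⟨h, rfl⟩ := hx
    have h1 := congrArg (auxAt k Y y) (hF h)
    refine Eq.trans (aux_evalMat_generic k _ h) ?_
    exact h1
  | algebraMap r =>
    have : (⟨algebraMap k (MatPoly k n m) r, (GMN k n m).algebraMap_mem r⟩ : ↥(GMN k n m))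
      = algebraMap k _ r := rfl
    change evalMat k _ (algebraMap k (MatPoly k n m) r) = auxAt k Y y (α (auxRes k X (algebraMap k (GMN k n m) r)))
    simp only [AlgHom.commutes]
  | add x z hx hz ihx ihz =>
    change evalMat k _ (x + z) = auxAt k Y y (α (auxRes k X ((⟨x, hx⟩ : GMN k n m) + ⟨z, hz⟩)))
    simp only [map_add]
    exact congrArg₂ _ ihx ihz
  | mul x z hx hz ihx ihz =>
    change evalMat k _ (x * z) = auxAt k Y y (α (auxRes k X ((⟨x, hx⟩ : GMN k n m) * ⟨z, hz⟩)))
    simp only [map_mul]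
    exact congrArg₂ _ ihx ihz

theorem aux_pull_mem {n m l : ℕ} (hn : 1 ≤ n) (X : Set (MTuple k n m)) (Y : Set (MTuple k n l))
    (hX : IsNVariety k X) (hY : IsNVariety k Y)
    (α : ↥(coordRing k X) ≃ₐ[k] ↥(coordRing k Y)) (F : Fin m → ↥(GMN k n l))
    (hF : ∀ h, auxRes k Y (F h) = α (auxRes k X (auxGen k n m h))) (y : MTuple k n l)
    (hy : y ∈ Y) : (fun h => evalMat k y (F h).1) ∈ X := by
  have hpull := aux_pull k X Y α F hF ⟨y, hy⟩
  refine aux_mem_of_vanish k hn X hX _ ?_ ?_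
  · change Algebra.adjoin k _ = ⊤
    rw [eq_top_iff]
    rintro M -
    obtain ⟨q, hq, hqM⟩ := aux_evalMat_surj k y (hY.1 hy) M
    obtain ⟨p, hp⟩ := auxRes_surj k X (α.symm (auxRes k Y ⟨q, hq⟩))
    have h1 := hpull p
    rw [hp] at h1
    have h2 : evalMat k (fun h => evalMat k y (F h).1) p.1 = M := by
      rw [h1, ← hqM]
      change auxAt k Y ⟨y, hy⟩ (α (α.symm (auxRes k Y ⟨q, hq⟩))) = _
      rw [AlgEquiv.apply_symm_apply]
      rfl
    rw [← h2]
    have h3 : (GMN k n m).map (evalMat k (fun h => evalMat k y (F h).1))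
        = Algebra.adjoin k (Set.range fun h => evalMat k y (F h).1) := by
      rw [show GMN k n m = Algebra.adjoin k (Set.range (genericMatrix k n m)) from rfl,
        AlgHom.map_adjoin, ← Set.range_comp]
      congr 2
      ext1 h
      exact aux_evalMat_generic k _ h
    rw [← h3]
    exact ⟨p.1, p.2, rfl⟩
  · intro p hp hv
    have h1 := hpull ⟨p, hp⟩
    have h2 : auxRes k X ⟨p, hp⟩ = 0 := by
      apply Subtype.ext
      funext a
      exact hv a.1 a.2
    rw [h2, map_zero, map_zero] at h1
    exact h1

theorem aux_comp {n m l : ℕ} (X : Set (MTuple k n m)) (φ : MTuple k n m → MTuple k n l)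
    (F : Fin l → MatPoly k n m) (hF : ∀ i, F i ∈ GMN k n m)
    (hφ : ∀ a ∈ X, ∀ i, φ a i = evalMat k a (F i)) (q : MatPoly k n l) (hq : q ∈ GMN k n l) :
    ∃ p ∈ GMN k n m, ∀ a ∈ X, evalMat k a p = evalMat k (φ a) q := by
  unfold GMN at hq
  induction hq using Algebra.adjoin_induction with
  | mem x hx =>
    obtain ⟨h, rfl⟩ := hx
    exact ⟨F h, hF h, fun a ha => by rw [aux_evalMat_generic, hφ a ha]⟩
  | algebraMap r => exact ⟨algebraMap k _ r, (GMN k n m).algebraMap_mem r, fun a ha => by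
      simp only [AlgHom.commutes]⟩
  | add x y _ _ hx hy =>
    obtain ⟨p, hp, h⟩ := hx
    obtain ⟨p', hp', h'⟩ := hy
    exact ⟨p + p', add_mem hp hp', fun a ha => by rw [map_add, map_add, h a ha, h' a ha]⟩
  | mul x y _ _ hx hy =>
    obtain ⟨p, hp, h⟩ := hx
    obtain ⟨p', hp', h'⟩ := hy
    exact ⟨p * p', mul_mem hp hp', fun a ha => by rw [map_mul, map_mul, h a ha, h' a ha]⟩

/-- pullback of functions along a map -/
def auxPull {n m l : ℕ} (X : Set (MTuple k n m)) (Y : Set (MTuple k n l)) (φ : X → Y) :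
    (Y → Matrix (Fin n) (Fin n) k) →ₐ[k] (X → Matrix (Fin n) (Fin n) k) :=
  AlgHom.pi fun a => Pi.evalAlgHom k (fun _ : Y => Matrix (Fin n) (Fin n) k) (φ a)

theorem aux_pull_exists {n m l : ℕ} (X : Set (MTuple k n m)) (Y : Set (MTuple k n l))
    (φ : MTuple k n m → MTuple k n l) (h : IsRegMapOn k X Y φ) :
    ∃ Φ : ↥(coordRing k Y) →ₐ[k] ↥(coordRing k X), ∀ g (a : MTuple k n m) (ha : a ∈ X),
      (Φ g : X → Matrix (Fin n) (Fin n) k) ⟨a, ha⟩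
        = (g : Y → Matrix (Fin n) (Fin n) k) ⟨φ a, h.1 a ha⟩ := by
  obtain ⟨hmap, F, hF, hφ⟩ := h
  refine ⟨((auxPull k X Y fun a => ⟨φ a.1, hmap a.1 a.2⟩).comp (coordRing k Y).val).codRestrict _
    ?_, fun g a ha => rfl⟩
  rintro ⟨_, q, hq, rfl⟩
  obtain ⟨p, hp, h⟩ := aux_comp k X φ F hF hφ q hq
  exact ⟨p, hp, funext fun a => h a.1 a.2⟩

/-- **Statement 14** (Lemma lem.reg1(c)).  Two `n`-varieties `X ⊆ U_{m,n}` and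
`Y ⊆ U_{l,n}` are isomorphic as `n`-varieties if and only if their
PI-coordinate rings `k_n[X]` and `k_n[Y]` are isomorphic as `k`-algebras. -/
theorem isomorphic_iff_coordinate_rings_isomorphic (n m l : ℕ)
    (hn : 1 ≤ n) (hm : 2 ≤ m) (hl : 2 ≤ l)
    (X : Set (MTuple k n m)) (Y : Set (MTuple k n l))
    (hX : IsNVariety k X) (hY : IsNVariety k Y) :
    NIsomorphic k X Y ↔ Nonempty (↥(coordRing k X) ≃ₐ[k] ↥(coordRing k Y)) := by
  constructor
  · rintro ⟨φ, ψ, hφ, hψ, h1, h2⟩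
    obtain ⟨Φ, hΦ⟩ := aux_pull_exists k X Y φ hφ
    obtain ⟨Ψ, hΨ⟩ := aux_pull_exists k Y X ψ hψ
    refine ⟨AlgEquiv.ofAlgHom Ψ Φ ?_ ?_⟩
    · refine AlgHom.ext fun g => Subtype.ext (funext fun b => ?_)
      obtain ⟨b, hb⟩ := b
      change (Ψ (Φ g) : Y → Matrix (Fin n) (Fin n) k) ⟨b, hb⟩ = g.1 ⟨b, hb⟩
      rw [hΨ, hΦ]
      exact congrArg g.1 (Subtype.ext (h2 b hb))
    · refine AlgHom.ext fun g => Subtype.ext (funext fun a => ?_)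
      obtain ⟨a, ha⟩ := a
      change (Φ (Ψ g) : X → Matrix (Fin n) (Fin n) k) ⟨a, ha⟩ = g.1 ⟨a, ha⟩
      rw [hΦ, hΨ]
      exact congrArg g.1 (Subtype.ext (h1 a ha))
  · rintro ⟨α⟩
    choose F hF using fun h => auxRes_surj k Y (α (auxRes k X (auxGen k n m h)))
    choose F' hF' using fun h => auxRes_surj k X (α.symm (auxRes k Y (auxGen k n l h)))
    refine ⟨fun a i => evalMat k a (F' i).1, fun b h => evalMat k b (F h).1,
      ⟨fun a ha => aux_pull_mem k hn Y X hY hX α.symm F' hF' a ha,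
        fun i => (F' i).1, fun i => (F' i).2, fun a _ i => rfl⟩,
      ⟨fun b hb => aux_pull_mem k hn X Y hX hY α F hF b hb,
        fun i => (F i).1, fun i => (F i).2, fun a _ i => rfl⟩, ?_, ?_⟩
    · intro a ha
      funext h
      have := aux_pull k Y X α.symm F' hF' ⟨a, ha⟩ (F h)
      refine Eq.trans this ?_
      rw [hF]
      change auxAt k X ⟨a, ha⟩ (α.symm (α _)) = _
      rw [AlgEquiv.symm_apply_apply]
      exact aux_evalMat_generic k a h
    · intro b hb
      funext h
      have := aux_pull k X Y α F hF ⟨b, hb⟩ (F' h)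
      refine Eq.trans this ?_
      rw [hF']
      change auxAt k Y ⟨b, hb⟩ (α (α.symm _)) = _
      rw [AlgEquiv.apply_symm_apply]
      exact aux_evalMat_generic k b h

end
end
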